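/- arXiv:1711.06941 — 2 statements merged into one kernel-verified Lean document; each statement's English description precedes it below -/
import Mathlib

section
/- Let (p_{n,k}) be the family of probability distributions on ℕ determined by p_{0,0} = δ_1, p_{n,0} = δ_0 for n ≥ 1, p_{0,k} = δ_0 for k ≥ 1, and, for n, k ≥ 1, p_{n,k} equal to the law of X + Y where J is Binomial(n−1, 1/2)-distributed and, conditionally on J = j, the random variables X and Y are independent with laws p_{j,k−1} and p_{n−1−j,k−1} respectively (p_{n,k} is the law of the external profile B_{n,k} of a random symmetric digital search tree; its mean equals μ_{n,k} and its variance equals σ_{n,k}² := ν_{n,k} − μ_{n,k}²). Then for every function k : ℕ → ℕ with k(n) ≤ n for all n such that σ_{n,k(n)}² → ∞, the law of (B_{n,k(n)} − μ_{n,k(n)})/σ_{n,k(n)} (i.e., the pushforward of p_{n,k(n)} under x ↦ (x − μ_{n,k(n)})/σ_{n,k(n)}) converges weakly to the standard normal distribution N(0,1) as n → ∞. -/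
open Filter Real MeasureTheory ProbabilityTheory

/-- Expected external profile `μ_{n,k}`. -/
noncomputable def mu : ℕ → ℕ → ℝ
  | n, 0 => if n = 0 then 1 else 0
  | n, k + 1 => (2:ℝ)^((2:ℤ) - (n:ℤ)) *
      ∑ j ∈ Finset.range n, ((n-1).choose j : ℝ) * mu j k

/-- Second moment `ν_{n,k}` of the external profile. -/
noncomputable def nu : ℕ → ℕ → ℝ
  | n, 0 => if n = 0 then 1 else 0
  | n, k + 1 => (2:ℝ)^((2:ℤ) - (n:ℤ)) *
      (∑ j ∈ Finset.range n, ((n-1).choose j : ℝ) * nu j k)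
    + (2:ℝ)^((2:ℤ) - (n:ℤ)) *
      (∑ j ∈ Finset.range n, ((n-1).choose j : ℝ) * mu j k * mu (n-1-j) k)

/-- Probability mass function `q n k m = P(B_{n,k} = m)` of the external profile:
`p_{0,0} = δ_1`, `p_{n,0} = δ_0` for `n ≥ 1`, `p_{0,k} = δ_0` for `k ≥ 1`, and for `n,k ≥ 1`
`p_{n,k}` is the law of `X + Y` where `J ~ Binomial(n−1,1/2)` and, given `J = j`,
`X ~ p_{j,k−1}` and `Y ~ p_{n−1−j,k−1}` are independent (convolution). -/
noncomputable def q : ℕ → ℕ → ℕ → ℝ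
  | n, 0, m => if n = 0 then (if m = 1 then 1 else 0) else (if m = 0 then 1 else 0)
  | n, k + 1, m =>
    if n = 0 then (if m = 0 then 1 else 0)
    else ∑ j ∈ Finset.range n, (2:ℝ)^((1:ℤ) - (n:ℤ)) * ((n-1).choose j : ℝ) *
          ∑ a ∈ Finset.range (m+1), q j k a * q (n-1-j) k (m-a)

/-- The law of the standardized external profile `(B_{n,k} − μ_{n,k})/σ_{n,k}`,
as a measure on `ℝ`. -/
noncomputable def standardizedProfileLaw (n k : ℕ) : Measure ℝ :=
  Measure.sum (fun m : ℕ => ENNReal.ofReal (q n k m) •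
    Measure.dirac (((m:ℝ) - mu n k) / Real.sqrt (nu n k - (mu n k)^2)))


noncomputable def bw (m j : ℕ) : ℝ := (m.choose j : ℝ) / 2 ^ m

noncomputable def Em (m : ℕ) (f : ℕ → ℝ) : ℝ := ∑ j ∈ Finset.range (m+1), bw m j * f j

lemma bw_nonneg (m j : ℕ) : 0 ≤ bw m j := by unfold bw; positivity

lemma Em_congr {m : ℕ} {f g : ℕ → ℝ} (h : ∀ j ≤ m, f j = g j) : Em m f = Em m g := by
  unfold Em
  refine Finset.sum_congr rfl fun j hj => ?_
  rw [h j (by simpa [Nat.lt_succ_iff] using hj)]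

lemma Em_mono {m : ℕ} {f g : ℕ → ℝ} (h : ∀ j ≤ m, f j ≤ g j) : Em m f ≤ Em m g := by
  unfold Em
  refine Finset.sum_le_sum fun j hj => ?_
  exact mul_le_mul_of_nonneg_left (h j (by simpa [Nat.lt_succ_iff] using hj)) (bw_nonneg _ _)

lemma Em_add (m : ℕ) (f g : ℕ → ℝ) : Em m (fun j => f j + g j) = Em m f + Em m g := by
  simp [Em, mul_add, Finset.sum_add_distrib]

lemma Em_sub (m : ℕ) (f g : ℕ → ℝ) : Em m (fun j => f j - g j) = Em m f - Em m g := by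
  simp [Em, mul_sub, Finset.sum_sub_distrib]

lemma Em_mul (m : ℕ) (c : ℝ) (f : ℕ → ℝ) : Em m (fun j => c * f j) = c * Em m f := by
  simp only [Em, Finset.mul_sum]
  exact Finset.sum_congr rfl fun j _ => by ring

lemma bw_sum (m : ℕ) : ∑ j ∈ Finset.range (m+1), bw m j = 1 := by
  unfold bw
  rw [← Finset.sum_div]
  have := Nat.sum_range_choose m
  rw [div_eq_one_iff_eq (by positivity)]
  exact_mod_cast this

lemma Em_const (m : ℕ) (c : ℝ) : Em m (fun _ => c) = c := by
  simp [Em, ← Finset.sum_mul, bw_sum]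

lemma Em_nonneg {m : ℕ} {f : ℕ → ℝ} (h : ∀ j ≤ m, 0 ≤ f j) : 0 ≤ Em m f := by
  have := Em_mono (m := m) (f := fun _ => 0) (g := f) h
  rwa [Em_const] at this

lemma Em_abs (m : ℕ) (f : ℕ → ℝ) : |Em m f| ≤ Em m (fun j => |f j|) := by
  unfold Em
  refine (Finset.abs_sum_le_sum_abs _ _).trans (le_of_eq ?_)
  exact Finset.sum_congr rfl fun j _ => by rw [abs_mul, abs_of_nonneg (bw_nonneg _ _)]

lemma Em_zero (f : ℕ → ℝ) : Em 0 f = f 0 := by simp [Em, bw]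

lemma Em_one (f : ℕ → ℝ) : Em 1 f = (f 0 + f 1) / 2 := by
  simp [Em, bw, Finset.sum_range_succ]; ring

lemma Em_succ (m : ℕ) (f : ℕ → ℝ) :
    Em (m+1) f = (Em m f + Em m (fun j => f (j+1))) / 2 := by
  have := Finset.sum_choose_succ_mul (R := ℝ) (fun i _ => f i) m
  unfold Em bw
  simp only [div_mul_eq_mul_div]
  rw [← Finset.sum_div, ← Finset.sum_div, ← Finset.sum_div, this]
  field_simp
  ring

lemma Em_reflect (m : ℕ) (f : ℕ → ℝ) : Em m (fun j => f (m - j)) = Em m f := by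
  unfold Em
  rw [← Finset.sum_range_reflect]
  refine Finset.sum_congr rfl fun j hj => ?_
  have hj : j ≤ m := by simpa [Nat.lt_succ_iff] using hj
  have h1 : m + 1 - 1 - j = m - j := by omega
  have h2 : m - (m - j) = j := by omega
  simp only [h1, h2]
  unfold bw
  rw [Nat.choose_symm hj]

/-- index raising -/
lemma Em_two (m : ℕ) (f : ℕ → ℝ) :
    ((m:ℝ)+2) * (m+1) * Em m f ≤
      4 * Em (m+2) (fun j => (j:ℝ) * (j-1) * f (j-2)) := by
  unfold Em
  rw [Finset.sum_range_succ' _ (m+2), Finset.sum_range_succ' _ (m+1)]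
  simp only [Nat.cast_zero, zero_mul, mul_zero, add_zero, Nat.cast_add, Nat.cast_one,
    zero_add, sub_self]
  rw [Finset.mul_sum, Finset.mul_sum]
  refine Finset.sum_le_sum fun j _ => ?_
  have e1 : (j + 1 + 1 - 2) = j := by omega
  rw [e1]
  have h1 := Nat.add_one_mul_choose_eq (m+1) (j+1)
  have h2 := Nat.add_one_mul_choose_eq m j
  have h1' : ((m:ℝ)+2) * ((m+1).choose (j+1) : ℝ) = ((m+2).choose (j+2) : ℝ) * (j+2) := by
    have : (((m+1+1) * (m+1).choose (j+1) : ℕ):ℝ) = (((m+1+1).choose (j+1+1) * (j+1+1) : ℕ) : ℝ) := by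
      exact_mod_cast h1
    push_cast at this
    have e : (m:ℝ)+1+1 = m+2 := by ring
    have e' : (j:ℝ)+1+1 = j+2 := by ring
    rw [e, e'] at this
    exact this
  have h2' : ((m:ℝ)+1) * (m.choose j : ℝ) = ((m+1).choose (j+1) : ℝ) * (j+1) := by
    exact_mod_cast h2
  unfold bw
  have : ((m:ℝ)+2) * (m+1) * (m.choose j : ℝ) = ((m+2).choose (j+2) : ℝ) * (j+2) * (j+1) := by
    rw [mul_assoc, h2', ← mul_assoc, h1']
  apply le_of_eq
  have e3 : m + 2 = m + 1 + 1 := rfl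
  have e4 : j + 2 = j + 1 + 1 := rfl
  calc _ = (((m:ℝ)+2) * (m+1) * (m.choose j : ℝ)) * f j / 2^m := by ring
    _ = _ := by
      rw [this]
      simp only [e4]
      rw [pow_add]
      field_simp
      ring

noncomputable def Vr (m : ℕ) (f : ℕ → ℝ) : ℝ := Em m (fun j => f j ^ 2) - (Em m f) ^ 2

lemma Vr_eq (m : ℕ) (f : ℕ → ℝ) : Vr m f = Em m (fun j => (f j - Em m f)^2) := by
  have : (fun j => (f j - Em m f)^2) =
      fun j => (f j ^ 2 - (2 * Em m f) * f j) + (Em m f)^2 := by funext j; ring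
  rw [this, Em_add, Em_sub, Em_mul, Em_const]
  unfold Vr; ring

lemma Vr_nonneg (m : ℕ) (f : ℕ → ℝ) : 0 ≤ Vr m f := by
  rw [Vr_eq]; exact Em_nonneg fun j _ => sq_nonneg _

lemma Vr_congr {m : ℕ} {f g : ℕ → ℝ} (h : ∀ j ≤ m, f j = g j) : Vr m f = Vr m g := by
  unfold Vr
  rw [Em_congr h, Em_congr (f := fun j => f j ^ 2) (g := fun j => g j ^ 2)]
  intro j hj; simp [h j hj]

lemma poincare (m : ℕ) : ∀ f : ℕ → ℝ,
    Vr (m+1) f ≤ ((m:ℝ)+1)/4 * Em m (fun j => (f (j+1) - f j)^2) := by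
  induction m with
  | zero =>
    intro f
    simp only [Vr, zero_add, Em_one, Em_zero]
    push_cast
    nlinarith
  | succ m ih =>
    intro f
    have h1 := ih f
    have h2 := ih (fun j => f (j+1))
    have h3 := Em_succ (m+1) f
    have h4 := Em_succ (m+1) (fun j => f j ^ 2)
    have h5 := Em_succ m (fun j => (f (j+1) - f j)^2)
    have h6 := Vr_nonneg (m+1) (fun j => f (j+1) - f j)
    have h7 := Em_sub (m+1) (fun j => f (j+1)) f
    simp only [Vr] at h1 h2 h6 ⊢
    rw [h7] at h6
    rw [h3, h4]
    push_cast
    generalize Em (m+1) (fun j => (f (j+1) - f j)^2) = D at *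
    generalize Em m (fun j => (f (j+1) - f j)^2) = D1 at *
    generalize Em m (fun j => (f (j+1+1) - f (j+1))^2) = D2 at *
    generalize Em (m+1) f = A at *
    generalize Em (m+1) (fun j => f (j+1)) = B at *
    generalize Em (m+1) (fun j => f j^2) = P at *
    generalize Em (m+1) (fun j => f (j+1)^2) = Q at *
    subst h5
    nlinarith

/-- two-step Poincaré for symmetrized functions -/
lemma poincare2 (m : ℕ) (w : ℕ → ℝ) :
    Vr (m+2) (fun j => w j + w (m+2-j)) ≤
      ((m:ℝ)+2)*(m+1)/4 * Em m (fun j => (w (j+2) - 2 * w (j+1) + w j)^2) := by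
  set h : ℕ → ℝ := fun j => w j + w (m+2-j) with hh
  have h1 := poincare (m+1) h
  have h2 := poincare m (fun j => h (j+1) - h j)
  have h0 : Em (m+1) (fun j => h (j+1) - h j) = 0 := by
    have e : Em (m+1) (fun j => h (j+1) - h j) =
        Em (m+1) (fun j => (w (j+1) - w j) - (fun i => (w (i+1) - w i)) (m+1-j)) := by
      refine Em_congr fun j hj => ?_
      have e1 : m + 2 - (j+1) = m+1-j := by omega
      have e2 : m + 2 - j = m+1-j+1 := by omega
      simp only [hh, e1, e2]; ring
    rw [e, Em_sub, Em_reflect (m+1) (fun i => (w (i+1) - w i))]; ring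
  have h3 : Em (m+1) (fun j => (h (j+1) - h j)^2) = Vr (m+1) (fun j => h (j+1) - h j) := by
    unfold Vr; rw [h0]; ring
  have h4 : Em m (fun j => (h (j+1+1) - h (j+1) - (h (j+1) - h j))^2) ≤
      4 * Em m (fun j => (w (j+2) - 2 * w (j+1) + w j)^2) := by
    set d : ℕ → ℝ := fun j => (w (j+2) - 2 * w (j+1) + w j) with hd
    have : Em m (fun j => (h (j+1+1) - h (j+1) - (h (j+1) - h j))^2) ≤
       Em m (fun j => 2 * (d j ^2) + 2 * ((fun i => d i ^ 2) (m-j))) := by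
      refine Em_mono fun j hj => ?_
      have e1 : m + 2 - (j+1+1) = m-j := by omega
      have e2 : m + 2 - (j+1) = m-j+1 := by omega
      have e3 : m + 2 - j = m-j+2 := by omega
      have : h (j+1+1) - h (j+1) - (h (j+1) - h j) = d j + d (m-j) := by
        simp only [hh, e1, e2, e3, hd]; ring
      rw [this]
      nlinarith [sq_nonneg (d j - d (m-j))]
    refine this.trans (le_of_eq ?_)
    rw [Em_add, Em_mul, Em_mul, Em_reflect m (fun i => d i ^ 2)]
    ring
  rw [h3] at h1
  push_cast at h1
  have hm : (0:ℝ) ≤ m := Nat.cast_nonneg m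
  calc Vr (m+2) h ≤ ((m:ℝ)+1+1)/4 * Vr (m+1) (fun j => h (j+1) - h j) := h1
    _ ≤ ((m:ℝ)+1+1)/4 * (((m:ℝ)+1)/4 *
        (4 * Em m (fun j => (w (j+2) - 2 * w (j+1) + w j)^2))) := by
        gcongr
        refine h2.trans ?_
        gcongr
    _ = _ := by ring


noncomputable def pp (n k : ℕ) : ℝ := mu n k / 2 ^ k

lemma mu_zero_right (n : ℕ) : mu n 0 = if n = 0 then 1 else 0 := by rw [mu]

lemma mu_zero_succ (k : ℕ) : mu 0 (k+1) = 0 := by rw [mu]; simp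

lemma zp (n : ℕ) : (2:ℝ)^((2:ℤ) - ((n+1:ℕ):ℤ)) = 2 / 2^n := by
  have : (2:ℤ) - ((n+1:ℕ):ℤ) = 1 - (n:ℤ) := by push_cast; ring
  rw [this, zpow_sub₀ (by norm_num)]
  simp

lemma mu_succ (n k : ℕ) : mu (n+1) (k+1) = 2 * Em n (fun j => mu j k) := by
  rw [mu, zp]
  unfold Em bw
  rw [Finset.mul_sum, Finset.mul_sum]
  refine Finset.sum_congr rfl fun j _ => ?_
  simp only [Nat.add_sub_cancel]
  ring

lemma mu_eq_pp (n k : ℕ) : mu n k = 2^k * pp n k := by unfold pp; field_simp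

lemma pp_zero_right (n : ℕ) : pp n 0 = if n = 0 then 1 else 0 := by
  simp [pp, mu_zero_right]

lemma pp_zero_succ (k : ℕ) : pp 0 (k+1) = 0 := by simp [pp, mu_zero_succ]

lemma pp_succ (n k : ℕ) : pp (n+1) (k+1) = Em n (fun j => pp j k) := by
  unfold pp
  rw [mu_succ]
  have : (fun j => mu j k / 2^k) = fun j => (1/2^k) * mu j k := by funext j; ring
  rw [this, Em_mul, pow_succ]
  field_simp

lemma pp_nonneg (n k : ℕ) : 0 ≤ pp n k := by
  induction k generalizing n with
  | zero => rw [pp_zero_right]; split_ifs <;> norm_num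
  | succ k ih =>
    cases n with
    | zero => rw [pp_zero_succ]
    | succ n => rw [pp_succ]; exact Em_nonneg fun j _ => ih j

lemma pp_le_one (n k : ℕ) : pp n k ≤ 1 := by
  induction k generalizing n with
  | zero => rw [pp_zero_right]; split_ifs <;> norm_num
  | succ k ih =>
    cases n with
    | zero => rw [pp_zero_succ]; norm_num
    | succ n =>
      rw [pp_succ]
      have := Em_mono (m := n) (f := fun j => pp j k) (g := fun _ => 1) (fun j _ => ih j)
      rwa [Em_const] at this

lemma mu_nonneg (n k : ℕ) : 0 ≤ mu n k := by
  rw [mu_eq_pp]; have := pp_nonneg n k; positivity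

lemma pp_succ_zero (n : ℕ) : pp (n+1) 0 = 0 := by simp [pp_zero_right]

lemma morris (n k : ℕ) :
    pp (n+1) (k+1) = (1 - 1/2^(k+1)) * pp n (k+1) + (1/2^k) * pp n k := by
  induction k generalizing n with
  | zero =>
    cases n with
    | zero => rw [pp_succ, Em_zero, pp_zero_succ]; simp
    | succ n =>
      rw [pp_succ, pp_succ_zero, Em_succ, pp_succ]
      have : (fun j => pp (j+1) 0) = fun _ => 0 := by funext j; exact pp_succ_zero j
      rw [this, Em_const]; norm_num; ring
  | succ k ih =>
    cases n with
    | zero => rw [pp_succ, Em_zero, pp_zero_succ, pp_zero_succ]; simp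
    | succ n =>
      rw [pp_succ, Em_succ, pp_succ n (k+1), pp_succ n k]
      have : (fun j => pp (j+1) (k+1)) =
        fun j => (1 - 1/2^(k+1)) * pp j (k+1) + (1/2^k) * pp j k := by funext j; exact ih j
      rw [this, Em_add, Em_mul, Em_mul]
      field_simp
      ring

lemma ratio (n : ℕ) : ∀ k : ℕ, ((n:ℝ)+1) * pp n k ≤ ((k:ℝ)+1) * 2^k * pp (n+1) (k+1) := by
  induction n with
  | zero =>
    intro k
    cases k with
    | zero => rw [pp_succ, Em_zero]; simp
    | succ k => rw [pp_zero_succ]; have := pp_nonneg (0+1) (k+1+1); simp only [mul_zero]; positivity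
  | succ n ih =>
    intro k
    cases k with
    | zero => rw [pp_succ_zero]; have := pp_nonneg (n+1+1) (0+1); simp only [mul_zero]; positivity
    | succ k =>
      have h1 := ih (k+1)
      have h2 := ih k
      rw [morris (n+1) (k+1)]
      have h3 := morris n k
      have h4 := pp_nonneg (n+1) (k+1)
      have h5 := pp_nonneg (n+1) (k+1+1)
      push_cast at h1 h2 ⊢
      have hk : (0:ℝ) < 2^k := by positivity
      have e1 : ((n:ℝ)+1) * pp (n+1) (k+1) ≤ (1 - 1/2^(k+1)) * (((k:ℝ)+1+1) * 2^(k+1) * pp (n+1) (k+1+1))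
          + (1/2^k) * (((k:ℝ)+1) * 2^k * pp (n+1) (k+1)) := by
        have hh : (0:ℝ) ≤ 1 - 1/2^(k+1) := by
          rw [sub_nonneg, div_le_one (by positivity)]; exact one_le_pow₀ (by norm_num)
        calc ((n:ℝ)+1) * pp (n+1) (k+1) = (1 - 1/2^(k+1)) * (((n:ℝ)+1) * pp n (k+1)) + (1/2^k) * (((n:ℝ)+1) * pp n k) := by
              rw [h3]; ring
          _ ≤ _ := by gcongr
      have e2 : (1/2^k) * (((k:ℝ)+1) * 2^k * pp (n+1) (k+1)) = ((k:ℝ)+1) * pp (n+1) (k+1) := by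
        field_simp
      have e3 : ((k:ℝ) + 1 + 1) * 2 ^ (k + 1) * ((1 - 1 / 2 ^ (k + 1 + 1)) * pp (n + 1) (k + 1 + 1) + 1 / 2 ^ (k + 1) * pp (n + 1) (k + 1))
         = (1 - 1/2^(k+1)) * (((k:ℝ)+1+1) * 2^(k+1) * pp (n+1) (k+1+1)) + ((k:ℝ)+1+1) /2 * pp (n+1) (k+1+1) + ((k:ℝ)+1+1) * pp (n+1) (k+1) := by
        field_simp
        ring
      rw [e3]
      rw [e2] at e1
      have : 0 ≤ ((k:ℝ)+1+1) /2 * pp (n+1) (k+1+1) := by positivity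
      linarith

lemma pp_half (n k : ℕ) : pp n (k+1) ≤ 2 * pp (n+1) (k+1) := by
  rw [morris]
  have h1 := pp_nonneg n (k+1)
  have h2 := pp_nonneg n k
  have h3 : 0 ≤ (1/2^k : ℝ) * pp n k := by positivity
  have h4 : (1:ℝ)/2^(k+1) ≤ 1/2 := by
    rw [pow_succ]
    gcongr
    have : (1:ℝ) ≤ 2^k := one_le_pow₀ (by norm_num)
    linarith
  nlinarith

lemma pp_step (n k : ℕ) : pp (n+1) (k+1) ≤ pp n (k+1) + pp n k := by
  rw [morris]
  have h1 := pp_nonneg n (k+1)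
  have h2 := pp_nonneg n k
  have h4 : (1:ℝ)/2^k ≤ 1 := by
    rw [div_le_one (by positivity)]; exact one_le_pow₀ (by norm_num)
  have h5 : (0:ℝ) ≤ 1/2^(k+1) := by positivity
  nlinarith

lemma mu_diff2 (n k : ℕ) : |mu (n+2) (k+2) - 2 * mu (n+1) (k+2) + mu n (k+2)| ≤
    8 / 2^(k+2) * (pp n (k+2) + pp n (k+1) + pp n k) := by
  have h1 := morris (n+1) (k+1)
  have h2 := morris n (k+1)
  have h3 := morris n k
  have : mu (n+2) (k+2) - 2 * mu (n+1) (k+2) + mu n (k+2) =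
      1/2^(k+2) * (8 * pp n k - 6 * pp n (k+1) + pp n (k+2)) := by
    rw [mu_eq_pp, mu_eq_pp, mu_eq_pp, h1, h2, h3]
    field_simp
    ring
  rw [this, abs_mul, abs_of_nonneg (by positivity)]
  have a := pp_nonneg n k
  have b := pp_nonneg n (k+1)
  have c := pp_nonneg n (k+2)
  rw [div_mul_eq_mul_div, div_mul_eq_mul_div, one_mul]
  gcongr
  rw [abs_le]; constructor <;> linarith

lemma sq3 (a b c : ℝ) : (a+b+c)^2 ≤ 3*(a^2+b^2+c^2) := by
  nlinarith [sq_nonneg (a-b), sq_nonneg (a-c), sq_nonneg (b-c)]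

set_option maxHeartbeats 2000000 in
lemma sqbound (j k : ℕ) :
    ((j:ℝ)+2) * (j+1) * (pp j (k+2) + pp j (k+1) + pp j k)^2 ≤
      30 * ((k:ℝ)+4)^2 * (2^(k+2))^2 * pp (j+2) (k+2) := by
  have hj : (0:ℝ) ≤ j := Nat.cast_nonneg j
  have hk : (0:ℝ) ≤ k := Nat.cast_nonneg k
  set P : ℝ := pp (j+2) (k+2) with hP
  set X : ℝ := 2^(k+2) with hX
  have hX0 : 0 < X := by positivity
  have hP0 : 0 ≤ P := pp_nonneg _ _
  have x0 : (2:ℝ)^k = X/4 := by rw [hX]; ring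
  have x1 : (2:ℝ)^(k+1) = X/2 := by rw [hX]; ring
  have x3 : (2:ℝ)^(k+3) = 2*X := by rw [hX]; ring
  -- term a: pp j k
  have a0 := pp_nonneg j k
  have a1 := pp_le_one j k
  have b0 := pp_nonneg j (k+1)
  have b1 := pp_le_one j (k+1)
  have c0 := pp_nonneg j (k+2)
  have r1 := ratio j k
  have r2 := ratio (j+1) (k+1)
  have r3 := ratio j (k+1)
  have r4 := ratio j (k+2)
  have r5 := ratio (j+1) (k+3)
  have s1 : pp (j+1) (k+2) ≤ 2 * P := pp_half (j+1) (k+1)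
  have s2 : pp j (k+2) ≤ 2 * pp (j+1) (k+2) := pp_half j (k+1)
  have l1 := pp_le_one (j+1) (k+2)
  have l2 := pp_le_one (j+2) (k+4)
  have n1 := pp_nonneg (j+1) (k+2)
  have n2 := pp_nonneg (j+1) (k+1)
  have n3 := pp_nonneg (j+1) (k+3)
  rw [x0] at r1
  rw [x1] at r2 r3
  rw [x3] at r5
  rw [← hX] at r4
  push_cast at r2 r3 r4 r5
  have e1 : (j:ℝ)+1+1 = j+2 := by ring
  have e2 : (k:ℝ)+1+1 = k+2 := by ring
  have e3 : (k:ℝ)+2+1 = k+3 := by ring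
  have e4 : (k:ℝ)+3+1 = k+4 := by ring
  rw [e1, e2] at r2
  rw [e2] at r3
  rw [e3] at r4
  rw [e1, e4] at r5
  have ta : ((j:ℝ)+2) * (j+1) * (pp j k)^2 ≤ (k+4)^2 * X^2 * P := by
    calc ((j:ℝ)+2) * (j+1) * (pp j k)^2 ≤ ((j:ℝ)+2) * (j+1) * (pp j k) := by
            have : (pp j k)^2 ≤ pp j k := by nlinarith
            gcongr
      _ = ((j:ℝ)+2) * ((j+1) * pp j k) := by ring
      _ ≤ ((j:ℝ)+2) * ((k+1) * (X/4) * pp (j+1) (k+1)) := by gcongr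
      _ = ((k+1) * (X/4)) * (((j:ℝ)+2) * pp (j+1) (k+1)) := by ring
      _ ≤ ((k+1) * (X/4)) * ((k+2) * (X/2) * P) := by gcongr
      _ = ((k+1)*(k+2)/8) * X^2 * P := by ring
      _ ≤ _ := by gcongr; nlinarith
  have tb : ((j:ℝ)+2) * (j+1) * (pp j (k+1))^2 ≤ (k+4)^2 * X^2 * P := by
    calc ((j:ℝ)+2) * (j+1) * (pp j (k+1))^2 = (((j:ℝ)+2) * pp j (k+1)) * ((j+1) * pp j (k+1)) := by ring
      _ ≤ (2 * (((j:ℝ)+1) * pp j (k+1))) * ((j+1) * pp j (k+1)) := by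
            have hu : ((j:ℝ)+2) * pp j (k+1) ≤ 2 * (((j:ℝ)+1) * pp j (k+1)) := by
              have : 0 ≤ (j:ℝ) * pp j (k+1) := by positivity
              linarith
            exact mul_le_mul_of_nonneg_right hu (by positivity)
      _ ≤ (2 * ((k+2) * (X/2) * pp (j+1) (k+2))) * ((k+2) * (X/2) * pp (j+1) (k+2)) := by gcongr
      _ ≤ (2 * ((k+2) * (X/2) * 1)) * ((k+2) * (X/2) * (2*P)) := by gcongr
      _ = (k+2)^2 * X^2 * P := by ring
      _ ≤ _ := by gcongr; norm_num
  have tc : ((j:ℝ)+2) * (j+1) * (pp j (k+2))^2 ≤ 8 * (k+4)^2 * X^2 * P := by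
    calc ((j:ℝ)+2) * (j+1) * (pp j (k+2))^2 = (((j:ℝ)+2) * ((j+1) * pp j (k+2))) * pp j (k+2) := by ring
      _ ≤ (((j:ℝ)+2) * ((k+3) * X * pp (j+1) (k+3))) * (4 * P) := by
            gcongr; linarith
      _ = ((k+3) * X * (((j:ℝ)+2) * pp (j+1) (k+3))) * (4 * P) := by ring
      _ ≤ ((k+3) * X * ((k+4) * (2*X) * 1)) * (4 * P) := by
            have hu : ((j:ℝ)+2) * pp (j+1) (k+3) ≤ (k+4) * (2*X) * 1 :=
              r5.trans (mul_le_mul_of_nonneg_left l2 (by positivity))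
            have hv : (k+3) * X * (((j:ℝ)+2) * pp (j+1) (k+3)) ≤ (k+3) * X * ((k+4) * (2*X) * 1) :=
              mul_le_mul_of_nonneg_left hu (by positivity)
            exact mul_le_mul_of_nonneg_right hv (by positivity)
      _ = 8 * ((k+3) * (k+4)) * X^2 * P := by ring
      _ ≤ _ := by gcongr; nlinarith
  have : (pp j (k+2) + pp j (k+1) + pp j k)^2 ≤ 3 * ((pp j (k+2))^2 + (pp j (k+1))^2 + (pp j k)^2) := sq3 _ _ _
  have hfin := mul_le_mul_of_nonneg_left this (show (0:ℝ) ≤ ((j:ℝ)+2) * (j+1) by positivity)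
  clear_value P X
  clear r1 r2 r3 r4 r5
  refine hfin.trans ?_
  have e : ((j:ℝ)+2) * (j+1) * (3 * ((pp j (k+2))^2 + (pp j (k+1))^2 + (pp j k)^2)) =
    3 * (((j:ℝ)+2) * (j+1) * (pp j (k+2))^2 + ((j:ℝ)+2) * (j+1) * (pp j (k+1))^2
      + ((j:ℝ)+2) * (j+1) * (pp j k)^2) := by ring
  rw [e]
  have e' : 30 * ((k:ℝ)+4)^2 * X^2 * P = 3 * (8 * (k+4)^2 * X^2 * P + (k+4)^2 * X^2 * P + (k+4)^2 * X^2 * P) := by ring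
  rw [e']
  gcongr

lemma varbound (w : ℕ → ℝ) (κ : ℝ) (k : ℕ)
    (hw : ∀ j, |w (j+2) - 2 * w (j+1) + w j| ≤ κ / 2^(k+2) * (pp j (k+2) + pp j (k+1) + pp j k))
    (n : ℕ) :
    Vr n (fun j => w j + w (n-j)) ≤ 30 * κ^2 * ((k:ℝ)+4)^2 * pp (n+1) (k+3) := by
  have hp := pp_nonneg (n+1) (k+3)
  have hr : 0 ≤ 30 * κ^2 * ((k:ℝ)+4)^2 * pp (n+1) (k+3) := by positivity
  match n, hr with
  | 0, hr => refine le_trans (le_of_eq ?_) hr; simp [Vr, Em_zero]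
  | 1, hr => refine le_trans (le_of_eq ?_) hr; simp [Vr, Em_one]; ring
  | m+2, _ =>
    refine (poincare2 m w).trans ?_
    have h1 := Em_two m (fun j => (w (j+2) - 2 * w (j+1) + w j)^2)
    have h2 : Em (m+2) (fun j => (j:ℝ) * (j-1) * (fun j => (w (j+2) - 2 * w (j+1) + w j)^2) (j-2))
       ≤ Em (m+2) (fun j => (30 * κ^2 * ((k:ℝ)+4)^2) * pp j (k+2)) := by
      refine Em_mono fun j _ => ?_
      have q0 := pp_nonneg j (k+2)
      match j, q0 with
      | 0, q0 => simp only [Nat.cast_zero, zero_mul]; positivity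
      | 1, q0 => simp only [Nat.cast_one, sub_self, mul_zero, zero_mul]; positivity
      | i+2, q0 =>
        have e : i + 2 - 2 = i := by omega
        simp only [e]
        push_cast
        have h3 := hw i
        have h4 := sqbound i k
        have h5 : (w (i+2) - 2 * w (i+1) + w i)^2 ≤ (κ / 2^(k+2) * (pp i (k+2) + pp i (k+1) + pp i k))^2 :=
          sq_le_sq' (by linarith [(abs_le.1 h3).1]) ((abs_le.1 h3).2)
        calc ((i:ℝ)+2) * (i+2-1) * (w (i+2) - 2 * w (i+1) + w i)^2
            ≤ ((i:ℝ)+2) * (i+2-1) * (κ / 2^(k+2) * (pp i (k+2) + pp i (k+1) + pp i k))^2 := by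
              gcongr
              have : (0:ℝ) ≤ i := Nat.cast_nonneg i
              apply mul_nonneg <;> linarith
          _ = (κ / 2^(k+2))^2 * (((i:ℝ)+2) * (i+1) * (pp i (k+2) + pp i (k+1) + pp i k)^2) := by ring
          _ ≤ (κ / 2^(k+2))^2 * (30 * ((k:ℝ)+4)^2 * (2^(k+2))^2 * pp (i+2) (k+2)) := by gcongr
          _ = _ := by field_simp
    rw [Em_mul] at h2
    have h3 : pp (m+2+1) (k+3) = Em (m+2) (fun j => pp j (k+2)) := pp_succ (m+2) (k+2)
    rw [h3]
    linarith


noncomputable def sg (n k : ℕ) : ℝ := nu n k - mu n k ^ 2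

lemma nu_zero_right (n : ℕ) : nu n 0 = if n = 0 then 1 else 0 := by rw [nu]

lemma nu_zero_succ (k : ℕ) : nu 0 (k+1) = 0 := by rw [nu]; simp

lemma nu_succ (n k : ℕ) : nu (n+1) (k+1) = 2 * Em n (fun j => nu j k)
    + 2 * Em n (fun j => mu j k * mu (n-j) k) := by
  rw [nu, zp]
  unfold Em bw
  rw [Finset.mul_sum, Finset.mul_sum, Finset.mul_sum, Finset.mul_sum]
  congr 1
  · refine Finset.sum_congr rfl fun j _ => ?_
    simp only [Nat.add_sub_cancel]
    ring
  · refine Finset.sum_congr rfl fun j _ => ?_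
    simp only [Nat.add_sub_cancel]
    ring

lemma sg_zero_right (n : ℕ) : sg n 0 = 0 := by
  unfold sg; rw [nu_zero_right, mu_zero_right]; split_ifs <;> norm_num

lemma sg_zero_succ (k : ℕ) : sg 0 (k+1) = 0 := by
  unfold sg; rw [nu_zero_succ, mu_zero_succ]; norm_num

lemma sg_zero (k : ℕ) : sg 0 k = 0 := by
  cases k
  · exact sg_zero_right 0
  · exact sg_zero_succ _

lemma sg_succ (n k : ℕ) : sg (n+1) (k+1) = Vr n (fun j => mu j k + mu (n-j) k)
    + 2 * Em n (fun j => sg j k) := by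
  unfold sg Vr
  rw [nu_succ, mu_succ, Em_sub, Em_add, Em_reflect n (fun j => mu j k)]
  have : (fun j => (mu j k + mu (n-j) k)^2) =
      fun j => (mu j k ^ 2 + mu (n-j) k ^2) + 2 * (mu j k * mu (n-j) k) := by
    funext j; ring
  rw [this, Em_add, Em_add, Em_mul, Em_reflect n (fun j => mu j k ^2)]
  ring

lemma sg_nonneg (n k : ℕ) : 0 ≤ sg n k := by
  induction k generalizing n with
  | zero => rw [sg_zero_right]
  | succ k ih =>
    cases n with
    | zero => rw [sg_zero_succ]
    | succ n =>
      rw [sg_succ]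
      have := Vr_nonneg n (fun j => mu j k + mu (n-j) k)
      have h2 := Em_nonneg (m := n) (f := fun j => sg j k) (fun j _ => ih j)
      linarith

lemma sg_ge (n k : ℕ) : 2 * Em n (fun j => sg j k) ≤ sg (n+1) (k+1) := by
  rw [sg_succ]; have := Vr_nonneg n (fun j => mu j k + mu (n-j) k); linarith

lemma sg_one (k : ℕ) : sg 1 k = 0 := by
  cases k with
  | zero => exact sg_zero_right 1
  | succ k => rw [sg_succ]; simp [Vr, Em_zero, sg_zero]

lemma sg_two (k : ℕ) : sg 2 k = 0 := by
  cases k with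
  | zero => exact sg_zero_right 2
  | succ k => rw [sg_succ]; simp [Vr, Em_one, sg_zero, sg_one]; ring

lemma q_zero (n m : ℕ) : q n 0 m = if n = 0 then (if m = 1 then 1 else 0) else (if m = 0 then 1 else 0) := by
  rw [q]

lemma q_zero_succ (k m : ℕ) : q 0 (k+1) m = if m = 0 then 1 else 0 := by
  rw [q]; simp

lemma zp1 (n : ℕ) : (2:ℝ)^((1:ℤ) - ((n+1:ℕ):ℤ)) = 1 / 2^n := by
  have : (1:ℤ) - ((n+1:ℕ):ℤ) = 0 - (n:ℤ) := by push_cast; ring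
  rw [this, zpow_sub₀ (by norm_num)]
  simp

lemma q_succ (n k m : ℕ) : q (n+1) (k+1) m =
    ∑ j ∈ Finset.range (n+1), bw n j * ∑ a ∈ Finset.range (m+1), q j k a * q (n-j) k (m-a) := by
  rw [q, zp1]
  simp only [Nat.add_sub_cancel, Nat.succ_ne_zero, if_false]
  refine Finset.sum_congr rfl fun j _ => ?_
  unfold bw
  ring

lemma q_nonneg (n k m : ℕ) : 0 ≤ q n k m := by
  induction k generalizing n m with
  | zero => rw [q_zero]; split_ifs <;> norm_num
  | succ k ih =>
    cases n with
    | zero => rw [q_zero_succ]; split_ifs <;> norm_num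
    | succ n =>
      rw [q_succ]
      exact Finset.sum_nonneg fun j _ => mul_nonneg (bw_nonneg _ _)
        (Finset.sum_nonneg fun a _ => mul_nonneg (ih _ _) (ih _ _))

lemma q_supp (n k m : ℕ) (h : 2^k < m) : q n k m = 0 := by
  induction k generalizing n m with
  | zero => rw [q_zero]; simp at h; have h1 : m ≠ 0 := by omega
            have h2 : m ≠ 1 := by omega
            simp [h1, h2]
  | succ k ih =>
    have h0 : m ≠ 0 := by rintro rfl; exact absurd h (Nat.not_lt_zero _)
    cases n with
    | zero => rw [q_zero_succ]; simp [h0]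
    | succ n =>
      rw [q_succ]
      refine Finset.sum_eq_zero fun j _ => ?_
      rw [Finset.sum_eq_zero, mul_zero]
      intro a ha
      rw [Finset.mem_range] at ha
      rw [pow_succ] at h
      by_cases hc : 2^k < a
      · rw [ih _ _ hc, zero_mul]
      · rw [ih _ (m-a) (by omega), mul_zero]

noncomputable def SS {E : Type} [AddCommGroup E] [Module ℝ E] (n k : ℕ) (g : ℕ → E) : E :=
  ∑ m ∈ Finset.range (2^k+1), q n k m • g m

lemma SS_ext {E : Type} [AddCommGroup E] [Module ℝ E] (n k M : ℕ) (g : ℕ → E) (h : 2^k+1 ≤ M) :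
    ∑ m ∈ Finset.range M, q n k m • g m = SS n k g := by
  unfold SS
  symm
  apply Finset.sum_subset
  · intro x; simp only [Finset.mem_range]; omega
  · intro x _ hx
    simp only [Finset.mem_range] at hx
    rw [q_supp _ _ _ (by omega), zero_smul]

lemma SS_zero {E : Type} [AddCommGroup E] [Module ℝ E] (n : ℕ) (g : ℕ → E) :
    SS n 0 g = if n = 0 then g 1 else g 0 := by
  unfold SS
  by_cases h : n = 0 <;> simp [Finset.sum_range_succ, q_zero, h]

lemma SS_zero_succ {E : Type} [AddCommGroup E] [Module ℝ E] (k : ℕ) (g : ℕ → E) :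
    SS 0 (k+1) g = g 0 := by
  unfold SS
  rw [Finset.sum_eq_single 0]
  · simp [q_zero_succ]
  · intro b _ hb; simp [q_zero_succ, hb]
  · simp

lemma SS_succ {E : Type} [AddCommGroup E] [Module ℝ E] (n k : ℕ) (g : ℕ → E) :
    SS (n+1) (k+1) g = ∑ j ∈ Finset.range (n+1), bw n j • SS j k (fun a => SS (n-j) k (fun b => g (a+b))) := by
  have h1 : ∀ j, ∑ m ∈ Finset.range (2^(k+1)+1), ∑ a ∈ Finset.range (m+1), (q j k a * q (n-j) k (m-a)) • g m
      = SS j k (fun a => SS (n-j) k (fun b => g (a+b))) := by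
    intro j
    have h2 : ∑ m ∈ Finset.range (2^(k+1)+1), ∑ a ∈ Finset.range (m+1), (q j k a * q (n-j) k (m-a)) • g m
       = ∑ m ∈ Finset.range (2^(k+1)+1), ∑ a ∈ Finset.range (m+1),
          (fun a b => (q j k a * q (n-j) k b) • g (a+b)) a (m-a) := by
      refine Finset.sum_congr rfl fun m _ => Finset.sum_congr rfl fun a ha => ?_
      rw [Finset.mem_range] at ha
      have : a + (m - a) = m := by omega
      simp only [this]
    rw [h2, Finset.sum_range_diag_flip (2^(k+1)+1) (fun a b => (q j k a * q (n-j) k b) • g (a+b))]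
    rw [← SS_ext j k (2^(k+1)+1) _ (by rw [pow_succ]; have := Nat.one_le_two_pow (n := k); omega)]
    refine Finset.sum_congr rfl fun a _ => ?_
    by_cases hc : 2^k < a
    · rw [q_supp _ _ _ hc, zero_smul]
      refine Finset.sum_eq_zero fun b _ => ?_
      rw [zero_mul, zero_smul]
    · rw [← SS_ext (n-j) k (2^(k+1)+1-a) _ (by rw [pow_succ]; omega), Finset.smul_sum]
      refine Finset.sum_congr rfl fun b _ => ?_
      rw [mul_smul]
  simp only [← h1]
  unfold SS
  simp only [q_succ, Finset.sum_smul, Finset.smul_sum, Finset.mul_sum]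
  rw [Finset.sum_comm]
  refine Finset.sum_congr rfl fun j _ => Finset.sum_congr rfl fun m _ => Finset.sum_congr rfl fun a _ => ?_
  rw [mul_smul]

lemma SS_add {E : Type} [AddCommGroup E] [Module ℝ E] (n k : ℕ) (f g : ℕ → E) :
    SS n k (fun m => f m + g m) = SS n k f + SS n k g := by
  simp [SS, Finset.sum_add_distrib]

lemma SS_sub {E : Type} [AddCommGroup E] [Module ℝ E] (n k : ℕ) (f g : ℕ → E) :
    SS n k (fun m => f m - g m) = SS n k f - SS n k g := by
  simp [SS, smul_sub]

lemma SS_smul {E : Type} [AddCommGroup E] [Module ℝ E] (n k : ℕ) (c : ℝ) (g : ℕ → E) :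
    SS n k (fun m => c • g m) = c • SS n k g := by
  simp only [SS, Finset.smul_sum]
  exact Finset.sum_congr rfl fun m _ => by rw [smul_comm]

lemma SS_const_one (n k : ℕ) : SS n k (fun _ => (1:ℝ)) = 1 := by
  induction k generalizing n with
  | zero => rw [SS_zero]; simp
  | succ k ih =>
    cases n with
    | zero => rw [SS_zero_succ]
    | succ n =>
      rw [SS_succ]
      simp only [ih, smul_eq_mul, mul_one, bw_sum]

lemma q_sum (n k : ℕ) : ∑ m ∈ Finset.range (2^k+1), q n k m = 1 := by
  have := SS_const_one n k
  simpa [SS] using this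

lemma SS_const {E : Type} [AddCommGroup E] [Module ℝ E] (n k : ℕ) (c : E) : SS n k (fun _ => c) = c := by
  unfold SS; rw [← Finset.sum_smul, q_sum, one_smul]

lemma Em_smul (n : ℕ) (f : ℕ → ℝ) : ∑ j ∈ Finset.range (n+1), bw n j • f j = Em n f := rfl

lemma SS_mul (n k : ℕ) (c : ℝ) (g : ℕ → ℝ) :
    SS n k (fun m => c * g m) = c * SS n k g := SS_smul n k c g

lemma SS_mean (n k : ℕ) : SS n k (fun m => (m:ℝ)) = mu n k := by
  induction k generalizing n with
  | zero => rw [SS_zero, mu_zero_right]; simp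
  | succ k ih =>
    cases n with
    | zero => rw [SS_zero_succ, mu_zero_succ]; simp
    | succ n =>
      rw [SS_succ, mu_succ]
      simp only [Nat.cast_add, SS_add, SS_const, ih]
      rw [Em_smul, Em_add, Em_reflect n (fun j => mu j k)]
      ring

lemma SS_sq (n k : ℕ) : SS n k (fun m => (m:ℝ)^2) = nu n k := by
  induction k generalizing n with
  | zero => rw [SS_zero, nu_zero_right]; simp
  | succ k ih =>
    cases n with
    | zero => rw [SS_zero_succ, nu_zero_succ]; simp
    | succ n =>
      rw [SS_succ, nu_succ]
      have h : ∀ j a : ℕ, SS (n-j) k (fun b => ((a+b:ℕ):ℝ)^2)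
          = (a:ℝ)^2 + 2 * mu (n-j) k * a + nu (n-j) k := by
        intro j a
        have : (fun b:ℕ => ((a+b:ℕ):ℝ)^2) = fun b:ℕ => ((a:ℝ)^2 + (2*a) * (b:ℝ)) + (b:ℝ)^2 := by
          funext b; push_cast; ring
        rw [this, SS_add, SS_add, SS_mul, SS_const, SS_mean, ih]
        ring
      simp only [h, SS_add, SS_const, SS_mul, ih, SS_mean]
      rw [Em_smul, Em_add, Em_add, Em_reflect n (fun j => nu j k)]
      have : (fun j => 2 * mu (n-j) k * mu j k) = fun j => 2 * (mu j k * mu (n-j) k) := by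
        funext j; ring
      rw [this, Em_mul]
      ring

lemma SS_mono (n k : ℕ) (f g : ℕ → ℝ) (h : ∀ m ≤ 2^k, f m ≤ g m) : SS n k f ≤ SS n k g := by
  unfold SS
  refine Finset.sum_le_sum fun m hm => ?_
  rw [Finset.mem_range] at hm
  exact mul_le_mul_of_nonneg_left (h m (by omega)) (q_nonneg _ _ _)

lemma SS_norm (n k : ℕ) (f : ℕ → ℂ) : ‖SS n k f‖ ≤ SS n k (fun m => ‖f m‖) := by
  unfold SS
  refine (norm_sum_le _ _).trans (le_of_eq ?_)
  refine Finset.sum_congr rfl fun m _ => ?_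
  rw [norm_smul, Real.norm_of_nonneg (q_nonneg _ _ _), smul_eq_mul]

lemma mu_le_nu (n k : ℕ) : mu n k ≤ nu n k := by
  rw [← SS_mean, ← SS_sq]
  refine SS_mono _ _ _ _ fun m _ => ?_
  rcases Nat.eq_zero_or_pos m with h | h
  · simp [h]
  · have : (1:ℝ) ≤ m := by exact_mod_cast h
    nlinarith

lemma nu_le (n k : ℕ) : nu n k ≤ 2^k * mu n k := by
  rw [← SS_mean, ← SS_sq, ← SS_mul]
  refine SS_mono _ _ _ _ fun m hm => ?_
  have : (m:ℝ) ≤ 2^k := by exact_mod_cast hm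
  have : (0:ℝ) ≤ m := Nat.cast_nonneg m
  nlinarith

lemma sg_le (n k : ℕ) : sg n k ≤ 4^k * pp n k := by
  have h := nu_le n k
  rw [mu_eq_pp, ← mul_assoc, ← mul_pow] at h
  norm_num at h
  unfold sg
  nlinarith [sq_nonneg (mu n k)]

lemma SS_cvar (n k : ℕ) : SS n k (fun m => ((m:ℝ) - mu n k)^2) = sg n k := by
  have : (fun m:ℕ => ((m:ℝ) - mu n k)^2) = fun m:ℕ => ((m:ℝ)^2 - (2*mu n k) * m) + mu n k ^2 := by
    funext m; ring
  rw [this, SS_add, SS_sub, SS_mul, SS_const, SS_mean, SS_sq]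
  unfold sg; ring

/-- characteristic function -/
noncomputable def ps (t : ℝ) (n k : ℕ) : ℂ := SS n k (fun m => Complex.exp (((t * m : ℝ) : ℂ) * Complex.I))

lemma SS_cmul (n k : ℕ) (c : ℂ) (g : ℕ → ℂ) :
    SS n k (fun m => c * g m) = c * SS n k g := by
  simp only [SS, Finset.mul_sum]
  exact Finset.sum_congr rfl fun m _ => by rw [mul_smul_comm]

lemma ps_zero_succ (t : ℝ) (k : ℕ) : ps t 0 (k+1) = 1 := by
  unfold ps; rw [SS_zero_succ]; simp

lemma ps_succ (t : ℝ) (n k : ℕ) : ps t (n+1) (k+1) =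
    ∑ j ∈ Finset.range (n+1), bw n j • (ps t j k * ps t (n-j) k) := by
  unfold ps
  rw [SS_succ]
  refine Finset.sum_congr rfl fun j _ => ?_
  congr 1
  have : ∀ a b : ℕ, Complex.exp (((t * (a+b:ℕ) : ℝ) : ℂ) * Complex.I)
      = Complex.exp (((t * a : ℝ) : ℂ) * Complex.I) * Complex.exp (((t * b : ℝ) : ℂ) * Complex.I) := by
    intro a b
    rw [← Complex.exp_add]
    congr 1
    push_cast; ring
  simp only [this, SS_cmul]
  simp only [mul_comm _ (SS (n-j) k _), SS_cmul]

lemma ps_norm (t : ℝ) (n k : ℕ) : ‖ps t n k‖ ≤ 1 := by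
  unfold ps
  refine (SS_norm _ _ _).trans ?_
  simp only [Complex.norm_exp_ofReal_mul_I, SS_const_one, le_refl]

lemma sg_ge_sub (n k : ℕ) : mu n k - mu n k ^ 2 ≤ sg n k := by
  have := mu_le_nu n k; unfold sg; linarith

lemma bw_pos {m j : ℕ} (h : j ≤ m) : 0 < bw m j := by
  unfold bw
  have : 0 < m.choose j := Nat.choose_pos h
  positivity

lemma sg_pos_up {n j k : ℕ} (h : j ≤ n) (hp : 0 < sg j k) : 0 < sg (n+1) (k+1) := by
  refine lt_of_lt_of_le ?_ (sg_ge n k)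
  have : bw n j * sg j k ≤ Em n (fun j => sg j k) := by
    unfold Em
    exact Finset.single_le_sum (f := fun j => bw n j * sg j k)
      (fun i _ => mul_nonneg (bw_nonneg _ _) (sg_nonneg _ _)) (Finset.mem_range.2 (by omega))
  have := mul_pos (bw_pos h) hp
  linarith

lemma Em_2 (f : ℕ → ℝ) : Em 2 f = (f 0 + 2 * f 1 + f 2) / 4 := by
  rw [Em_succ, Em_one, Em_one]; ring

lemma sg_three_pos (k : ℕ) (h : mu 0 k + mu 2 k ≠ 2 * mu 1 k) : 0 < sg 3 (k+1) := by
  rw [sg_succ]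
  simp only [Vr, Em_2, sg_zero, sg_one, sg_two]
  norm_num
  have : 0 < (mu 0 k + mu 2 k - 2 * mu 1 k)^2 := by
    have := sub_ne_zero.2 h
    positivity
  nlinarith

lemma mu_vals : mu 0 1 = 0 ∧ mu 1 1 = 2 ∧ mu 2 1 = 1 ∧ mu 1 2 = 0 ∧ mu 2 2 = 2 := by
  have a : mu 0 1 = 0 := mu_zero_succ 0
  have b : mu 1 1 = 2 := by rw [mu_succ 0 0, Em_zero, mu_zero_right]; norm_num
  have c : mu 2 1 = 1 := by rw [mu_succ 1 0, Em_one, mu_zero_right, mu_zero_right]; norm_num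
  have d : mu 1 2 = 0 := by rw [mu_succ 0 1, Em_zero, a]; norm_num
  have e : mu 2 2 = 2 := by rw [mu_succ 1 1, Em_one, a, b]; norm_num
  exact ⟨a, b, c, d, e⟩

lemma sg_n3_pos (n : ℕ) (hn : 3 ≤ n) : 0 < sg n 3 := by
  obtain ⟨a, b, c, d, e⟩ := mu_vals
  have h31 : 0 < sg 3 1 := sg_three_pos 0 (by simp [mu_zero_right])
  have h32 : 0 < sg 3 2 := sg_three_pos 1 (by rw [a, b, c]; norm_num)
  have h33 : 0 < sg 3 3 := sg_three_pos 2 (by rw [mu_zero_succ, d, e]; norm_num)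
  rcases Nat.lt_or_ge n 4 with h | h
  · have : n = 3 := by omega
    rw [this]; exact h33
  · obtain ⟨m, rfl⟩ : ∃ m, n = m+1 := ⟨n-1, by omega⟩
    exact sg_pos_up (by omega) h32

lemma mu_n3_small (n : ℕ) (hn : n ≤ 2) : mu n 3 = 0 := by
  obtain ⟨a, b, c, d, e⟩ := mu_vals
  interval_cases n
  · exact mu_zero_succ 2
  · rw [mu_succ 0 2, Em_zero, mu_zero_succ]; norm_num
  · rw [mu_succ 1 2, Em_one, mu_zero_succ, d]; norm_num

lemma lower_fin (N : ℕ) : ∃ c : ℝ, 0 < c ∧ ∀ n < N, c * mu n 3 ≤ sg n 3 := by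
  induction N with
  | zero => exact ⟨1, one_pos, fun n hn => by omega⟩
  | succ N ih =>
    obtain ⟨c, hc, h⟩ := ih
    have : ∃ c' : ℝ, 0 < c' ∧ c' * mu N 3 ≤ sg N 3 := by
      rcases Nat.lt_or_ge N 3 with h3 | h3
      · exact ⟨1, one_pos, by rw [mu_n3_small N (by omega)]; simpa using sg_nonneg N 3⟩
      · have h1 := sg_n3_pos N h3
        have h2 := mu_nonneg N 3
        refine ⟨sg N 3 / (mu N 3 + 1), by positivity, ?_⟩
        rw [div_mul_eq_mul_div, div_le_iff₀ (by positivity)]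
        nlinarith
    obtain ⟨c', hc', h'⟩ := this
    refine ⟨min c c', lt_min hc hc', fun n hn => ?_⟩
    have hm := mu_nonneg n 3
    rcases Nat.lt_or_ge n N with hh | hh
    · exact (mul_le_mul_of_nonneg_right (min_le_left _ _) hm).trans (h n hh)
    · have : n = N := by omega
      subst this
      exact (mul_le_mul_of_nonneg_right (min_le_right _ _) hm).trans h'

lemma lower3 : ∃ c : ℝ, 0 < c ∧ ∀ n, c * mu n 3 ≤ sg n 3 := by
  obtain ⟨c, hc, h⟩ := lower_fin 511
  refine ⟨min c (1/2), lt_min hc (by norm_num), fun n => ?_⟩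
  have hm := mu_nonneg n 3
  rcases Nat.lt_or_ge n 511 with hh | hh
  · exact (mul_le_mul_of_nonneg_right (min_le_left _ _) hm).trans (h n hh)
  · refine (mul_le_mul_of_nonneg_right (min_le_right _ _) hm).trans ?_
    refine le_trans ?_ (sg_ge_sub n 3)
    have h1 := ratio n 3
    have h2 := pp_le_one (n+1) (3+1)
    have h3 : (511:ℝ) ≤ n := by exact_mod_cast hh
    have h4 := mu_eq_pp n 3
    have h5 := pp_nonneg n 3
    norm_num at h1 h4
    have h6 : 512 * pp n 3 ≤ 32 := by nlinarith
    nlinarith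

lemma lower : ∃ c : ℝ, 0 < c ∧ ∀ k n, c * mu n (k+3) ≤ sg n (k+3) := by
  obtain ⟨c, hc, h⟩ := lower3
  refine ⟨c, hc, fun k => ?_⟩
  induction k with
  | zero => exact h
  | succ k ih =>
    intro n
    cases n with
    | zero => rw [show k+1+3 = (k+3)+1 from rfl, mu_zero_succ, sg_zero_succ]; simp
    | succ n =>
      rw [show k+1+3 = (k+3)+1 from rfl]
      refine le_trans ?_ (sg_ge n (k+3))
      rw [mu_succ]
      have := Em_mono (m := n) (fun j _ => ih j)
      rw [Em_mul] at this
      linarith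

noncomputable def ww (r : ℕ) : ℕ → ℕ → ℝ
  | 0, n => sg n r
  | _+1, 0 => 0
  | i+1, n+1 => 2 * Em n (ww r i)

lemma ww_0 (r n : ℕ) : ww r 0 n = sg n r := by rw [ww]
lemma ww_s0 (r i : ℕ) : ww r (i+1) 0 = 0 := by rw [ww]
lemma ww_ss (r i n : ℕ) : ww r (i+1) (n+1) = 2 * Em n (ww r i) := by rw [ww]

lemma ww_n0 (r i : ℕ) : ww r i 0 = 0 := by
  cases i
  · rw [ww_0, sg_zero]
  · rw [ww_s0]

lemma ww_n1 (r i : ℕ) : ww r i 1 = 0 := by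
  cases i
  · rw [ww_0, sg_one]
  · rw [ww_ss r _ 0, Em_zero, ww_n0, mul_zero]

lemma ww_n2 (r i : ℕ) : ww r i 2 = 0 := by
  cases i
  · rw [ww_0, sg_two]
  · rw [ww_ss r _ 1, Em_one, ww_n0, ww_n1]; norm_num

lemma ww_nonneg (r i n : ℕ) : 0 ≤ ww r i n := by
  induction i generalizing n with
  | zero => rw [ww_0]; exact sg_nonneg _ _
  | succ i ih =>
    cases n with
    | zero => rw [ww_s0]
    | succ n => rw [ww_ss]; have := Em_nonneg (m := n) (fun j _ => ih j); linarith

lemma ww_le (r i n : ℕ) : ww r i n ≤ sg n (r+i) := by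
  induction i generalizing n with
  | zero => rw [ww_0]; rfl
  | succ i ih =>
    cases n with
    | zero => rw [ww_s0]; exact sg_nonneg _ _
    | succ n =>
      rw [ww_ss]
      refine le_trans ?_ (sg_ge n (r+i))
      have := Em_mono (m := n) (fun j _ => ih j)
      linarith

lemma Em_D2 (n : ℕ) (f : ℕ → ℝ) : Em (n+2) f - 2 * Em (n+1) f + Em n f =
    Em n (fun j => f (j+2) - 2 * f (j+1) + f j) / 4 := by
  rw [Em_add, Em_sub, Em_mul, Em_succ (n+1), Em_succ n, Em_succ n]
  ring_nf

lemma ww_D2 (R i : ℕ) : ∀ n, |ww (R+2) i (n+2) - 2 * ww (R+2) i (n+1) + ww (R+2) i n| ≤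
    (4 * 4^(R+2) * 2^(R+2)) / 2^(R+i+2) * (pp n (R+i+2) + pp n (R+i+1) + pp n (R+i)) := by
  induction i with
  | zero =>
    intro n
    simp only [ww_0, add_zero]
    have h0 := sg_nonneg n (R+2)
    have h1 := sg_nonneg (n+1) (R+2)
    have h2 := sg_nonneg (n+2) (R+2)
    have b0 := sg_le n (R+2)
    have b1 := sg_le (n+1) (R+2)
    have b2 := sg_le (n+2) (R+2)
    have p1 := pp_step n (R+1)
    have p2 := pp_step (n+1) (R+1)
    have p3 := pp_step n R
    have q1 := pp_nonneg n R
    have q2 := pp_nonneg n (R+1)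
    have q3 := pp_nonneg n (R+2)
    have e : (4 * 4^(R+2) * 2^(R+2)) / 2^(R+2) = (4:ℝ) * 4^(R+2) := by field_simp
    rw [e]
    set T : ℝ := 4^(R+2) with hT
    have hT0 : 0 < T := by positivity
    have c1 : sg (n+1) (R+2) ≤ T * (pp n (R+2) + pp n (R+1)) :=
      b1.trans (mul_le_mul_of_nonneg_left p1 hT0.le)
    have c2 : sg (n+2) (R+2) ≤ T * (pp n (R+2) + pp n (R+1) + (pp n (R+1) + pp n R)) :=
      b2.trans (mul_le_mul_of_nonneg_left (by
        have : pp (n+2) (R+2) ≤ pp (n+1) (R+2) + pp (n+1) (R+1) := p2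
        linarith) hT0.le)
    have d1 : 0 ≤ T * pp n R := by positivity
    have d2 : 0 ≤ T * pp n (R+1) := by positivity
    have d3 : 0 ≤ T * pp n (R+2) := by positivity
    rw [abs_le]; constructor <;> nlinarith
  | succ i ih =>
    intro n
    cases n with
    | zero =>
      rw [ww_n0, ww_n1, ww_n2]
      have q1 := pp_nonneg 0 (R+(i+1))
      have q2 := pp_nonneg 0 (R+(i+1)+1)
      have q3 := pp_nonneg 0 (R+(i+1)+2)
      simp only [mul_zero, sub_zero, add_zero, abs_zero]
      positivity
    | succ n =>
      rw [ww_ss, ww_ss, ww_ss]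
      have h1 := Em_D2 n (ww (R+2) i)
      have h2 : 2 * Em (n+1+1) (ww (R+2) i) - 2 * (2 * Em (n+1) (ww (R+2) i)) + 2 * Em n (ww (R+2) i)
        = (1/2) * Em n (fun j => ww (R+2) i (j+2) - 2 * ww (R+2) i (j+1) + ww (R+2) i j) := by
        have : Em (n+1+1) (ww (R+2) i) = Em (n+2) (ww (R+2) i) := rfl
        rw [this]; linarith
      rw [h2, abs_mul, abs_of_pos (by norm_num : (0:ℝ) < 1/2)]
      have h3 := (Em_abs n (fun j => ww (R+2) i (j+2) - 2 * ww (R+2) i (j+1) + ww (R+2) i j)).trans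
        (Em_mono fun j _ => ih j)
      rw [Em_mul, Em_add n (fun j => pp j (R+i+2) + pp j (R+i+1)), Em_add n (fun j => pp j (R+i+2))] at h3
      rw [← pp_succ, ← pp_succ, ← pp_succ] at h3
      have e1 : R + (i+1) = R + i + 1 := rfl
      have e2 : R + i + 1 + 1 = R + i + 2 := rfl
      have e3 : R + i + 2 + 1 = R + i + 3 := rfl
      have e4 : R + i + 1 + 2 = R + i + 3 := rfl
      rw [e2, e3] at h3
      rw [e1, e4, e2]
      refine (mul_le_mul_of_nonneg_left h3 (by norm_num)).trans (le_of_eq ?_)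
      rw [show (2:ℝ)^(R+i+3) = 2 * 2^(R+i+2) by ring]
      field_simp

lemma growth (K : ℕ) : ((K:ℝ)+4)^2 ≤ 17 * (3/2)^K := by
  match K with
  | 0 => norm_num
  | K+1 =>
    induction K with
    | zero => norm_num
    | succ K ih =>
      push_cast at ih ⊢
      rw [pow_succ (3/2:ℝ) (K+1)]
      have : (0:ℝ) ≤ K := Nat.cast_nonneg K
      nlinarith

lemma accum (D : ℕ → ℕ → ℝ) (r : ℕ) (A Y : ℝ) (hY : 0 ≤ Y) (hA : 0 ≤ A)
    (h0 : ∀ n, D 0 n ≤ A * pp n r) (h1 : ∀ i, D (i+1) 0 ≤ 0)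
    (h2 : ∀ i n, D (i+1) (n+1) ≤ 2 * Em n (D i) + Y * (3/2)^i * pp (n+1) (r+i+1)) (i n : ℕ) :
    D i n ≤ (A + 2 * Y) / 2^r * mu n (r+i) := by
  have key : ∀ i n, D i n ≤ (2^i * A + 2 * Y * (2^i - (3/2)^i)) * pp n (r+i) := by
    intro i
    induction i with
    | zero => intro n; simpa using h0 n
    | succ i ih =>
      intro n
      cases n with
      | zero => rw [← add_assoc, pp_zero_succ, mul_zero]; exact h1 i
      | succ n =>
        refine (h2 i n).trans ?_
        have := Em_mono (m := n) (fun j _ => ih j)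
        rw [Em_mul, ← pp_succ] at this
        have e : r + (i+1) = r+i+1 := rfl
        rw [e, pow_succ, pow_succ]
        nlinarith
  refine (key i n).trans ?_
  rw [mu_eq_pp, pow_add]
  have hp := pp_nonneg n (r+i)
  have : (A + 2 * Y) / 2^r * (2^r * 2^i * pp n (r+i)) = ((A + 2*Y) * 2^i) * pp n (r+i) := by
    field_simp
  rw [this]
  refine mul_le_mul_of_nonneg_right ?_ hp
  have : (0:ℝ) ≤ (3/2)^i := by positivity
  nlinarith [mul_nonneg hY this]

/-- variance of mean part -/
lemma vmu (R i n : ℕ) : Vr n (fun j => mu j (R+2+i) + mu (n-j) (R+2+i)) ≤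
    (32640 * (3/2)^R) * (3/2)^i * pp (n+1) (R+2+i+1) := by
  have h := varbound (fun j => mu j (R+i+2)) 8 (R+i) (fun j => mu_diff2 j (R+i)) n
  have e : R+2+i = R+i+2 := by omega
  rw [e]
  refine h.trans ?_
  have g := growth (R+i)
  have hp := pp_nonneg (n+1) (R+i+3)
  refine mul_le_mul_of_nonneg_right ?_ hp
  rw [pow_add] at g
  push_cast at g ⊢
  nlinarith

lemma vww (R i n : ℕ) : Vr n (fun j => ww (R+2) i j + ww (R+2) i (n-j)) ≤
    (30 * (4 * 4^(R+2) * 2^(R+2))^2 * 17 * (3/2)^R) * (3/2)^i * pp (n+1) (R+2+i+1) := by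
  have h := varbound (ww (R+2) i) (4 * 4^(R+2) * 2^(R+2)) (R+i) (ww_D2 R i) n
  have e : R+2+i+1 = R+i+3 := by omega
  rw [e]
  refine h.trans ?_
  have g := growth (R+i)
  have hp := pp_nonneg (n+1) (R+i+3)
  refine mul_le_mul_of_nonneg_right ?_ hp
  rw [pow_add] at g
  push_cast at g ⊢
  set T : ℝ := (4 * 4^(R+2) * 2^(R+2))^2
  have hT : 0 ≤ T := by positivity
  have := mul_le_mul_of_nonneg_left g hT
  nlinarith

lemma dbound (R i n : ℕ) : sg n (R+2+i) - ww (R+2) i n ≤ 16320 * (3/4)^R * mu n (R+2+i) := by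
  have := accum (fun i n => sg n (R+2+i) - ww (R+2) i n) (R+2) 0 (32640 * (3/2)^R) (by positivity) le_rfl
    (by intro n; simp [ww_0]) (by intro i; simp [ww_s0, sg_zero])
    (by
      intro i n
      have h := vmu R i n
      have h2 := sg_succ n (R+2+i)
      simp only [Em_sub, ww_ss]
      have e : R+2+(i+1) = R+2+i+1 := rfl
      rw [e]
      have e2 : Em n (fun j => ww (R+2) i j) = Em n (ww (R+2) i) := rfl
      rw [e2]
      linarith) i n
  refine this.trans (le_of_eq ?_)
  have : ((3:ℝ)/4)^R = (3/2)^R / 2^R := by rw [← div_pow]; norm_num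
  rw [this, pow_add]
  field_simp
  ring

noncomputable def FF (x y : ℝ) : ℂ := Complex.exp ((x:ℂ) * Complex.I) * ((Real.exp (-y) : ℝ) : ℂ)

lemma FF_mul (x y x' y' : ℝ) : FF x y * FF x' y' = FF (x+x') (y+y') := by
  unfold FF
  rw [show -(y+y') = -y + -y' by ring, Real.exp_add]
  push_cast
  rw [add_mul, Complex.exp_add]
  ring

lemma FF_zero : FF 0 0 = 1 := by simp [FF]

lemma FF_norm (x y : ℝ) (hy : 0 ≤ y) : ‖FF x y‖ ≤ 1 := by
  unfold FF
  rw [norm_mul, Complex.norm_exp_ofReal_mul_I, one_mul, Complex.norm_real, Real.norm_of_nonneg (Real.exp_pos _).le]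
  exact Real.exp_le_one_iff.2 (by linarith)

lemma ex1 (x : ℝ) : ‖Complex.exp ((x:ℂ) * Complex.I) - 1‖ ≤ |x| := by
  have := Real.norm_exp_I_mul_ofReal_sub_one_le (x := x)
  rwa [mul_comm] at this

lemma xI_norm (x : ℝ) : ‖(x:ℂ) * Complex.I‖ = |x| := by simp

lemma ex2 (x : ℝ) : ‖Complex.exp ((x:ℂ) * Complex.I) - 1 - (x:ℂ) * Complex.I‖ ≤ 3 * x^2 := by
  rcases le_or_gt |x| 1 with h | h
  · have := Complex.norm_exp_sub_one_sub_id_le (x := (x:ℂ) * Complex.I) (by rwa [xI_norm])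
    rw [xI_norm, sq_abs] at this
    nlinarith [sq_nonneg x]
  · refine (norm_sub_le _ _).trans ?_
    have := ex1 x
    rw [xI_norm]
    have h2 : x^2 = |x|^2 := (sq_abs x).symm
    nlinarith

lemma ex3 (x : ℝ) : ‖Complex.exp ((x:ℂ) * Complex.I) - 1 - (x:ℂ) * Complex.I + ((x^2/2 : ℝ):ℂ)‖ ≤ 4 * |x|^3 := by
  rcases le_or_gt |x| 1 with h | h
  · have h1 := Complex.exp_bound (x := (x:ℂ) * Complex.I) (by rwa [xI_norm]) (n := 3) (by norm_num)
    rw [xI_norm] at h1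
    have e : ∑ m ∈ Finset.range 3, ((x:ℂ) * Complex.I)^m / (m.factorial : ℂ) =
       1 + (x:ℂ) * Complex.I - ((x^2/2 : ℝ):ℂ) := by
      simp [Finset.sum_range_succ, Nat.factorial, mul_pow]
      ring
    rw [e] at h1
    have e2 : Complex.exp ((x:ℂ) * Complex.I) - 1 - (x:ℂ) * Complex.I + ((x^2/2 : ℝ):ℂ) =
      Complex.exp ((x:ℂ) * Complex.I) - (1 + (x:ℂ) * Complex.I - ((x^2/2 : ℝ):ℂ)) := by ring
    rw [e2]
    refine h1.trans ?_
    have : 0 ≤ |x|^3 := by positivity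
    norm_num [Nat.factorial]
    linarith
  · refine (norm_add_le _ _).trans ?_
    have := ex2 x
    have h2 : ‖((x^2/2 : ℝ):ℂ)‖ = x^2/2 := by
      rw [Complex.norm_real, Real.norm_of_nonneg (by positivity)]
    rw [h2]
    rw [← sq_abs x] at *
    nlinarith [sq_nonneg |x|, mul_pos (show 0 < |x| by linarith) (show 0 < |x| by linarith)]

lemma ex4a (s s' : ℝ) (hs : 0 ≤ s) (hs' : 0 ≤ s') : |Real.exp (-s) - Real.exp (-s')| ≤ |s - s'| := by
  wlog h : s ≤ s' generalizing s s' with H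
  · rw [abs_sub_comm, abs_sub_comm s]; exact H s' s hs' hs (le_of_not_ge h)
  · rw [abs_sub_comm s, abs_of_nonneg (by linarith : 0 ≤ s' - s)]
    have h1 : Real.exp (-s') ≤ Real.exp (-s) := Real.exp_le_exp.2 (by linarith)
    rw [abs_of_nonneg (by linarith)]
    have h2 : Real.exp (-s') = Real.exp (-s) * Real.exp (-(s'-s)) := by rw [← Real.exp_add]; congr 1; ring
    have h3 := Real.add_one_le_exp (-(s'-s))
    have h4 : Real.exp (-s) ≤ 1 := Real.exp_le_one_iff.2 (by linarith)
    have h5 := Real.exp_pos (-s)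
    rw [h2]
    nlinarith

lemma ex4 (s s' : ℝ) (hs : 0 ≤ s) (hs' : 0 ≤ s') :
    |Real.exp (-s) - Real.exp (-s') + (s - s') * Real.exp (-s')| ≤ 2 * (s - s')^2 := by
  have h4 : Real.exp (-s') ≤ 1 := Real.exp_le_one_iff.2 (by linarith)
  have h5 := Real.exp_pos (-s')
  rcases le_or_gt |s - s'| 1 with h | h
  · have h2 : Real.exp (-s) = Real.exp (-s') * Real.exp (-(s-s')) := by rw [← Real.exp_add]; congr 1; ring
    have h3 := Real.abs_exp_sub_one_sub_id_le (x := -(s-s')) (by rwa [abs_neg])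
    have e : Real.exp (-s) - Real.exp (-s') + (s - s') * Real.exp (-s') =
      Real.exp (-s') * (Real.exp (-(s-s')) - 1 - (-(s-s'))) := by rw [h2]; ring
    rw [e, abs_mul, abs_of_pos h5]
    rw [neg_sq] at h3
    calc _ ≤ 1 * (s-s')^2 := by gcongr
      _ ≤ _ := by nlinarith [sq_nonneg (s-s')]
  · refine (abs_add_le _ _).trans ?_
    have := ex4a s s' hs hs'
    rw [abs_mul, abs_of_pos h5, ← sq_abs]
    nlinarith

lemma step_pt (a a' s s' : ℝ) (hs : 0 ≤ s) (hs' : 0 ≤ s') :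
    ‖FF a s - FF a' s' - ((a - a' : ℝ) : ℂ) * (Complex.I * FF a' s') + ((s - s' : ℝ):ℂ) * FF a' s'‖ ≤
      4 * (a-a')^2 + 3 * (s-s')^2 := by
  set u := Complex.exp (((a-a' : ℝ):ℂ) * Complex.I) with hu
  set c := Complex.exp ((a':ℂ) * Complex.I) with hc
  have h1 : Complex.exp ((a:ℂ) * Complex.I) = c * u := by
    rw [hu, hc, ← Complex.exp_add]; congr 1; push_cast; ring
  have e : FF a s - FF a' s' - ((a - a' : ℝ) : ℂ) * (Complex.I * FF a' s') + ((s - s' : ℝ):ℂ) * FF a' s' =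
    c * ((u - 1 - ((a-a' : ℝ):ℂ) * Complex.I) * ((Real.exp (-s') : ℝ):ℂ)
      + (u - 1) * ((Real.exp (-s) - Real.exp (-s') : ℝ):ℂ)
      + ((Real.exp (-s) - Real.exp (-s') + (s-s') * Real.exp (-s') : ℝ):ℂ)) := by
    unfold FF
    rw [h1, ← hc]
    push_cast
    ring
  rw [e, norm_mul, hc, Complex.norm_exp_ofReal_mul_I, one_mul]
  refine (norm_add_le _ _).trans ?_
  have n1 := norm_add_le ((u - 1 - ((a-a' : ℝ):ℂ) * Complex.I) * ((Real.exp (-s') : ℝ):ℂ))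
     ((u - 1) * ((Real.exp (-s) - Real.exp (-s') : ℝ):ℂ))
  rw [norm_mul, norm_mul, Complex.norm_real, Complex.norm_real, Real.norm_eq_abs, Real.norm_eq_abs] at n1
  rw [Complex.norm_real, Real.norm_eq_abs]
  have b1 := ex2 (a-a')
  have b2 := ex1 (a-a')
  have b3 := ex4a s s' hs hs'
  have b4 := ex4 s s' hs hs'
  have h4 : |Real.exp (-s')| ≤ 1 := by
    rw [abs_of_pos (Real.exp_pos _)]; exact Real.exp_le_one_iff.2 (by linarith)
  have t1 : ‖u - 1 - ((a-a' : ℝ):ℂ) * Complex.I‖ * |Real.exp (-s')| ≤ 3 * (a-a')^2 * 1 := by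
    gcongr
  have t2 : ‖u - 1‖ * |Real.exp (-s) - Real.exp (-s')| ≤ |a-a'| * |s-s'| := by gcongr
  have t3 : |a-a'| * |s-s'| ≤ (a-a')^2 + (s-s')^2 := by
    rw [← sq_abs (a-a'), ← sq_abs (s-s')]
    nlinarith [sq_nonneg (|a-a'| - |s-s'|), sq_nonneg (|a-a'|), sq_nonneg (|s-s'|)]
  linarith

lemma stepF (n : ℕ) (a s : ℕ → ℝ) (hs : ∀ j, 0 ≤ s j) :
    ‖∑ j ∈ Finset.range (n+1), bw n j • FF (a j) (s j) - FF (Em n a) (Em n s)‖ ≤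
      4 * Vr n a + 3 * Vr n s := by
  set A := Em n a with hA
  set S := Em n s with hS
  have hS0 : 0 ≤ S := Em_nonneg fun j _ => hs j
  have z1 : Em n (fun j => a j - A) = 0 := by rw [Em_sub, Em_const]; simp [hA]
  have z2 : Em n (fun j => s j - S) = 0 := by rw [Em_sub, Em_const]; simp [hS]
  have cs : ∀ (f : ℕ → ℝ) (z : ℂ), ∑ j ∈ Finset.range (n+1), bw n j • (((f j : ℝ):ℂ) * z) = ((Em n f : ℝ):ℂ) * z := by
    intro f z
    unfold Em
    push_cast
    rw [Finset.sum_mul]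
    refine Finset.sum_congr rfl fun j _ => ?_
    rw [Complex.real_smul]; ring
  have e : ∑ j ∈ Finset.range (n+1), bw n j • FF (a j) (s j) - FF A S =
    ∑ j ∈ Finset.range (n+1), bw n j • (FF (a j) (s j) - FF A S - ((a j - A : ℝ) : ℂ) * (Complex.I * FF A S)
       + ((s j - S : ℝ):ℂ) * FF A S) := by
    simp only [smul_add, smul_sub, Finset.sum_add_distrib, Finset.sum_sub_distrib]
    rw [cs (fun j => a j - A), cs (fun j => s j - S), z1, z2, ← Finset.sum_smul, bw_sum]
    simp
  rw [e]
  refine (norm_sum_le _ _).trans ?_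
  rw [Vr_eq, Vr_eq, ← Em_mul, ← Em_mul, ← Em_add]
  unfold Em
  refine Finset.sum_le_sum fun j _ => ?_
  rw [norm_smul, Real.norm_of_nonneg (bw_nonneg _ _)]
  exact mul_le_mul_of_nonneg_left (step_pt _ _ _ _ (hs j) hS0) (bw_nonneg _ _)

lemma mu_le_two_pow (n k : ℕ) : mu n k ≤ 2^k := by
  rw [mu_eq_pp]; have := pp_le_one n k
  have h : (0:ℝ) < 2^k := by positivity
  nlinarith

lemma base (t : ℝ) (n r : ℕ) : ‖ps t n r - FF (t * mu n r) (t^2/2 * sg n r)‖ ≤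
    4 * 16^r * (|t|^3 + t^4) * pp n r := by
  set M := mu n r with hM
  set V := sg n r with hV
  have hV0 : 0 ≤ V := sg_nonneg _ _
  have hVle : V ≤ 4^r * pp n r := sg_le n r
  have hp := pp_nonneg n r
  have hp1 := pp_le_one n r
  set c := Complex.exp (((t*M:ℝ):ℂ) * Complex.I) with hc
  have hcn : ‖c‖ = 1 := Complex.norm_exp_ofReal_mul_I _
  have h1 : ∀ m : ℕ, Complex.exp (((t*m:ℝ):ℂ) * Complex.I) =
      c * (Complex.exp (((t*(m-M):ℝ):ℂ) * Complex.I)) := by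
    intro m; rw [hc, ← Complex.exp_add]; congr 1; push_cast; ring
  have cs : ∀ (f : ℕ → ℝ) (z : ℂ), SS n r (fun m => ((f m : ℝ):ℂ) * z) = ((SS n r f : ℝ):ℂ) * z := by
    intro f z
    unfold SS
    push_cast
    rw [Finset.sum_mul]
    refine Finset.sum_congr rfl fun j _ => ?_
    rw [Complex.real_smul]; simp; ring
  have z1 : SS n r (fun m => t * ((m:ℝ) - M)) = 0 := by
    rw [SS_mul, SS_sub, SS_mean, SS_const]; simp [hM]
  have z2 : SS n r (fun m => (t * ((m:ℝ) - M))^2/2) = t^2/2 * V := by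
    have : (fun m:ℕ => (t * ((m:ℝ) - M))^2/2) = fun m:ℕ => (t^2/2) * ((m:ℝ)-M)^2 := by funext m; ring
    rw [this, SS_mul, SS_cvar]
  have e1 : ps t n r - FF (t*M) (t^2/2*V) =
     c * (SS n r (fun m => Complex.exp (((t*(m-M):ℝ):ℂ) * Complex.I) - 1 - ((t*(m-M):ℝ):ℂ) * Complex.I
        + (((t*(m-M))^2/2:ℝ):ℂ) * 1) - ((Real.exp (-(t^2/2*V)) - Real.exp (-0) + (t^2/2*V - 0) * Real.exp (-0) : ℝ):ℂ)) := by
    unfold ps FF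
    simp only [h1, SS_cmul, SS_add, SS_sub, SS_const]
    rw [cs (fun m => t*((m:ℝ)-M)), cs (fun m => (t*((m:ℝ)-M))^2/2), z1, z2]
    simp only [neg_zero, Real.exp_zero]
    rw [← hc]
    generalize (SS n r fun m => Complex.exp (((t*(m-M):ℝ):ℂ) * Complex.I)) = Q
    clear_value c
    push_cast
    ring
  rw [e1, norm_mul, hcn, one_mul]
  refine (norm_sub_le _ _).trans ?_
  rw [Complex.norm_real, Real.norm_eq_abs]
  have b2 := ex4 (t^2/2*V) 0 (by positivity) le_rfl
  have b1 : ‖SS n r (fun m => Complex.exp (((t*(m-M):ℝ):ℂ) * Complex.I) - 1 - ((t*(m-M):ℝ):ℂ) * Complex.I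
        + (((t*(m-M))^2/2:ℝ):ℂ) * 1)‖ ≤ 4 * |t|^3 * 2^r * V := by
    refine (SS_norm _ _ _).trans ?_
    rw [hV, ← SS_cvar, ← SS_mul]
    refine SS_mono _ _ _ _ fun m hm => ?_
    rw [mul_one]
    refine (ex3 _).trans ?_
    have m1 : (m:ℝ) ≤ 2^r := by exact_mod_cast hm
    have m2 := mu_le_two_pow n r
    have m3 := mu_nonneg n r
    have m4 : |(m:ℝ) - M| ≤ 2^r := by
      rw [abs_le]; constructor <;> linarith [Nat.cast_nonneg (α := ℝ) m]
    rw [abs_mul, mul_pow, ← sq_abs ((m:ℝ)-M), pow_succ |(m:ℝ)-M|]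
    have : |(m:ℝ)-M|^2 * |(m:ℝ)-M| ≤ |(m:ℝ)-M|^2 * 2^r := by gcongr
    calc 4 * (|t|^3 * (|(m:ℝ)-M|^2 * |(m:ℝ)-M|)) ≤ 4 * (|t|^3 * (|(m:ℝ)-M|^2 * 2^r)) := by gcongr
      _ = _ := by ring
  have f1 : 4 * |t|^3 * 2^r * V ≤ 4 * |t|^3 * 16^r * pp n r := by
    calc 4 * |t|^3 * 2^r * V ≤ 4 * |t|^3 * 2^r * (4^r * pp n r) := by gcongr
      _ = 4 * |t|^3 * (2^r*4^r) * pp n r := by ring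
      _ = 4 * |t|^3 * 8^r * pp n r := by rw [← mul_pow]; norm_num
      _ ≤ _ := by gcongr; norm_num
  have f2 : 2 * (t^2/2*V - 0)^2 ≤ 4 * t^4 * 16^r * pp n r := by
    have hV4 : V ≤ 4^r := hVle.trans (by nlinarith [show (0:ℝ) < 4^r by positivity])
    calc 2 * (t^2/2*V - 0)^2 = t^4/2 * (V * V) := by ring
      _ ≤ t^4/2 * (4^r * (4^r * pp n r)) := by gcongr
      _ = t^4/2 * (4^r*4^r) * pp n r := by ring
      _ = t^4/2 * 16^r * pp n r := by rw [← mul_pow]; norm_num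
      _ ≤ _ := by
        have : 0 ≤ t^4 * 16^r * pp n r := by positivity
        linarith
  linarith

noncomputable def KK (R : ℕ) : ℝ := 30 * (4 * 4^(R+2) * 2^(R+2))^2 * 17 * (3/2)^R

lemma KK_nonneg (R : ℕ) : 0 ≤ KK R := by unfold KK; positivity

lemma Vr_mul (n : ℕ) (c : ℝ) (f : ℕ → ℝ) : Vr n (fun j => c * f j) = c^2 * Vr n f := by
  unfold Vr
  have : (fun j => (c * f j)^2) = fun j => c^2 * f j^2 := by funext j; ring
  rw [this, Em_mul, Em_mul]; ring

lemma prod_diff (a b c d : ℂ) (hb : ‖b‖ ≤ 1) (hc : ‖c‖ ≤ 1) : ‖a * b - c * d‖ ≤ ‖a - c‖ + ‖b - d‖ := by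
  have : a * b - c * d = (a - c) * b + c * (b - d) := by ring
  rw [this]
  refine (norm_add_le _ _).trans ?_
  rw [norm_mul, norm_mul]
  have := norm_nonneg (a-c)
  have := norm_nonneg (b-d)
  nlinarith

lemma main_err (t : ℝ) (R i n : ℕ) :
    ‖ps t n (R+2+i) - FF (t * mu n (R+2+i)) (t^2/2 * ww (R+2) i n)‖ ≤
      (4 * 16^(R+2) * (|t|^3+t^4) + 2 * (4 * t^2 * (32640 * (3/2)^R) + t^4 * KK R)) / 2^(R+2)
        * mu n (R+2+i) := by
  have hK := KK_nonneg R
  refine accum (fun i n => ‖ps t n (R+2+i) - FF (t * mu n (R+2+i)) (t^2/2 * ww (R+2) i n)‖) (R+2)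
    (4 * 16^(R+2) * (|t|^3+t^4)) (4 * t^2 * (32640 * (3/2)^R) + t^4 * KK R) (by positivity) (by positivity)
    ?_ ?_ ?_ i n
  · intro n
    simp only [ww_0, add_zero]
    exact base t n (R+2)
  · intro i
    simp only [ww_s0]
    rw [show R+2+(i+1) = R+2+i+1 from rfl, ps_zero_succ, mu_zero_succ, mul_zero, mul_zero, FF_zero]
    simp
  · intro i n
    rw [show R+2+(i+1) = R+2+i+1 from rfl]
    set k := R+2+i with hk
    set D : ℕ → ℝ := fun n => ‖ps t n k - FF (t * mu n k) (t^2/2 * ww (R+2) i n)‖ with hD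
    have hm : t * mu (n+1) (k+1) = Em n (fun j => t * (mu j k + mu (n-j) k)) := by
      rw [Em_mul, Em_add, Em_reflect n (fun j => mu j k), mu_succ]; ring
    have hw : t^2/2 * ww (R+2) (i+1) (n+1) = Em n (fun j => t^2/2 * (ww (R+2) i j + ww (R+2) i (n-j))) := by
      rw [Em_mul, Em_add n (ww (R+2) i), Em_reflect n (ww (R+2) i), ww_ss]; ring
    have hst := stepF n (fun j => t * (mu j k + mu (n-j) k))
      (fun j => t^2/2 * (ww (R+2) i j + ww (R+2) i (n-j)))
      (fun j => by have := ww_nonneg (R+2) i j; have := ww_nonneg (R+2) i (n-j); positivity)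
    rw [← hm, ← hw, Vr_mul, Vr_mul] at hst
    have v1 := vmu R i n
    have v2 := vww R i n
    rw [← hk] at v1 v2
    have hsum : ‖ps t (n+1) (k+1) - ∑ j ∈ Finset.range (n+1), bw n j •
        FF (t * (mu j k + mu (n-j) k)) (t^2/2 * (ww (R+2) i j + ww (R+2) i (n-j)))‖ ≤ 2 * Em n D := by
      rw [ps_succ, ← Finset.sum_sub_distrib]
      have e2 : 2 * Em n D = Em n (fun j => D j + D (n-j)) := by
        rw [Em_add, Em_reflect n D]; ring
      rw [e2]
      refine (norm_sum_le _ _).trans ?_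
      refine Finset.sum_le_sum fun j _ => ?_
      rw [← smul_sub, norm_smul, Real.norm_of_nonneg (bw_nonneg _ _)]
      refine mul_le_mul_of_nonneg_left ?_ (bw_nonneg _ _)
      rw [mul_add, mul_add, ← FF_mul]
      refine prod_diff _ _ _ _ (ps_norm _ _ _) (FF_norm _ _ ?_)
      have := ww_nonneg (R+2) i j
      positivity
    have tri := norm_sub_le_norm_sub_add_norm_sub (ps t (n+1) (k+1)) (∑ j ∈ Finset.range (n+1), bw n j •
        FF (t * (mu j k + mu (n-j) k)) (t^2/2 * (ww (R+2) i j + ww (R+2) i (n-j)))) (FF (t * mu (n+1) (k+1)) (t^2/2 * ww (R+2) (i+1) (n+1)))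
    refine tri.trans ?_
    refine (add_le_add hsum hst).trans ?_
    have f1 : 4 * (t^2 * Vr n (fun j => mu j k + mu (n-j) k)) ≤
       4 * (t^2 * ((32640 * (3/2)^R) * (3/2)^i * pp (n+1) (k+1))) := by gcongr
    have f2 : 3 * ((t^2/2)^2 * Vr n (fun j => ww (R+2) i j + ww (R+2) i (n-j))) ≤
       3 * ((t^2/2)^2 * (KK R * (3/2)^i * pp (n+1) (k+1))) := by
      gcongr
      exact v2
    have hp := pp_nonneg (n+1) (k+1)
    have f3 : 3 * ((t^2/2)^2 * (KK R * (3/2)^i * pp (n+1) (k+1))) ≤ t^4 * KK R * (3/2)^i * pp (n+1) (k+1) := by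
      have : 0 ≤ t^4 * KK R * (3/2)^i * pp (n+1) (k+1) := by positivity
      have e : 3 * ((t^2/2)^2 * (KK R * (3/2)^i * pp (n+1) (k+1))) = 3/4 * (t^4 * KK R * (3/2)^i * pp (n+1) (k+1)) := by ring
      linarith
    have e3 : (4 * t^2 * (32640 * (3/2)^R) + t^4 * KK R) * (3/2)^i * pp (n+1) (k+1) =
       4 * (t^2 * ((32640 * (3/2)^R) * (3/2)^i * pp (n+1) (k+1))) + t^4 * KK R * (3/2)^i * pp (n+1) (k+1) := by ring
    rw [e3]
    linarith

lemma main_err2 (t : ℝ) (R i n : ℕ) :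
    ‖ps t n (R+2+i) - FF (t * mu n (R+2+i)) (t^2/2 * sg n (R+2+i))‖ ≤
      ((4 * 16^(R+2) + 2 * KK R) * (|t|^3+t^4) + 80000 * (3/4)^R * t^2) * mu n (R+2+i) := by
  have h1 := main_err t R i n
  have hK := KK_nonneg R
  have hm := mu_nonneg n (R+2+i)
  have h2 : ‖FF (t * mu n (R+2+i)) (t^2/2 * ww (R+2) i n) - FF (t * mu n (R+2+i)) (t^2/2 * sg n (R+2+i))‖ ≤
      t^2/2 * (16320 * (3/4)^R * mu n (R+2+i)) := by
    unfold FF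
    rw [← mul_sub, norm_mul, Complex.norm_exp_ofReal_mul_I, one_mul, ← Complex.ofReal_sub, Complex.norm_real, Real.norm_eq_abs]
    have a1 := ww_nonneg (R+2) i n
    have a2 := sg_nonneg n (R+2+i)
    refine (ex4a _ _ (by positivity) (by positivity)).trans ?_
    have a3 := ww_le (R+2) i n
    have a4 := dbound R i n
    rw [← mul_sub, abs_mul, abs_of_nonneg (by positivity), abs_sub_comm, abs_of_nonneg (by linarith)]
    gcongr
  have tri := norm_sub_le_norm_sub_add_norm_sub (ps t n (R+2+i)) (FF (t * mu n (R+2+i)) (t^2/2 * ww (R+2) i n))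
    (FF (t * mu n (R+2+i)) (t^2/2 * sg n (R+2+i)))
  refine tri.trans ((add_le_add h1 h2).trans ?_)
  rw [show t^2/2 * (16320 * (3/4)^R * mu n (R+2+i)) = (t^2/2 * 16320 * (3/4)^R) * mu n (R+2+i) by ring, ← add_mul]
  refine mul_le_mul_of_nonneg_right ?_ hm
  have e : (3/4:ℝ)^R = (3/2)^R / 2^R := by rw [← div_pow]; norm_num
  have e2 : (4 * 16^(R+2) * (|t|^3+t^4) + 2 * (4 * t^2 * (32640 * (3/2)^R) + t^4 * KK R)) / 2^(R+2) =
     (4 * 16^(R+2) * (|t|^3+t^4) + 2 * (t^4 * KK R)) / 2^(R+2) + 65280 * (3/4)^R * t^2 := by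
    rw [e, pow_add 2]; field_simp; ring
  rw [e2]
  have e3 : (4 * 16^(R+2) * (|t|^3+t^4) + 2 * (t^4 * KK R)) / 2^(R+2) ≤ 4 * 16^(R+2) * (|t|^3+t^4) + 2 * (t^4 * KK R) :=
    div_le_self (by positivity) (one_le_pow₀ (by norm_num))
  have e4 : 0 ≤ KK R * |t|^3 := by positivity
  have e5 : 0 ≤ (3/4:ℝ)^R * t^2 := by positivity
  nlinarith

lemma law_fin (n k : ℕ) : standardizedProfileLaw n k = ∑ m ∈ Finset.range (2^k+1), ENNReal.ofReal (q n k m) •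
    Measure.dirac (((m:ℝ) - mu n k) / Real.sqrt (nu n k - (mu n k)^2)) := by
  unfold standardizedProfileLaw
  ext s hs
  rw [Measure.sum_apply _ hs, Measure.finsetSum_apply]
  refine tsum_eq_sum fun m hm => ?_
  rw [Finset.mem_range] at hm
  rw [q_supp n k m (by omega)]
  simp

lemma law_prob (n k : ℕ) : IsProbabilityMeasure (standardizedProfileLaw n k) := by
  constructor
  rw [law_fin, Measure.finsetSum_apply]
  simp only [Measure.smul_apply, measure_univ, smul_eq_mul, mul_one]
  rw [← ENNReal.ofReal_sum_of_nonneg (fun m _ => q_nonneg _ _ _), q_sum, ENNReal.ofReal_one]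

lemma law_charFun (n k : ℕ) (s : ℝ) : charFun (standardizedProfileLaw n k) s =
    Complex.exp (((-(s / Real.sqrt (sg n k) * mu n k) : ℝ) : ℂ) * Complex.I) * ps (s / Real.sqrt (sg n k)) n k := by
  rw [charFun_apply_real, law_fin, integral_finsetSum_measure]
  · unfold ps
    rw [← SS_cmul]
    unfold SS
    refine Finset.sum_congr rfl fun m _ => ?_
    rw [integral_smul_measure, integral_dirac, ENNReal.toReal_ofReal (q_nonneg _ _ _)]
    beta_reduce
    rw [← Complex.exp_add]
    congr 2
    unfold sg
    push_cast
    ring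
  · intro m _
    refine Integrable.smul_measure ?_ ENNReal.ofReal_ne_top
    exact integrable_dirac (by simp)

lemma cf_err (s : ℝ) (n k R : ℕ) (hk : R + 2 ≤ k) (hsg : 0 < sg n k) (c : ℝ) (hc : 0 < c)
    (hl : c * mu n k ≤ sg n k) :
    ‖charFun (standardizedProfileLaw n k) s - ((Real.exp (-(s^2/2)) : ℝ) : ℂ)‖ ≤
      ((4 * 16^(R+2) + 2 * KK R) * (|s|^3 / Real.sqrt (sg n k) + s^4 / sg n k)
        + 80000 * (3/4)^R * s^2) / c := by
  obtain ⟨i, rfl⟩ := Nat.exists_eq_add_of_le hk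
  set V := sg n (R+2+i) with hV
  set M := mu n (R+2+i) with hM
  have hsq : 0 < Real.sqrt V := Real.sqrt_pos.2 hsg
  have hsqq : Real.sqrt V ^ 2 = V := Real.sq_sqrt hsg.le
  set t := s / Real.sqrt V with ht
  have hK := KK_nonneg R
  have t2 : t^2 * V = s^2 := by rw [ht, div_pow, hsqq]; field_simp
  have t4 : t^4 * V = s^4 / V := by
    have : t^4 = (t^2)^2 := by ring
    rw [this, ht, div_pow, hsqq]; field_simp
  have t3 : |t|^3 * V = |s|^3 / Real.sqrt V := by
    rw [ht, abs_div, abs_of_pos hsq, div_pow]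
    nth_rw 2 [← hsqq]
    field_simp
  have h := main_err2 t R i n
  rw [← hM, ← hV] at h
  have e1 : ((Real.exp (-(s^2/2)) : ℝ) : ℂ) = Complex.exp (((-(t * M) : ℝ) : ℂ) * Complex.I) * FF (t*M) (t^2/2*V) := by
    unfold FF
    rw [← mul_assoc, ← Complex.exp_add, show t^2/2*V = s^2/2 by rw [← t2]; ring]
    have : (((-(t * M) : ℝ) : ℂ) * Complex.I) + ((t*M:ℝ):ℂ) * Complex.I = 0 := by push_cast; ring
    rw [this, Complex.exp_zero, one_mul]
  rw [law_charFun, ← hV, ← hM, ← ht, e1, ← mul_sub, norm_mul, Complex.norm_exp_ofReal_mul_I, one_mul]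
  refine h.trans ?_
  have hMc : M ≤ V / c := by rw [le_div_iff₀ hc]; linarith
  refine (mul_le_mul_of_nonneg_left hMc (by positivity)).trans (le_of_eq ?_)
  rw [← t2, ← t3, ← t4]
  ring

lemma cf_tendsto (k : ℕ → ℕ) (h : Tendsto (fun n => sg n (k n)) atTop atTop) (s : ℝ) :
    Tendsto (fun n => charFun (standardizedProfileLaw n (k n)) s) atTop (nhds ((Real.exp (-(s^2/2)) : ℝ) : ℂ)) := by
  obtain ⟨c, hc, hl⟩ := lower
  rw [Metric.tendsto_atTop']
  intro ε hε
  have hgeo : Tendsto (fun R : ℕ => 80000 * (3/4:ℝ)^R * s^2 / c) atTop (nhds 0) := by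
    have := ((tendsto_pow_atTop_nhds_zero_of_lt_one (r := (3/4:ℝ)) (by norm_num) (by norm_num)).const_mul 80000).mul_const (s^2) |>.div_const c
    simpa using this
  obtain ⟨R, hR, hR1⟩ := ((hgeo.eventually (gt_mem_nhds (show (0:ℝ) < ε/2 by linarith))).and (eventually_ge_atTop 1)).exists
  have hlim : Tendsto (fun n => (4 * 16^(R+2) + 2 * KK R) * (|s|^3 / Real.sqrt (sg n (k n)) + s^4 / sg n (k n)) / c) atTop (nhds 0) := by
    have a1 : Tendsto (fun n => |s|^3 / Real.sqrt (sg n (k n))) atTop (nhds 0) :=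
      tendsto_const_nhds.div_atTop (Real.tendsto_sqrt_atTop.comp h)
    have a2 : Tendsto (fun n => s^4 / sg n (k n)) atTop (nhds 0) := tendsto_const_nhds.div_atTop h
    have := ((a1.add a2).const_mul (4 * 16^(R+2) + 2 * KK R)).div_const c
    simpa using this
  have ev := ((hlim.eventually (gt_mem_nhds (show (0:ℝ) < ε/2 by linarith))).and
    (h.eventually (eventually_gt_atTop ((4:ℝ)^(R+2)))))
  obtain ⟨N, hN⟩ := eventually_atTop.1 ev
  refine ⟨N, fun n hn => ?_⟩
  obtain ⟨b1, b2⟩ := hN n hn.le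
  have hkR : R + 2 ≤ k n := by
    by_contra hlt
    push Not at hlt
    have h1 := sg_le n (k n)
    have h2 := pp_le_one n (k n)
    have h3 : (4:ℝ)^(k n) ≤ 4^(R+2) := pow_le_pow_right₀ (by norm_num) hlt.le
    have h4 : (0:ℝ) < 4^(k n) := by positivity
    nlinarith
  have hpos : 0 < sg n (k n) := lt_trans (by positivity) b2
  have hl' : c * mu n (k n) ≤ sg n (k n) := by
    obtain ⟨i, hi⟩ := Nat.exists_eq_add_of_le (show 3 ≤ k n by omega)
    rw [hi, add_comm 3]; exact hl i n
  rw [dist_eq_norm]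
  refine lt_of_le_of_lt (cf_err s n (k n) R hkR hpos c hc hl') ?_
  rw [add_div]
  linarith

/-- If `σ_{n,k(n)}² → ∞`, the standardized external profile converges weakly to `N(0,1)`. -/
theorem clt_external_profile :
    ∀ k : ℕ → ℕ, (∀ n, k n ≤ n) →
    Tendsto (fun n => nu n (k n) - (mu n (k n))^2) atTop atTop →
    ∀ f : BoundedContinuousFunction ℝ ℝ,
      Tendsto (fun n => ∫ x, f x ∂(standardizedProfileLaw n (k n))) atTop
        (nhds (∫ x, f x ∂(gaussianReal 0 1))) := by
  intro k _ h
  have key := cf_tendsto k h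
  let P : ℕ → ProbabilityMeasure ℝ := fun n => ⟨standardizedProfileLaw n (k n), law_prob n (k n)⟩
  let Q : ProbabilityMeasure ℝ := ⟨gaussianReal 0 1, inferInstance⟩
  have hPQ : Tendsto P atTop (nhds Q) := by
    refine ProbabilityMeasure.tendsto_of_tendsto_charFun fun s => ?_
    have e : charFun (Q : Measure ℝ) s = ((Real.exp (-(s^2/2)) : ℝ) : ℂ) := by
      change charFun (gaussianReal 0 1) s = _
      rw [charFun_gaussianReal]
      push_cast
      congr 1
      simp
    rw [e]
    exact key s
  exact ProbabilityMeasure.tendsto_iff_forall_integral_tendsto.1 hPQ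
end

section
/- There exist constants C > 0 and x₀ ∈ (0, 1) such that for all real x with 0 < x ≤ x₀, writing X := 1/(x log 2), one has F(x) = √(log 2/(2π)) · X^{1/2 + 1/log 2} · exp(−(log(X log X))²/(2 log 2) − P(log₂(X log X))) · (1 + E(x)) with |E(x)| ≤ C (log log X)²/log X. -/
open Filter Real

/-- `Q j = ∏_{ℓ=1}^{j} (1 - 2^{-ℓ})`. -/
noncomputable def Q (j : ℕ) : ℝ := ∏ l ∈ Finset.range j, (1 - (2:ℝ)^(-(l:ℤ)-1))

/-- `Q_∞ = ∏_{ℓ≥1} (1 - 2^{-ℓ})`. -/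
noncomputable def Qinf : ℝ := ∏' l : ℕ, (1 - (2:ℝ)^(-(l:ℤ)-1))

/-- `F(x) = ∑_{j≥0} (-1)^j 2^{-j(j-1)/2} e^{-2^j x} / (Q_j Q_∞)`. -/
noncomputable def F (x : ℝ) : ℝ :=
  ∑' j : ℕ, (-1:ℝ)^j * ((2:ℝ)^(j.choose 2))⁻¹ * Real.exp (-(2:ℝ)^j * x) / (Q j * Qinf)

/-- The 1-periodic function
`P(t) = log 2/12 + π²/(6 log 2) − ∑_{j≥1} cos(2jπt)/(j sinh(2jπ²/log 2))`. -/
noncomputable def P (t : ℝ) : ℝ :=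
  Real.log 2 / 12 + Real.pi^2 / (6 * Real.log 2) -
    ∑' j : ℕ, Real.cos (2 * ((j:ℝ)+1) * Real.pi * t) /
      (((j:ℝ)+1) * Real.sinh (2 * ((j:ℝ)+1) * Real.pi^2 / Real.log 2))


/-- coefficients without `Qinf`. -/
noncomputable def ecoef (j : ℕ) : ℝ := (-1:ℝ)^j * ((2:ℝ)^(j.choose 2))⁻¹ / Q j

lemma zpow_half (l : ℕ) : (2:ℝ)^(-(l:ℤ)-1) = (1/2:ℝ)^(l+1) := by
  have : (-(l:ℤ)-1) = -((l+1 : ℕ):ℤ) := by push_cast; ring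
  rw [this, zpow_neg, zpow_natCast, one_div, inv_pow]

lemma half_pow_lt (l : ℕ) : (1/2:ℝ)^(l+1) < 1 := pow_lt_one₀ (by norm_num) (by norm_num) (by omega)

lemma Q_succ (j : ℕ) : Q (j+1) = Q j * (1 - (1/2:ℝ)^(j+1)) := by
  unfold Q
  rw [Finset.prod_range_succ, zpow_half]

lemma Q_pos (j : ℕ) : 0 < Q j := by
  induction j with
  | zero => simp [Q]
  | succ j ih => rw [Q_succ]; exact mul_pos ih (by linarith [half_pow_lt j])

lemma ecoef_zero : ecoef 0 = 1 := by simp [ecoef, Q]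

lemma ecoef_succ (j : ℕ) : ecoef (j+1) * ((2:ℝ)^(j+1) - 1) = -2 * ecoef j := by
  unfold ecoef
  rw [Q_succ]
  have h1 := (Q_pos j).ne'
  have h2 : (2:ℝ)^(j+1) - 1 ≠ 0 := by
    have : (1:ℝ) < 2^(j+1) := one_lt_pow₀ (by norm_num) (by omega)
    linarith
  have h3 : (1 - (1/2:ℝ)^(j+1)) = ((2:ℝ)^(j+1) - 1) / 2^(j+1) := by
    rw [one_div, inv_pow]; field_simp
  have h4 : (j+1).choose 2 = j.choose 2 + j := by
    rw [Nat.choose_succ_succ' j 1]; simp; ring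
  rw [h3, h4, pow_add, pow_succ, pow_succ]
  rw [pow_succ] at h2
  field_simp
  ring

lemma ecoef_summable : Summable ecoef := by
  apply summable_of_ratio_norm_eventually_le (r := 2/3) (by norm_num)
  filter_upwards [eventually_ge_atTop 1] with j hj
  have h := ecoef_succ j
  have h2 : (4:ℝ) ≤ 2^(j+1) := by
    calc (4:ℝ) = 2^(1+1) := by norm_num
      _ ≤ 2^(j+1) := pow_le_pow_right₀ (by norm_num) (by omega)
  have h3 : |ecoef (j+1)| * ((2:ℝ)^(j+1) - 1) = 2 * |ecoef j| := by
    have := congrArg abs h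
    rw [abs_mul, abs_mul, abs_of_pos (by linarith : (0:ℝ) < 2^(j+1) - 1)] at this
    simpa using this
  simp only [Real.norm_eq_abs]
  nlinarith [abs_nonneg (ecoef (j+1))]

lemma ecoef_abs_summable : Summable (fun j => |ecoef j|) := ecoef_summable.abs

/-- Euler's function. -/
noncomputable def Eul (x : ℝ) : ℝ := ∑' j, ecoef j * x^j

lemma Eul_summable {x : ℝ} (hx : |x| ≤ 1) : Summable (fun j => ecoef j * x^j) := by
  refine Summable.of_norm_bounded ecoef_abs_summable (fun j => ?_)
  rw [norm_mul, norm_pow]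
  exact mul_le_of_le_one_right (norm_nonneg _) (pow_le_one₀ (norm_nonneg _) hx)

lemma Eul_rec {x : ℝ} (hx : |x| ≤ 1) : Eul x = (1 - x) * Eul (x/2) := by
  have hx2 : |x/2| ≤ 1 := by rw [abs_div]; norm_num; linarith
  have h1 := Eul_summable hx
  have h2 := Eul_summable hx2
  have h3 : Eul x - Eul (x/2) = - x * Eul (x/2) := by
    unfold Eul
    rw [← h1.tsum_sub h2, (h1.sub h2).tsum_eq_zero_add, ← tsum_mul_left]
    simp only [pow_zero, sub_self, zero_add]
    congr 1
    ext j
    have := ecoef_succ j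
    rw [div_pow, div_pow]
    have h5 : ecoef (j+1) * x^(j+1) - ecoef (j+1) * (x^(j+1)/2^(j+1)) = (ecoef (j+1) * ((2:ℝ)^(j+1) - 1)) * (x^(j+1)/2^(j+1)) := by
      field_simp
    rw [h5, this, pow_succ, pow_succ]; field_simp
  linarith

lemma Eul_one : Eul 1 = 0 := by rw [Eul_rec (by simp)]; simp

lemma Eul_tendsto : Tendsto (fun n : ℕ => Eul ((1/2:ℝ)^(n+1))) atTop (nhds 1) := by
  have h0 : (1:ℝ) = ∑' j, ecoef j * (0:ℝ)^j := by
    rw [tsum_eq_single 0]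
    · simp [ecoef_zero]
    · intro j hj; simp [hj]
  have key : Tendsto (fun n : ℕ => Eul ((1/2:ℝ)^(n+1))) atTop (nhds (∑' j, ecoef j * (0:ℝ)^j)) := by
   unfold Eul
   refine tendsto_tsum_of_dominated_convergence ecoef_abs_summable (fun j => ?_) ?_
   · have : Tendsto (fun n : ℕ => (1/2:ℝ)^(n+1)) atTop (nhds 0) :=
       (tendsto_pow_atTop_nhds_zero_of_lt_one (by norm_num) (by norm_num)).comp (tendsto_add_atTop_nat 1)
     exact (this.pow j).const_mul _
   · refine Eventually.of_forall (fun n j => ?_)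
     rw [norm_mul]
     refine mul_le_of_le_one_right (norm_nonneg _) ?_
     rw [norm_pow, norm_pow]
     apply pow_le_one₀ (by positivity) (pow_le_one₀ (by positivity) (by norm_num))
  rw [← h0] at key
  exact key

lemma Qlog_summable : Summable (fun l : ℕ => Real.log (1 - (2:ℝ)^(-(l:ℤ)-1))) := by
  have : Summable (fun l : ℕ => -(1/2:ℝ)^(l+1)) :=
    ((summable_geometric_of_lt_one (by norm_num) (by norm_num)).comp_injective (add_left_injective 1)).neg
  have h := Real.summable_log_one_add_of_summable this
  refine h.congr (fun l => ?_)
  rw [zpow_half, sub_eq_add_neg]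

lemma Qfac_pos (l : ℕ) : 0 < (1 - (2:ℝ)^(-(l:ℤ)-1)) := by rw [zpow_half]; linarith [half_pow_lt l]

lemma Qinf_pos : 0 < Qinf := by
  unfold Qinf
  rw [← Real.rexp_tsum_eq_tprod Qfac_pos Qlog_summable]
  exact Real.exp_pos _

lemma Q_tendsto : Tendsto Q atTop (nhds Qinf) :=
  (Real.multipliable_of_summable_log Qfac_pos Qlog_summable).hasProd.tendsto_prod_nat

lemma Eul_half : Eul (1/2) = Qinf := by
  have h : ∀ n, Eul (1/2) = Q n * Eul ((1/2:ℝ)^(n+1)) := by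
    intro n
    induction n with
    | zero => simp [Q]
    | succ n ih =>
      rw [ih, Q_succ, Eul_rec (x := (1/2:ℝ)^(n+1))]
      · rw [pow_succ (1/2:ℝ) (n+1)]; ring_nf
      · rw [abs_of_pos (by positivity)]; exact (half_pow_lt n).le
  have h2 := Q_tendsto.mul Eul_tendsto
  simp only [← h, mul_one] at h2
  exact tendsto_nhds_unique tendsto_const_nhds h2

/-- Laplace transform as a sum. -/
noncomputable def HH (z : ℂ) : ℂ := ∑' j, (ecoef j / Qinf : ℝ) / (z + 2^j)

lemma ccoef_summable : Summable (fun j => |ecoef j / Qinf|) := (ecoef_summable.div_const _).abs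

lemma norm_add_ge {z : ℂ} (hz : 0 ≤ z.re) (j : ℕ) : (2:ℝ)^j ≤ ‖z + 2^j‖ := by
  have h1 := Complex.abs_re_le_norm (z + 2^j)
  have h2 : (z + 2^j).re = z.re + 2^j := by
    have : ((2:ℂ)^j) = (((2:ℝ)^j : ℝ) : ℂ) := by push_cast; rfl
    rw [this, Complex.add_re, Complex.ofReal_re]
  rw [h2, abs_of_nonneg (by positivity)] at h1
  linarith

lemma norm_add_ge_one {z : ℂ} (hz : 0 ≤ z.re) (j : ℕ) : 1 ≤ ‖z + 2^j‖ :=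
  (one_le_pow₀ (by norm_num)).trans (norm_add_ge hz j)

lemma add_pow_ne {z : ℂ} (hz : 0 ≤ z.re) (j : ℕ) : z + 2^j ≠ 0 := by
  intro h
  have := norm_add_ge_one hz j
  rw [h] at this; norm_num at this

lemma HH_term_norm {z : ℂ} (hz : 0 ≤ z.re) (j : ℕ) :
    ‖((ecoef j / Qinf : ℝ) : ℂ) / (z + 2^j)‖ ≤ |ecoef j / Qinf| := by
  rw [norm_div, Complex.norm_real, Real.norm_eq_abs]
  exact div_le_self (abs_nonneg _) (norm_add_ge_one hz j)

lemma HH_summable {z : ℂ} (hz : 0 ≤ z.re) :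
    Summable (fun j => ((ecoef j / Qinf : ℝ) : ℂ) / (z + 2^j)) :=
  Summable.of_norm_bounded ccoef_summable (HH_term_norm hz)

lemma HH_rec {z : ℂ} (hz : 0 ≤ z.re) : (1 + z) * HH z = HH (z/2) := by
  have h0 : ∑' j, ((ecoef j / Qinf : ℝ) : ℂ) = 0 := by
    rw [← Complex.ofReal_tsum, tsum_div_const]
    have := Eul_one
    simp only [Eul, one_pow, mul_one] at this
    rw [this]; simp
  have hs0 : Summable (fun j => ((ecoef j / Qinf : ℝ) : ℂ)) :=
    Complex.summable_ofReal.2 (ecoef_summable.div_const _)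
  have hs1 := (HH_summable hz).mul_left (1+z)
  unfold HH
  rw [← tsum_mul_left, ← sub_zero (∑' j, (1+z) * _), ← h0, ← hs1.tsum_sub hs0, (hs1.sub hs0).tsum_eq_zero_add]
  have e0 : (1 + z) * (((ecoef 0 / Qinf : ℝ) : ℂ) / (z + 2 ^ 0)) - ((ecoef 0 / Qinf : ℝ) : ℂ) = 0 := by
    have := add_pow_ne hz 0
    rw [pow_zero] at this ⊢
    field_simp; ring
  rw [e0, zero_add]
  congr 1
  ext j
  have h1 := add_pow_ne hz (j+1)
  have h2 : z/2 + 2^j ≠ 0 := by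
    apply add_pow_ne; simp only [Complex.div_ofNat_re]; positivity
  have h3 : ((ecoef (j+1) : ℝ) : ℂ) * ((2:ℂ)^(j+1) - 1) = -2 * (ecoef j : ℝ) := by
    have := congrArg (fun r : ℝ => (r:ℂ)) (ecoef_succ j)
    push_cast at this; exact this
  have hQ : (Qinf : ℂ) ≠ 0 := by exact_mod_cast Qinf_pos.ne'
  push_cast
  have e1 : z + 2^(j+1) = 2 * (z/2 + 2^j) := by rw [pow_succ]; ring
  have e2 : (1 + z) * ((ecoef (j+1) : ℂ) / Qinf / (z + 2^(j+1))) - (ecoef (j+1) : ℂ) / Qinf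
      = - ((ecoef (j+1) : ℂ) * ((2:ℂ)^(j+1) - 1)) / Qinf / (z + 2^(j+1)) := by
    field_simp; ring
  rw [e2, h3, e1]; field_simp

lemma HH_zero : HH 0 = 1 := by
  unfold HH
  have : ∀ j, ((ecoef j / Qinf : ℝ) : ℂ) / (0 + 2^j) = ((ecoef j * (1/2)^j / Qinf : ℝ) : ℂ) := by
    intro j; push_cast; rw [zero_add, one_div, inv_pow]; ring
  simp only [this]
  rw [← Complex.ofReal_tsum, tsum_div_const]
  have h := Eul_half
  unfold Eul at h
  rw [h, div_self Qinf_pos.ne']; simp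

lemma HH_prod {z : ℂ} (hz : 0 ≤ z.re) (n : ℕ) :
    HH z * ∏ k ∈ Finset.range n, (1 + z / 2^k) = HH (z / 2^n) := by
  induction n with
  | zero => simp
  | succ n ih =>
    rw [Finset.prod_range_succ, ← mul_assoc, ih, mul_comm, HH_rec]
    · rw [pow_succ, div_div]
    · have : z / 2^n = z / (((2:ℝ)^n : ℝ) : ℂ) := by push_cast; rfl
      rw [this, Complex.div_ofReal_re]; positivity

lemma div_pow_re {z : ℂ} (hz : 0 ≤ z.re) (n : ℕ) : 0 ≤ (z / 2^n).re := by
  have : z / 2^n = z / (((2:ℝ)^n : ℝ) : ℂ) := by push_cast; rfl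
  rw [this, Complex.div_ofReal_re]; positivity

lemma HH_tendsto {z : ℂ} (hz : 0 ≤ z.re) : Tendsto (fun n : ℕ => HH (z / 2^n)) atTop (nhds 1) := by
  rw [← HH_zero]
  unfold HH
  refine tendsto_tsum_of_dominated_convergence ccoef_summable (fun j => ?_) ?_
  · have h1 : Tendsto (fun n : ℕ => z / 2^n) atTop (nhds 0) := by
      have := (tendsto_pow_atTop_nhds_zero_of_norm_lt_one (x := (1/2:ℂ)) (by norm_num)).const_mul z
      simp only [mul_zero] at this
      refine this.congr (fun n => ?_)
      rw [one_div, inv_pow]; rfl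
    refine Tendsto.div tendsto_const_nhds (h1.add tendsto_const_nhds) ?_
    simp
  · exact Eventually.of_forall (fun n j => HH_term_norm (div_pow_re hz n) j)

lemma HH_prod_tendsto {z : ℂ} (hz : 0 ≤ z.re) :
    Tendsto (fun n : ℕ => HH z * ∏ k ∈ Finset.range n, (1 + z / 2^k)) atTop (nhds 1) :=
  (HH_tendsto hz).congr (fun n => (HH_prod hz n).symm)

noncomputable def ak (s : ℝ) (k : ℕ) : ℝ := s / (2^k + s)
noncomputable def rho (s v : ℝ) : ℝ := (1/2) * ∑' k, Real.log (1 + (v * ak s k)^2)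
noncomputable def Th (s v : ℝ) : ℝ := ∑' k, Real.arctan (v * ak s k)
noncomputable def LS (s : ℝ) : ℝ := ∑' k : ℕ, Real.log (1 + s / 2^k)

lemma ak_pos {s : ℝ} (hs : 0 < s) (k : ℕ) : 0 < ak s k := by unfold ak; positivity
lemma ak_le_one {s : ℝ} (hs : 0 < s) (k : ℕ) : ak s k ≤ 1 := by
  unfold ak; rw [div_le_one (by positivity)]; linarith [pow_pos (two_pos : (0:ℝ) < 2) k]
lemma ak_le {s : ℝ} (hs : 0 < s) (k : ℕ) : ak s k ≤ s / 2^k := by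
  unfold ak
  apply div_le_div_of_nonneg_left hs.le (by positivity); linarith

lemma sdiv_summable (s : ℝ) : Summable (fun k : ℕ => s / 2^k) := by
  have := (summable_geometric_of_lt_one (r := (1/2:ℝ)) (by norm_num) (by norm_num)).mul_left s
  refine this.congr (fun k => ?_)
  rw [one_div, inv_pow]; rfl

lemma ak_summable {s : ℝ} (hs : 0 < s) : Summable (ak s) :=
  Summable.of_nonneg_of_le (fun k => (ak_pos hs k).le) (ak_le hs) (sdiv_summable s)

lemma ak_pow_summable {s : ℝ} (hs : 0 < s) {p : ℕ} (hp : p ≠ 0) : Summable (fun k => ak s k ^ p) :=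
  Summable.of_nonneg_of_le (fun k => (pow_pos (ak_pos hs k) p).le)
    (fun k => pow_le_of_le_one (ak_pos hs k).le (ak_le_one hs k) hp) (ak_summable hs)

lemma log_one_add_le {y : ℝ} (hy : 0 ≤ y) : Real.log (1 + y) ≤ y := by
  have := Real.log_le_sub_one_of_pos (by linarith : 0 < 1 + y); linarith

lemma LS_summable {s : ℝ} (_hs : 0 < s) : Summable (fun k : ℕ => Real.log (1 + s / 2^k)) :=
  Real.summable_log_one_add_of_summable (sdiv_summable s)

lemma sq_ak_summable {s : ℝ} (hs : 0 < s) (v : ℝ) : Summable (fun k => (v * ak s k)^2) := by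
  simp only [mul_pow]
  exact (ak_pow_summable hs two_ne_zero).mul_left _

lemma rho_summable {s : ℝ} (hs : 0 < s) (v : ℝ) : Summable (fun k => Real.log (1 + (v * ak s k)^2)) :=
  Real.summable_log_one_add_of_summable (sq_ak_summable hs v)

lemma arctan_le_self' {y : ℝ} (hy : 0 ≤ y) : Real.arctan y ≤ y := by
  have hd : ∀ x : ℝ, HasDerivAt (fun x => x - Real.arctan x) (1 - 1/(1+x^2)) x := fun x =>
    (hasDerivAt_id x).sub (Real.hasDerivAt_arctan x)
  have hm : Monotone (fun x : ℝ => x - Real.arctan x) := by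
    apply monotone_of_deriv_nonneg (fun x => (hd x).differentiableAt)
    intro x
    rw [(hd x).deriv, sub_nonneg, div_le_one (by positivity)]
    nlinarith [sq_nonneg x]
  have := hm hy
  simp at this; exact this

lemma arctan_ge_cubic {y : ℝ} (hy : 0 ≤ y) : y - y^3/3 ≤ Real.arctan y := by
  have hd : ∀ x : ℝ, HasDerivAt (fun x => Real.arctan x - x + x^3/3) (1/(1+x^2) - 1 + x^2) x := fun x => by
    have := ((Real.hasDerivAt_arctan x).sub (hasDerivAt_id x)).add ((hasDerivAt_pow 3 x).div_const 3)
    exact this.congr_deriv (by norm_num)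
  have hm : Monotone (fun x : ℝ => Real.arctan x - x + x^3/3) := by
    apply monotone_of_deriv_nonneg (fun x => (hd x).differentiableAt)
    intro x
    rw [(hd x).deriv]
    have : 1/(1+x^2) - 1 + x^2 = x^4/(1+x^2) := by field_simp; ring
    rw [this]; positivity
  have := hm hy
  simp at this; linarith

lemma abs_arctan_eq (y : ℝ) : |Real.arctan y| = Real.arctan |y| := by
  rcases le_total 0 y with h | h
  · rw [abs_of_nonneg h, abs_of_nonneg (Real.arctan_nonneg.2 h)]
  · rw [abs_of_nonpos h, Real.arctan_neg, abs_of_nonpos (Real.arctan_le_zero.2 h)]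

lemma abs_arctan_le (y : ℝ) : |Real.arctan y| ≤ |y| := by
  rw [abs_arctan_eq]; exact arctan_le_self' (abs_nonneg y)

lemma abs_sub_arctan_le (y : ℝ) : |y - Real.arctan y| ≤ |y|^3/3 := by
  rcases le_total 0 y with h | h
  · have h1 := arctan_le_self' h
    have h2 := arctan_ge_cubic h
    rw [abs_of_nonneg h, abs_of_nonneg (by linarith)]; linarith
  · have h1 := arctan_le_self' (neg_nonneg.2 h)
    have h2 := arctan_ge_cubic (neg_nonneg.2 h)
    rw [Real.arctan_neg] at h1 h2
    rw [abs_of_nonpos h, abs_of_nonpos (by linarith)]; linarith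

lemma Th_summable {s : ℝ} (hs : 0 < s) (v : ℝ) : Summable (fun k => Real.arctan (v * ak s k)) :=
  Summable.of_norm_bounded ((ak_summable hs).mul_left v).abs (fun _ => abs_arctan_le _)

lemma one_add_I_mul (y : ℝ) : (1 + Complex.I * y : ℂ) =
    Complex.exp ((1/2 * Real.log (1 + y^2) : ℝ) + (Real.arctan y : ℝ) * Complex.I) := by
  have h : 0 < 1 + y^2 := by positivity
  have h1 : Real.exp (1/2 * Real.log (1+y^2)) = √(1+y^2) := by
    have : 1/2 * Real.log (1+y^2) = Real.log √(1+y^2) := by rw [Real.log_sqrt h.le]; ring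
    rw [this, Real.exp_log (Real.sqrt_pos.2 h)]
  have h2 := (Real.sqrt_pos.2 h).ne'
  rw [Complex.exp_add, ← Complex.ofReal_exp, h1, Complex.exp_mul_I, ← Complex.ofReal_cos, ← Complex.ofReal_sin,
    Real.cos_arctan, Real.sin_arctan]
  have h3 : ((√(1+y^2) : ℝ) : ℂ) ≠ 0 := by exact_mod_cast h2
  push_cast
  field_simp

lemma HH_eq {s : ℝ} (hs : 0 < s) (v : ℝ) : HH (s + Complex.I * (s * v)) =
    Complex.exp (-(LS s : ℝ)) * Complex.exp (-((rho s v : ℝ) + (Th s v : ℝ) * Complex.I)) := by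
  set z : ℂ := s + Complex.I * (s * v) with hz
  have hre : 0 ≤ z.re := by simp [hz, hs.le]
  have hfac : ∀ k : ℕ, 1 + z / 2^k = Complex.exp ((Real.log (1 + s/2^k) : ℝ) +
      ((1/2 * Real.log (1 + (v * ak s k)^2) : ℝ) + (Real.arctan (v * ak s k) : ℝ) * Complex.I)) := by
    intro k
    rw [Complex.exp_add, ← one_add_I_mul, ← Complex.ofReal_exp, Real.exp_log (by positivity)]
    have h1 : (2:ℂ)^k ≠ 0 := pow_ne_zero _ two_ne_zero
    have h2 : (2:ℂ)^k + s ≠ 0 := by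
      have : (2:ℝ)^k + s ≠ 0 := by positivity
      exact_mod_cast this
    rw [hz]; unfold ak; push_cast; field_simp
    ring
  have hsum : HasSum (fun k : ℕ => ((Real.log (1 + s/2^k) : ℝ) : ℂ) +
      ((1/2 * Real.log (1 + (v * ak s k)^2) : ℝ) + (Real.arctan (v * ak s k) : ℝ) * Complex.I))
      ((LS s : ℝ) + ((rho s v : ℝ) + (Th s v : ℝ) * Complex.I)) := by
    refine HasSum.add ?_ (HasSum.add ?_ (HasSum.mul_right _ ?_))
    · exact Complex.hasSum_ofReal.2 (LS_summable hs).hasSum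
    · exact Complex.hasSum_ofReal.2 ((rho_summable hs v).hasSum.mul_left (1/2))
    · exact Complex.hasSum_ofReal.2 (Th_summable hs v).hasSum
  have hprod : Tendsto (fun n : ℕ => ∏ k ∈ Finset.range n, (1 + z / 2^k)) atTop
      (nhds (Complex.exp ((LS s : ℝ) + ((rho s v : ℝ) + (Th s v : ℝ) * Complex.I)))) := by
    simp only [hfac, ← Complex.exp_sum]
    exact (Complex.continuous_exp.tendsto _).comp hsum.tendsto_sum_nat
  have h1 := tendsto_nhds_unique (hprod.const_mul (HH z)) (HH_prod_tendsto hre)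
  rw [← Complex.exp_add, ← neg_add, Complex.exp_neg]
  exact eq_inv_of_mul_eq_one_left h1

lemma HH_cont {s : ℝ} (hs : 0 < s) : Continuous (fun v : ℝ => HH (s + Complex.I * (s * v))) := by
  unfold HH
  have hre : ∀ v : ℝ, 0 ≤ (s + Complex.I * (s * v) : ℂ).re := by intro v; simp [hs.le]
  refine continuous_tsum (fun j => ?_) ccoef_summable (fun j v => HH_term_norm (hre v) j)
  exact Continuous.div (by fun_prop) (by fun_prop) (fun v => add_pow_ne (hre v) j)

/-- the integrand. -/
noncomputable def gI (s v : ℝ) : ℂ := Complex.exp (-((rho s v : ℝ) + (Th s v : ℝ) * Complex.I))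

lemma gI_eq {s : ℝ} (hs : 0 < s) (v : ℝ) : gI s v = Complex.exp (LS s : ℝ) * HH (s + Complex.I * (s * v)) := by
  rw [HH_eq hs, ← mul_assoc, ← Complex.exp_add, add_neg_cancel, Complex.exp_zero, one_mul]; rfl

lemma gI_cont {s : ℝ} (hs : 0 < s) : Continuous (gI s) := by
  have : gI s = fun v : ℝ => Complex.exp (LS s : ℝ) * HH (s + Complex.I * (s * v)) := by
    ext v; exact gI_eq hs v
  rw [this]; exact continuous_const.mul (HH_cont hs)

lemma gI_norm (s v : ℝ) : ‖gI s v‖ = Real.exp (-rho s v) := by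
  unfold gI; rw [Complex.norm_exp]; simp

lemma gI_re (s v n : ℝ) : (Complex.exp ((n * v : ℝ) * Complex.I) * gI s v).re =
    Real.exp (-rho s v) * Real.cos (n * v - Th s v) := by
  unfold gI
  rw [← Complex.exp_add, Complex.exp_re]; congr 2 <;> simp
  ring

lemma rho_ge_finset {s : ℝ} (hs : 0 < s) (v : ℝ) (N : ℕ) :
    (1/2) * ∑ k ∈ Finset.range N, Real.log (1 + (v * ak s k)^2) ≤ rho s v := by
  unfold rho
  gcongr
  refine (rho_summable hs v).sum_le_tsum _ (fun k _ => Real.log_nonneg ?_)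
  nlinarith [sq_nonneg (v * ak s k)]

lemma ak_anti {s : ℝ} (hs : 0 < s) {i j : ℕ} (h : i ≤ j) : ak s j ≤ ak s i := by
  unfold ak
  have : (2:ℝ)^i ≤ 2^j := pow_le_pow_right₀ (by norm_num) h
  gcongr

/-- power decay -/
lemma R_le_pow {s : ℝ} (hs : 0 < s) (v : ℝ) (N : ℕ) :
    Real.exp (-rho s v) ≤ Real.exp (-(N/2 * Real.log (1 + (v * ak s (N-1))^2))) := by
  apply Real.exp_le_exp.2
  have h := rho_ge_finset hs v N
  have h2 : ∑ k ∈ Finset.range N, Real.log (1 + (v * ak s (N-1))^2) ≤ ∑ k ∈ Finset.range N, Real.log (1 + (v * ak s k)^2) := by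
    refine Finset.sum_le_sum (fun k hk => ?_)
    have hk' := Finset.mem_range.1 hk
    have h3 := ak_anti hs (show k ≤ N-1 by omega)
    have h4 := (ak_pos hs (N-1)).le
    apply Real.log_le_log (by positivity)
    rw [mul_pow, mul_pow]
    gcongr
  simp only [Finset.sum_const, Finset.card_range, nsmul_eq_mul] at h2
  linarith

lemma R_le_two {s : ℝ} (hs : 0 < s) (v : ℝ) :
    Real.exp (-rho s v) ≤ (1 + (ak s 1 * v)^2)⁻¹ := by
  have h := R_le_pow hs v 2
  refine h.trans (le_of_eq ?_)
  norm_num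
  rw [Real.exp_neg, Real.exp_log (by positivity), mul_comm]

lemma R_integrable {s : ℝ} (hs : 0 < s) : MeasureTheory.Integrable (fun v => Real.exp (-rho s v)) := by
  have h1 : MeasureTheory.Integrable (fun v => (1 + (ak s 1 * v)^2)⁻¹) :=
    integrable_inv_one_add_sq.comp_mul_left' (ak_pos hs 1).ne'
  refine h1.mono' ?_ (Eventually.of_forall (fun v => ?_))
  · have : (fun v => Real.exp (-rho s v)) = fun v => ‖gI s v‖ := by ext v; rw [gI_norm]
    rw [this]
    exact (gI_cont hs).norm.aestronglyMeasurable
  · rw [Real.norm_eq_abs, abs_of_pos (Real.exp_pos _)]; exact R_le_two hs v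

lemma gI_integrable {s : ℝ} (hs : 0 < s) : MeasureTheory.Integrable (gI s) := by
  refine (R_integrable hs).mono' (gI_cont hs).aestronglyMeasurable (Eventually.of_forall (fun v => ?_))
  rw [gI_norm]

lemma F_eq_tsum (x : ℝ) : F x = ∑' j, (ecoef j / Qinf) * Real.exp (-(2:ℝ)^j * x) := by
  unfold F ecoef
  congr 1; ext j
  rw [← div_div]; ring

lemma F_term_bound {x : ℝ} (hx : 0 < x) (j : ℕ) :
    ‖(ecoef j / Qinf) * Real.exp (-(2:ℝ)^j * x)‖ ≤ |ecoef j / Qinf| := by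
  rw [norm_mul, Real.norm_eq_abs, Real.norm_eq_abs, abs_of_pos (Real.exp_pos _)]
  refine mul_le_of_le_one_right (abs_nonneg _) (Real.exp_le_one_iff.2 ?_)
  have : 0 < (2:ℝ)^j * x := by positivity
  linarith

lemma F_contOn : ContinuousOn F (Set.Ioi 0) := by
  have : F = fun x => ∑' j, (ecoef j / Qinf) * Real.exp (-(2:ℝ)^j * x) := by ext x; exact F_eq_tsum x
  rw [this]
  refine continuousOn_tsum (fun j => by fun_prop) ccoef_summable (fun j x hx => F_term_bound hx j)

/-- the function whose Fourier transform we take -/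
noncomputable def fT (s x : ℝ) : ℂ := Set.indicator (Set.Ioi (0:ℝ)) (fun x => ((Real.exp (-s*x) * F x : ℝ) : ℂ)) x

lemma fT_integrable {s : ℝ} (hs : 0 < s) : MeasureTheory.Integrable (fT s) := by
  have h0 : MeasureTheory.IntegrableOn (fun x => ((Real.exp (-s*x) * F x : ℝ) : ℂ)) (Set.Ioi 0) := by
    have h1 : MeasureTheory.IntegrableOn (fun x : ℝ => (∑' j, |ecoef j / Qinf|) * Real.exp (-s*x)) (Set.Ioi 0) :=
      (integrableOn_exp_mul_Ioi (by linarith : -s < 0) 0).const_mul _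
    refine h1.mono' ?_ ?_
    · refine ContinuousOn.aestronglyMeasurable ?_ measurableSet_Ioi
      refine Complex.continuous_ofReal.comp_continuousOn ?_
      exact ContinuousOn.mul (by fun_prop) F_contOn
    · filter_upwards [MeasureTheory.ae_restrict_mem measurableSet_Ioi] with x hx
      rw [Complex.norm_real, norm_mul, Real.norm_eq_abs, abs_of_pos (Real.exp_pos _), mul_comm]
      refine mul_le_mul_of_nonneg_right ?_ (Real.exp_pos _).le
      rw [F_eq_tsum]
      exact tsum_of_norm_bounded ccoef_summable.hasSum (F_term_bound hx)
  exact (MeasureTheory.integrable_indicator_iff measurableSet_Ioi).2 h0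

lemma fT_fourier {s : ℝ} (hs : 0 < s) (w : ℝ) :
    FourierTransform.fourier (fT s) w = HH (s + Complex.I * (2 * π * w)) := by
  rw [Real.fourier_eq']
  set z : ℂ := s + Complex.I * (2 * π * w) with hz
  have hzre : z.re = s := by simp [hz]
  have h1 : (fun v : ℝ => Complex.exp (((-2 * π * inner ℝ v w : ℝ) : ℂ) * Complex.I) • fT s v) =
      Set.indicator (Set.Ioi (0:ℝ)) (fun x : ℝ => ∑' j : ℕ, ((ecoef j / Qinf : ℝ) : ℂ) * Complex.exp (-(z + 2^j) * x)) := by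
    ext x
    unfold fT
    by_cases hx : x ∈ Set.Ioi (0:ℝ)
    · rw [Set.indicator_of_mem hx, Set.indicator_of_mem hx, F_eq_tsum, ← tsum_mul_left, Complex.ofReal_tsum, smul_eq_mul, ← tsum_mul_left]
      congr 1; ext j
      push_cast
      rw [show ∀ a b c d : ℂ, a * (b * (c * d)) = c * (a * b * d) by intros; ring, ← Complex.exp_add, ← Complex.exp_add]
      congr 2
      rw [hz]; simp; ring
    · rw [Set.indicator_of_notMem hx, Set.indicator_of_notMem hx, smul_zero]
  rw [h1, MeasureTheory.integral_indicator measurableSet_Ioi]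
  have hre : ∀ j : ℕ, (-(z + 2^j)).re = -(s + 2^j) := by
    intro j
    have : ((2:ℂ)^j) = (((2:ℝ)^j : ℝ) : ℂ) := by push_cast; rfl
    rw [this, Complex.neg_re, Complex.add_re, Complex.ofReal_re, hzre]
  have hneg : ∀ j : ℕ, (-(z + 2^j)).re < 0 := by
    intro j; rw [hre]; have : (0:ℝ) < 2^j := by positivity
    linarith
  have hint : ∀ j : ℕ, MeasureTheory.IntegrableOn (fun x : ℝ => ((ecoef j / Qinf : ℝ) : ℂ) * Complex.exp (-(z + 2^j) * x)) (Set.Ioi 0) := fun j =>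
    (integrableOn_exp_mul_complex_Ioi (hneg j) 0).const_mul _
  have hsum := MeasureTheory.hasSum_integral_of_summable_integral_norm (μ := MeasureTheory.volume.restrict (Set.Ioi 0))
    (F := fun (j : ℕ) (x : ℝ) => ((ecoef j / Qinf : ℝ) : ℂ) * Complex.exp (-(z + 2^j) * x)) hint ?_
  · rw [← hsum.tsum_eq]
    unfold HH
    congr 1; ext j
    rw [MeasureTheory.integral_const_mul, integral_exp_mul_complex_Ioi (hneg j)]
    simp
    rw [← neg_add, neg_div_neg_eq, add_comm, mul_one_div]
  · have hn : ∀ j : ℕ, ∫ x in Set.Ioi (0:ℝ), ‖((ecoef j / Qinf : ℝ) : ℂ) * Complex.exp (-(z + 2^j) * x)‖ =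
        |ecoef j / Qinf| * (1 / (s + 2^j)) := by
      intro j
      have : ∀ x : ℝ, ‖((ecoef j / Qinf : ℝ) : ℂ) * Complex.exp (-(z + 2^j) * x)‖ = |ecoef j / Qinf| * Real.exp (-(s + 2^j) * x) := by
        intro x
        rw [norm_mul, Complex.norm_real, Real.norm_eq_abs, Complex.norm_exp, Complex.re_mul_ofReal, hre]
      simp only [this]
      have h2 : -(s + 2^j) < 0 := by rw [← hre]; exact hneg j
      rw [MeasureTheory.integral_const_mul, integral_exp_mul_Ioi h2]
      simp
      left
      rw [← neg_add, neg_div_neg_eq, add_comm, one_div]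
    simp only [hn]
    refine Summable.of_nonneg_of_le (fun j => by positivity) (fun j => ?_) (ccoef_summable.mul_right (1/s))
    gcongr
    have : (0:ℝ) < 2^j := by positivity
    linarith

lemma inversion {s x : ℝ} (hs : 0 < s) (hx : 0 < x) :
    F x = Real.exp (s * x - LS s) * (s / (2*π)) *
      ∫ v, Real.exp (-rho s v) * Real.cos (s * x * v - Th s v) := by
  have hc : (2 * π / s) ≠ 0 := by positivity
  have hFT : FourierTransform.fourier (fT s) = fun w => Complex.exp (-(LS s : ℝ)) * gI s ((2*π/s) * w) := by
    ext w
    rw [fT_fourier hs, gI_eq hs, ← mul_assoc (Complex.exp _), ← Complex.exp_add, neg_add_cancel, Complex.exp_zero, one_mul]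
    congr 3
    have : (s:ℂ) ≠ 0 := by exact_mod_cast hs.ne'
    push_cast; field_simp
  have hFTi : MeasureTheory.Integrable (FourierTransform.fourier (fT s)) := by
    rw [hFT]
    exact ((gI_integrable hs).comp_mul_left' hc).const_mul _
  have hca : ContinuousAt (fT s) x := by
    have h1 : ContinuousAt (fun x => ((Real.exp (-s*x) * F x : ℝ) : ℂ)) x := by
      have := F_contOn.continuousAt (Ioi_mem_nhds hx)
      fun_prop
    refine h1.congr ?_
    filter_upwards [Ioi_mem_nhds hx] with y hy
    unfold fT; rw [Set.indicator_of_mem hy]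
  have h := (fT_integrable hs).fourierInv_fourier_eq hFTi hca
  rw [Real.fourierInv_eq', hFT] at h
  have h2 : (fun w : ℝ => Complex.exp (((2 * π * inner ℝ w x : ℝ) : ℂ) * Complex.I) • (Complex.exp (-(LS s : ℝ)) * gI s ((2*π/s) * w)))
     = fun w : ℝ => Complex.exp (-(LS s : ℝ)) * (fun v : ℝ => Complex.exp ((s * x * v : ℝ) * Complex.I) * gI s v) ((2*π/s) * w) := by
    ext w
    have : s * x * (2*π/s * w) = 2 * π * inner ℝ w x := by simp; field_simp
    simp only [smul_eq_mul, this]; ring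
  rw [h2, MeasureTheory.integral_const_mul, MeasureTheory.Measure.integral_comp_mul_left
    (fun v : ℝ => Complex.exp ((s * x * v : ℝ) * Complex.I) * gI s v)] at h
  have h3 : fT s x = ((Real.exp (-s*x) * F x : ℝ) : ℂ) := by
    unfold fT; rw [Set.indicator_of_mem (Set.mem_Ioi.2 hx)]
  rw [h3] at h
  have hint : MeasureTheory.Integrable (fun v : ℝ => Complex.exp ((s * x * v : ℝ) * Complex.I) * gI s v) := by
    refine (R_integrable hs).mono' ?_ (Eventually.of_forall (fun v => ?_))
    · have := gI_cont hs
      exact Continuous.aestronglyMeasurable (by fun_prop)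
    · rw [norm_mul, Complex.norm_exp_ofReal_mul_I, one_mul, gI_norm]
  have h4 := congrArg Complex.re h
  rw [Complex.ofReal_re, ← Complex.ofReal_neg, ← Complex.ofReal_exp, Complex.re_ofReal_mul, Complex.smul_re] at h4
  have h5 : (∫ v : ℝ, Complex.exp ((s * x * v : ℝ) * Complex.I) * gI s v).re =
      ∫ v : ℝ, Real.exp (-rho s v) * Real.cos (s * x * v - Th s v) := by
    have := integral_re hint
    simp only [RCLike.re_to_complex] at this
    rw [← this]
    congr 1; ext v; rw [gI_re]
  rw [h5, abs_of_pos (by positivity), inv_div, smul_eq_mul] at h4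
  have h6 : F x = Real.exp (s*x) * (Real.exp (-s*x) * F x) := by
    rw [← mul_assoc, ← Real.exp_add]; simp
  rw [h6, ← h4, sub_eq_add_neg, Real.exp_add]; ring

lemma Ssum_summable (ξ : ℝ) : Summable (fun m : ℕ => 1 / (((m:ℝ)+1)^2 + ξ^2)) := by
  have h : Summable (fun m : ℕ => 1 / ((m:ℝ)+1)^2) := by
    have := (summable_nat_add_iff 1).2 (Real.summable_one_div_nat_pow.2 (by norm_num : 1 < 2))
    simpa using this
  refine Summable.of_nonneg_of_le (fun m => by positivity) (fun m => ?_) h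
  apply one_div_le_one_div_of_le (by positivity)
  nlinarith [sq_nonneg ξ]

lemma Ssum_zero : ∑' m : ℕ, 1 / (((m:ℝ)+1)^2 + (0:ℝ)^2) = π^2/6 := by
  have h := hasSum_zeta_two
  have h2 := (hasSum_nat_add_iff' 1).2 h
  simp at h2
  rw [← h2.tsum_eq]
  congr 1; ext m; simp

lemma Ssum_eq {ξ : ℝ} (hξ : ξ ≠ 0) : ∑' m : ℕ, 1 / (((m:ℝ)+1)^2 + ξ^2) =
    π * (Real.cosh (π*ξ) / Real.sinh (π*ξ)) / (2*ξ) - 1/(2*ξ^2) := by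
  have hx : (Complex.I * ξ) ∈ Complex.integerComplement := by
    rintro ⟨n, hn⟩
    have := congrArg Complex.im hn
    simp at this; exact hξ this.symm
  have h := cot_series_rep' hx
  have hI := Complex.I_sq
  have hξc : (ξ:ℂ) ≠ 0 := by exact_mod_cast hξ
  have hsh : Real.sinh (π * ξ) ≠ 0 := by
    rw [Ne, Real.sinh_eq_zero]; positivity
  have hshc : Complex.sinh (π * ξ) ≠ 0 := by exact_mod_cast hsh
  have h1 : ∀ n : ℕ, (1 / (Complex.I * ξ - (n+1)) + 1 / (Complex.I * ξ + (n+1)) : ℂ) =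
      (-2 * Complex.I * ξ) * ((1 / (((n:ℝ)+1)^2 + ξ^2) : ℝ) : ℂ) := by
    intro n
    have hq : (((n:ℂ)+1)^2 + ξ^2) ≠ 0 := by
      have : (((n:ℝ)+1)^2 + ξ^2) ≠ 0 := by positivity
      exact_mod_cast this
    have hp : (Complex.I * ξ - (n+1)) * (Complex.I * ξ + (n+1)) = -(((n:ℂ)+1)^2 + ξ^2) := by
      linear_combination (ξ:ℂ)^2 * hI
    have hp0 : (Complex.I * ξ - (n+1)) * (Complex.I * ξ + (n+1)) ≠ 0 := by rw [hp]; exact neg_ne_zero.2 hq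
    have p1 := left_ne_zero_of_mul hp0
    have p2 := right_ne_zero_of_mul hp0
    rw [div_add_div _ _ p1 p2, hp]
    push_cast
    field_simp
    ring
  simp only [h1] at h
  rw [tsum_mul_left, ← Complex.ofReal_tsum] at h
  set S := ∑' m : ℕ, 1 / (((m:ℝ)+1)^2 + ξ^2)
  have hcot : Complex.cot (π * (Complex.I * ξ)) = -Complex.I * (Complex.cosh (π * ξ) / Complex.sinh (π * ξ)) := by
    rw [Complex.cot, show (π:ℂ) * (Complex.I * ξ) = (π * ξ) * Complex.I by ring, Complex.cos_mul_I, Complex.sin_mul_I]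
    field_simp
    rw [hI]; ring
  rw [hcot] at h
  have hS : (S:ℂ) = ((π * (Real.cosh (π*ξ) / Real.sinh (π*ξ)) / (2*ξ) - 1/(2*ξ^2) : ℝ) : ℂ) := by
    push_cast
    have h3 : (-2 * Complex.I * ξ) ≠ 0 := by simp [hξ]
    apply mul_left_cancel₀ h3
    rw [← h]
    field_simp
    rw [hI]; ring
  exact_mod_cast hS

lemma alt_generic {g : ℕ → ℝ} (hs : Summable g) :
    ∑' m : ℕ, (-1:ℝ)^m * g m = (∑' m : ℕ, g m) - 2 * ∑' k : ℕ, g (2*k+1) := by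
  have i0 : Function.Injective (fun k : ℕ => 2 * k) := fun a b h => by simpa using h
  have i1 : Function.Injective (fun k : ℕ => 2 * k + 1) := fun a b h => by simpa using h
  have hs0 : Summable (fun k : ℕ => g (2*k)) := hs.comp_injective i0
  have hs1 : Summable (fun k : ℕ => g (2*k+1)) := hs.comp_injective i1
  have e0 : ∀ k : ℕ, (-1:ℝ)^(2*k) * g (2*k) = g (2*k) := fun k => by
    rw [pow_mul, neg_one_sq, one_pow, one_mul]
  have e1 : ∀ k : ℕ, (-1:ℝ)^(2*k+1) * g (2*k+1) = -g (2*k+1) := fun k => by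
    rw [pow_succ, pow_mul, neg_one_sq, one_pow]; ring
  have k0 : Summable (fun k : ℕ => (-1:ℝ)^(2*k) * g (2*k)) := by simpa only [e0] using hs0
  have k1 : Summable (fun k : ℕ => (-1:ℝ)^(2*k+1) * g (2*k+1)) := by simpa only [e1] using hs1.neg
  have r1 := tsum_even_add_odd hs0 hs1
  have r2 := tsum_even_add_odd (f := fun m : ℕ => (-1:ℝ)^m * g m) k0 k1
  have r3 : ∑' k : ℕ, (-1:ℝ)^(2*k) * g (2*k) = ∑' k : ℕ, g (2*k) := tsum_congr e0
  have r4 : ∑' k : ℕ, (-1:ℝ)^(2*k+1) * g (2*k+1) = - ∑' k : ℕ, g (2*k+1) := by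
    rw [← tsum_neg]; exact tsum_congr e1
  rw [r3, r4] at r2
  linarith

lemma alt_sum (ξ : ℝ) : ∑' m : ℕ, (-1:ℝ)^m * (1 / (((m:ℝ)+1)^2 + ξ^2)) =
    (∑' m : ℕ, 1 / (((m:ℝ)+1)^2 + ξ^2)) - (1/2) * ∑' m : ℕ, 1 / (((m:ℝ)+1)^2 + (ξ/2)^2) := by
  have h := alt_generic (Ssum_summable ξ)
  have e : ∀ k : ℕ, 1 / ((((2*k+1:ℕ):ℝ)+1)^2 + ξ^2) = 1/4 * (1 / (((k:ℝ)+1)^2 + (ξ/2)^2)) := by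
    intro k
    have e2 : (((2*k+1:ℕ):ℝ)+1)^2 + ξ^2 = 4 * (((k:ℝ)+1)^2 + (ξ/2)^2) := by push_cast; ring
    rw [e2, one_div_mul_one_div]
  have e3 : ∑' k : ℕ, 1 / ((((2*k+1:ℕ):ℝ)+1)^2 + ξ^2) = 1/4 * ∑' k : ℕ, (1 / (((k:ℝ)+1)^2 + (ξ/2)^2)) := by
    rw [← tsum_mul_left]; exact tsum_congr e
  rw [h, e3]
  ring

lemma alt_sum_zero : ∑' m : ℕ, (-1:ℝ)^m * (1 / (((m:ℝ)+1)^2 + (0:ℝ)^2)) = π^2/12 := by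
  rw [alt_sum, zero_div, Ssum_zero]; ring

lemma alt_sum_ne {ξ : ℝ} (hξ : ξ ≠ 0) : ∑' m : ℕ, (-1:ℝ)^m * (1 / (((m:ℝ)+1)^2 + ξ^2)) =
    1/(2*ξ^2) - π / (2 * ξ * Real.sinh (π * ξ)) := by
  rw [alt_sum, Ssum_eq hξ, Ssum_eq (by positivity : ξ/2 ≠ 0)]
  set y := π * (ξ/2) with hy
  have hy0 : Real.sinh y ≠ 0 := by rw [Ne, Real.sinh_eq_zero]; positivity
  have hc := (Real.cosh_pos y).ne'
  have h1 : π * ξ = 2 * y := by rw [hy]; ring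
  have hcs := Real.cosh_sq y
  rw [h1, Real.sinh_two_mul, Real.cosh_two_mul]
  have : Real.sinh y ^2 = Real.cosh y ^2 - 1 := by linarith
  rw [this]
  field_simp
  ring

lemma ak_sum_bound {s : ℝ} {N : ℕ} (hN : 1 ≤ N) (h1 : (2:ℝ)^(N-1) ≤ s) (h2 : s < 2^N) {p : ℕ}
    (hp : p = 1 ∨ p = 2) : |∑' k, ak s k ^ p - N| ≤ 4 := by
  have hs : 0 < s := lt_of_lt_of_le (by positivity) h1
  have hp0 : p ≠ 0 := by omega
  have hsum := ak_pow_summable hs hp0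
  rw [← hsum.sum_add_tsum_nat_add N]
  have ht0 : 0 ≤ ∑' k, ak s (k+N) ^ p := tsum_nonneg (fun k => (pow_pos (ak_pos hs _) p).le)
  have ht1 : ∑' k, ak s (k+N) ^ p ≤ 2 := by
    rw [← tsum_geometric_two]
    refine Summable.tsum_le_tsum (fun k => ?_) ((summable_nat_add_iff N).2 hsum) summable_geometric_two
    refine (pow_le_of_le_one (ak_pos hs _).le (ak_le_one hs _) hp0).trans ((ak_le hs _).trans ?_)
    rw [div_le_iff₀ (by positivity), pow_add, one_div, inv_pow]
    field_simp
    exact h2.le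
  have hh1 : ∑ k ∈ Finset.range N, ak s k ^ p ≤ N := by
    have := Finset.sum_le_sum (s := Finset.range N) (f := fun k => ak s k ^ p) (g := fun _ => (1:ℝ))
      (fun k _ => pow_le_one₀ (ak_pos hs _).le (ak_le_one hs _))
    simpa using this
  have hh2 : (N:ℝ) - 4 ≤ ∑ k ∈ Finset.range N, ak s k ^ p := by
    have h3 : ∀ k ∈ Finset.range N, 1 - 2 * (2^k / s) ≤ ak s k ^ p := by
      intro k _
      have h4 : 1 - 2^k/s ≤ ak s k := by
        unfold ak
        rw [le_div_iff₀ (by positivity)]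
        have : (1 - 2^k/s) * (2^k + s) = s - 2^k * 2^k / s := by field_simp; ring
        rw [this]
        have : 0 ≤ (2:ℝ)^k * 2^k / s := by positivity
        linarith
      have h5 := ak_pos hs k
      have h6 : 0 ≤ (2:ℝ)^k / s := by positivity
      rcases hp with rfl | rfl
      · rw [pow_one]; linarith
      · nlinarith [sq_nonneg (ak s k - 1)]
    have h4 := Finset.sum_le_sum h3
    rw [Finset.sum_sub_distrib, ← Finset.mul_sum, ← Finset.sum_div] at h4
    have h5 : ∑ k ∈ Finset.range N, (2:ℝ)^k = 2^N - 1 := by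
      rw [geom_sum_eq (by norm_num)]; norm_num
    have h6 : ((2:ℝ)^N - 1) / s ≤ 2 := by
      rw [div_le_iff₀ hs]
      have : (2:ℝ)^N = 2 * 2^(N-1) := by rw [← pow_succ']; congr 1; omega
      rw [this]; linarith
    rw [h5] at h4
    simp at h4
    linarith
  rw [abs_le]; constructor <;> linarith

lemma log_quad {y : ℝ} (hy : 0 ≤ y) : y - y^2/2 ≤ Real.log (1+y) := by
  refine le_trans ?_ (Real.le_log_one_add_of_nonneg hy)
  rw [le_div_iff₀ (by linarith)]
  have : 0 ≤ y^3 := by positivity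
  nlinarith

lemma rho_le {s : ℝ} (hs : 0 < s) (v : ℝ) : rho s v ≤ (∑' k, ak s k ^ 2) * v^2 / 2 := by
  have : ∑' k, Real.log (1 + (v * ak s k)^2) ≤ ∑' k, (v * ak s k)^2 :=
    (rho_summable hs v).tsum_le_tsum (fun k => log_one_add_le (sq_nonneg _)) (sq_ak_summable hs v)
  simp only [mul_pow] at this
  rw [tsum_mul_left] at this
  unfold rho
  simp only [mul_pow]
  linarith

lemma rho_ge {s : ℝ} (hs : 0 < s) (v : ℝ) :
    (∑' k, ak s k ^ 2) * v^2 / 2 - (∑' k, ak s k ^ 2) * v^4 / 4 ≤ rho s v := by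
  have h2 := ak_pow_summable hs two_ne_zero
  have : ∑' k, (v^2 - v^4/2) * ak s k ^ 2 ≤ ∑' k, Real.log (1 + (v * ak s k)^2) := by
    refine (h2.mul_left _).tsum_le_tsum (fun k => ?_) (rho_summable hs v)
    refine le_trans ?_ (log_quad (sq_nonneg _))
    have h3 := ak_pos hs k
    have h4 := ak_le_one hs k
    have h5 : ak s k ^ 2 * ak s k ^ 2 ≤ ak s k ^ 2 * 1 := by
      gcongr; exact pow_le_one₀ h3.le h4
    have h6 : 0 ≤ v^4 := by positivity
    nlinarith [mul_le_mul_of_nonneg_left h5 h6]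
  rw [tsum_mul_left] at this
  unfold rho
  linarith

lemma Th_bound {s : ℝ} (hs : 0 < s) (v : ℝ) :
    |(∑' k, ak s k) * v - Th s v| ≤ (∑' k, ak s k ^ 2) * |v|^3 / 3 := by
  have h1 := (ak_summable hs).mul_left v
  have h2 := ak_pow_summable hs two_ne_zero
  unfold Th
  rw [mul_comm, ← tsum_mul_left, ← h1.tsum_sub (Th_summable hs v)]
  have h3 : HasSum (fun k => |v|^3/3 * ak s k ^ 2) (|v|^3/3 * ∑' k, ak s k ^ 2) := h2.hasSum.mul_left _
  have := tsum_of_norm_bounded h3 (f := fun k => v * ak s k - Real.arctan (v * ak s k)) (fun k => ?_)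
  · rw [Real.norm_eq_abs] at this; linarith
  · rw [Real.norm_eq_abs]
    refine (abs_sub_arctan_le _).trans ?_
    rw [abs_mul, mul_pow, abs_of_pos (ak_pos hs k)]
    have h5 : ak s k ^ 3 ≤ ak s k ^ 2 := pow_le_pow_of_le_one (ak_pos hs k).le (ak_le_one hs k) (by norm_num)
    have h6 : 0 ≤ |v|^3 := by positivity
    nlinarith [mul_le_mul_of_nonneg_left h5 h6]

lemma ak_half {s : ℝ} {N : ℕ} (h1 : (2:ℝ)^(N-1) ≤ s) : 1/2 ≤ ak s (N-1) := by
  have hs : 0 < s := lt_of_lt_of_le (by positivity) h1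
  unfold ak
  rw [le_div_iff₀ (by positivity)]; linarith

lemma R_le_quarter {s : ℝ} {N : ℕ} (h1 : (2:ℝ)^(N-1) ≤ s) (v : ℝ) :
    Real.exp (-rho s v) ≤ Real.exp (-(N/2 * Real.log (1 + v^2/4))) := by
  have hs : 0 < s := lt_of_lt_of_le (by positivity) h1
  refine (R_le_pow hs v N).trans ?_
  have h2 := ak_half h1
  have h3 : Real.log (1 + v^2/4) ≤ Real.log (1 + (v * ak s (N-1))^2) := by
    apply Real.log_le_log (by positivity)
    rw [mul_pow]
    nlinarith [sq_nonneg v, mul_le_mul h2 h2 (by norm_num) (by linarith)]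
  apply Real.exp_le_exp.2
  have : (0:ℝ) ≤ N/2 := by positivity
  nlinarith

lemma poly_exp {y : ℝ} (hy : 0 ≤ y) : (y^2 + 25*y + y^3) * Real.exp (-y/16) ≤ 200000 * Real.exp (-y/32) := by
  have hz : 0 ≤ y/32 := by positivity
  have e1 := Real.pow_div_factorial_le_exp _ hz 1
  have e2 := Real.pow_div_factorial_le_exp _ hz 2
  have e3 := Real.pow_div_factorial_le_exp _ hz 3
  norm_num [Nat.factorial] at e1 e2 e3
  have h : Real.exp (-y/16) = Real.exp (-y/32) * (Real.exp (y/32))⁻¹ := by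
    rw [← Real.exp_neg, ← Real.exp_add]; congr 1; ring
  rw [h]
  have hE := Real.exp_pos (y/32)
  have h3 : (y^2 + 25*y + y^3) ≤ 200000 * Real.exp (y/32) := by nlinarith
  calc _ = ((y^2 + 25*y + y^3) * (Real.exp (y/32))⁻¹) * Real.exp (-y/32) := by ring
    _ ≤ 200000 * Real.exp (-y/32) := by
      gcongr
      rw [mul_inv_le_iff₀ hE]; exact h3

set_option maxHeartbeats 1000000 in
lemma pointwise_small {s n D : ℝ} {N : ℕ} (hN : 8 ≤ N) (h1 : (2:ℝ)^(N-1) ≤ s) (h2 : s < 2^N)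
    (hD : 1 ≤ D) (hn : |n - N| ≤ D) {v : ℝ} (hv : |v| ≤ 1) :
    |Real.exp (-rho s v) * Real.cos (n * v - Th s v) - Real.exp (-((∑' k, ak s k ^ 2)/2) * v^2)| ≤
      200000 * D^2 / N * Real.exp (-(N/32) * v^2) := by
  have hs : 0 < s := lt_of_lt_of_le (by positivity) h1
  have hNr : (8:ℝ) ≤ N := by exact_mod_cast hN
  have a1 := ak_sum_bound (by omega) h1 h2 (p := 1) (Or.inl rfl)
  have a2 := ak_sum_bound (by omega) h1 h2 (p := 2) (Or.inr rfl)
  simp only [pow_one] at a1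
  have r1 := rho_le hs v
  have r2 := rho_ge hs v
  have tb := Th_bound hs v
  set A := ∑' k, ak s k ^ 2
  set B := ∑' k, ak s k
  have hA : A ≤ 2 * N := by rw [abs_le] at a2; linarith
  have hA0 : 0 ≤ A := by rw [abs_le] at a2; linarith
  have hdB : |n - B| ≤ 5 * D := by
    have := abs_sub_le n N B
    rw [abs_sub_comm] at a1; linarith
  set φ := n * v - Th s v with hφ
  have hφb : |φ| ≤ 5 * D * |v| + A * |v|^3/3 := by
    have : φ = (n - B) * v + (B * v - Th s v) := by rw [hφ]; ring
    rw [this]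
    refine (abs_add_le _ _).trans ?_
    rw [abs_mul]
    gcongr
  have hφ2 : φ^2/2 ≤ 25 * D^2 * v^2 + A^2 * v^6/9 := by
    have h3 : φ^2 ≤ (5 * D * |v| + A * |v|^3/3)^2 := by
      rw [← sq_abs φ]; gcongr
    have h4 : (5 * D * |v| + A * |v|^3/3)^2 ≤ 2 * (5 * D * |v|)^2 + 2 * (A * |v|^3/3)^2 := by
      nlinarith [sq_nonneg (5 * D * |v| - A * |v|^3/3)]
    have h5 : (5 * D * |v|)^2 = 25 * D^2 * v^2 := by rw [mul_pow, sq_abs]; ring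
    have h6 : (A * |v|^3/3)^2 = A^2 * v^6/9 := by
      rw [div_pow, mul_pow, ← pow_mul, show 3*2 = 2*3 by norm_num, pow_mul |v|, sq_abs]; ring
    rw [h5, h6] at h4; linarith
  set R := Real.exp (-rho s v) with hR
  have hR0 : 0 < R := Real.exp_pos _
  have hG : Real.exp (-(A/2) * v^2) = R * Real.exp (-(A * v^2/2 - rho s v)) := by
    rw [hR, ← Real.exp_add]; congr 1; ring
  have hd1 : |R * Real.cos φ - R| ≤ R * (φ^2/2) := by
    have c1 := Real.one_sub_sq_div_two_le_cos (x := φ)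
    have c2 := Real.cos_le_one φ
    have c3 : |R * Real.cos φ - R| = R * (1 - Real.cos φ) := by
      rw [show R * Real.cos φ - R = -(R * (1 - Real.cos φ)) by ring, abs_neg, abs_of_nonneg]
      exact mul_nonneg hR0.le (by linarith)
    rw [c3]
    exact mul_le_mul_of_nonneg_left (by linarith) hR0.le
  have hd2 : |R - Real.exp (-(A/2) * v^2)| ≤ R * (A * v^4/4) := by
    rw [hG]
    have g1 : Real.exp (-(A * v^2/2 - rho s v)) ≤ 1 := Real.exp_le_one_iff.2 (by linarith)
    have g2 := Real.add_one_le_exp (-(A * v^2/2 - rho s v))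
    have c3 : |R - R * Real.exp (-(A * v^2/2 - rho s v))| = R * (1 - Real.exp (-(A * v^2/2 - rho s v))) := by
      rw [show ∀ e : ℝ, R - R * e = R * (1 - e) by intro e; ring, abs_of_nonneg]
      exact mul_nonneg hR0.le (by linarith)
    rw [c3]
    exact mul_le_mul_of_nonneg_left (by linarith) hR0.le
  have hvv : v^2 ≤ 1 := by rw [← sq_abs]; exact pow_le_one₀ (abs_nonneg _) hv
  have hRb : R ≤ Real.exp (-(N * v^2)/16) := by
    refine (R_le_quarter h1 v).trans (Real.exp_le_exp.2 ?_)
    have := log_quad (y := v^2/4) (by positivity)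
    have h8 : (v^2/4)^2 ≤ v^2/16 := by
      have := mul_le_mul_of_nonneg_left hvv (sq_nonneg v)
      have e : (v^2/4)^2 = v^2 * v^2 / 16 := by ring
      rw [e]; linarith
    have h7 : v^2/8 ≤ Real.log (1 + v^2/4) := by linarith [sq_nonneg v]
    have h9 := mul_le_mul_of_nonneg_left h7 (show (0:ℝ) ≤ N/2 by positivity)
    linarith
  have htot : |R * Real.cos φ - Real.exp (-(A/2) * v^2)| ≤ R * (φ^2/2 + A * v^4/4) := by
    have := abs_sub_le (R * Real.cos φ) R (Real.exp (-(A/2) * v^2))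
    linarith
  refine htot.trans ?_
  have hbr : φ^2/2 + A * v^4/4 ≤ D^2/N * ((N*v^2)^2 + 25*(N*v^2) + (N*v^2)^3) := by
    have e : D^2/N * ((N*v^2)^2 + 25*(N*v^2) + (N*v^2)^3) = D^2 * (N * v^4 + 25 * v^2 + N^2 * v^6) := by
      field_simp
    rw [e]
    have hD2 : 1 ≤ D^2 := one_le_pow₀ hD
    have hA2 : A^2 ≤ (2 * N)^2 := by gcongr
    have k1 : A * v^4/4 ≤ N * v^4 := by
      have q1 := mul_le_mul_of_nonneg_right hA (show 0 ≤ v^4 by positivity)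
      have q2 : 0 ≤ (N:ℝ) * v^4 := by positivity
      linarith
    have k2 : A^2 * v^6/9 ≤ N^2 * v^6 := by
      have q1 := mul_le_mul_of_nonneg_right hA2 (show 0 ≤ v^6 by positivity)
      have q2 : 0 ≤ (N:ℝ)^2 * v^6 := by positivity
      linarith
    have k3 : N * v^4 ≤ D^2 * (N * v^4) := le_mul_of_one_le_left (by positivity) hD2
    have k4 : N^2 * v^6 ≤ D^2 * (N^2 * v^6) := le_mul_of_one_le_left (by positivity) hD2
    linarith
  have hpe := poly_exp (y := N * v^2) (by positivity)
  calc R * (φ^2/2 + A * v^4/4) ≤ Real.exp (-(N * v^2)/16) * (D^2/N * ((N*v^2)^2 + 25*(N*v^2) + (N*v^2)^3)) := by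
        apply mul_le_mul hRb hbr (by positivity) (Real.exp_pos _).le
    _ = D^2/N * (((N*v^2)^2 + 25*(N*v^2) + (N*v^2)^3) * Real.exp (-(N * v^2)/16)) := by ring
    _ ≤ D^2/N * (200000 * Real.exp (-(N * v^2)/32)) := by gcongr
    _ = _ := by
      have : -(N * v^2)/32 = -((N:ℝ)/32) * v^2 := by ring
      rw [this]; ring

lemma pointwise_large {s n : ℝ} {N : ℕ} (hN : 8 ≤ N) (h1 : (2:ℝ)^(N-1) ≤ s) {v : ℝ} (hv : 1 < |v|) :
    |Real.exp (-rho s v) * Real.cos (n * v - Th s v) - Real.exp (-((∑' k, ak s k ^ 2)/2) * v^2)| ≤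
      4096 / (N:ℝ)^2 * (1 + ((1/2) * v)^2)⁻¹ := by
  have hs : 0 < s := lt_of_lt_of_le (by positivity) h1
  have hNr : (8:ℝ) ≤ N := by exact_mod_cast hN
  have r1 := rho_le hs v
  have rq := R_le_quarter h1 v
  set A := ∑' k, ak s k ^ 2
  have hG : Real.exp (-(A/2) * v^2) ≤ Real.exp (-rho s v) := Real.exp_le_exp.2 (by linarith)
  have hle : |Real.exp (-rho s v) * Real.cos (n * v - Th s v) - Real.exp (-(A/2) * v^2)| ≤ 2 * Real.exp (-rho s v) := by
    refine (abs_sub _ _).trans ?_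
    rw [abs_mul, abs_of_pos (Real.exp_pos _), abs_of_pos (Real.exp_pos _)]
    have := Real.abs_cos_le_one (n * v - Th s v)
    nlinarith [Real.exp_pos (-rho s v)]
  refine hle.trans ?_
  have hv2 : 1 ≤ v^2 := by rw [← sq_abs]; exact one_le_pow₀ hv.le
  set l := Real.log (1 + v^2/4) with hl
  have hl1 : 1/8 ≤ l := by
    have e1 : Real.log (1 + 1/4) ≤ l := Real.log_le_log (by norm_num) (by linarith)
    have e2 := log_quad (y := 1/4) (by norm_num)
    norm_num at e1 e2; linarith
  have e1 : Real.exp (-(N/2 * l)) = Real.exp (-l) * Real.exp (-((N/2 - 1) * l)) := by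
    rw [← Real.exp_add]; congr 1; ring
  have e2 : Real.exp (-l) = (1 + ((1/2) * v)^2)⁻¹ := by
    rw [Real.exp_neg, hl, Real.exp_log (by positivity)]; congr 1; ring
  have e3 : Real.exp (-((N/2 - 1) * l)) ≤ 2048 / (N:ℝ)^2 := by
    have f1 : Real.exp (-((N/2 - 1) * l)) ≤ Real.exp (-((N:ℝ)/32)) := by
      apply Real.exp_le_exp.2; nlinarith
    have f2 := Real.pow_div_factorial_le_exp ((N:ℝ)/32) (by positivity) 2
    norm_num [Nat.factorial] at f2
    refine f1.trans ?_
    have f3 : (N:ℝ)^2/2048 ≤ Real.exp ((N:ℝ)/32) := by nlinarith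
    rw [Real.exp_neg, inv_le_comm₀ (Real.exp_pos _) (by positivity), inv_div]
    exact f3
  rw [e1, e2] at rq
  have := mul_le_mul_of_nonneg_left e3 (show 0 ≤ (1 + ((1/2) * v)^2)⁻¹ by positivity)
  have e : 4096 / (N:ℝ)^2 * (1 + ((1/2) * v)^2)⁻¹ = 2 * ((1 + ((1/2) * v)^2)⁻¹ * (2048/(N:ℝ)^2)) := by ring
  rw [e]; linarith

lemma J_bound {s n D : ℝ} {N : ℕ} (hN : 8 ≤ N) (h1 : (2:ℝ)^(N-1) ≤ s) (h2 : s < 2^N)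
    (hD : 1 ≤ D) (hn : |n - N| ≤ D) :
    |(∫ v, Real.exp (-rho s v) * Real.cos (n * v - Th s v)) - √(2 * π / ∑' k, ak s k ^ 2)| ≤
      3000000 * D^2 / (N * √N) := by
  have hs : 0 < s := lt_of_lt_of_le (by positivity) h1
  have hNr : (8:ℝ) ≤ N := by exact_mod_cast hN
  have a2 := ak_sum_bound (by omega) h1 h2 (p := 2) (Or.inr rfl)
  have ps := fun v hv => pointwise_small hN h1 h2 hD hn (v := v) hv
  have pl := fun v hv => pointwise_large (n := n) hN h1 (v := v) hv
  set A := ∑' k, ak s k ^ 2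
  have hA : 0 < A := by rw [abs_le] at a2; linarith
  have hg := integral_gaussian (A/2)
  have hgi := integrable_exp_neg_mul_sq (b := A/2) (by positivity)
  have hI : MeasureTheory.Integrable (fun v => Real.exp (-rho s v) * Real.cos (n * v - Th s v)) := by
    have : (fun v => Real.exp (-rho s v) * Real.cos (n * v - Th s v)) =
        fun v : ℝ => (Complex.exp ((n * v : ℝ) * Complex.I) * gI s v).re := by ext v; rw [gI_re]
    rw [this]
    refine (R_integrable hs).mono' ?_ (Eventually.of_forall (fun v => ?_))
    · have := gI_cont hs
      exact Continuous.aestronglyMeasurable (by fun_prop)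
    · refine (Complex.abs_re_le_norm _).trans (le_of_eq ?_)
      rw [norm_mul, Complex.norm_exp_ofReal_mul_I, one_mul, gI_norm]
  have e0 : √(2 * π / A) = ∫ v : ℝ, Real.exp (-(A/2) * v^2) := by
    rw [hg]; congr 1; field_simp
  rw [e0, ← MeasureTheory.integral_sub hI hgi]
  have b1 : MeasureTheory.Integrable (fun v : ℝ => 200000 * D^2 / N * Real.exp (-(N/32) * v^2)) :=
    (integrable_exp_neg_mul_sq (by positivity)).const_mul _
  have b2 : MeasureTheory.Integrable (fun v : ℝ => 4096 / (N:ℝ)^2 * (1 + ((1/2) * v)^2)⁻¹) :=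
    (integrable_inv_one_add_sq.comp_mul_left' (by norm_num : (1/2:ℝ) ≠ 0)).const_mul _
  have hb := MeasureTheory.norm_integral_le_of_norm_le (b1.add b2)
    (f := fun v => Real.exp (-rho s v) * Real.cos (n * v - Th s v) - Real.exp (-(A/2) * v^2))
    (Eventually.of_forall (fun v => ?_))
  · rw [Real.norm_eq_abs] at hb
    refine hb.trans ?_
    simp only [Pi.add_apply]
    rw [MeasureTheory.integral_add b1 b2, MeasureTheory.integral_const_mul, MeasureTheory.integral_const_mul,
      integral_gaussian, MeasureTheory.Measure.integral_comp_mul_left (fun v : ℝ => (1 + v^2)⁻¹), integral_univ_inv_one_add_sq]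
    have hsN : 0 < √(N:ℝ) := Real.sqrt_pos.2 (by linarith)
    have c1 : √(π / (N/32)) ≤ 11 / √N := by
      rw [Real.sqrt_le_left (by positivity), div_pow, Real.sq_sqrt (by positivity)]
      rw [div_le_div_iff₀ (by positivity) (by positivity)]
      nlinarith [Real.pi_lt_d2]
    have c2 : |(1/2:ℝ)⁻¹| • π ≤ 7 := by
      norm_num; linarith [Real.pi_lt_d2]
    have c3 : 4096 / (N:ℝ)^2 ≤ 4096 * D^2 / (N * √N) := by
      have : √(N:ℝ) ≤ N := by
        rw [Real.sqrt_le_left (by positivity)]; nlinarith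
      have hD2 : 1 ≤ D^2 := one_le_pow₀ hD
      rw [pow_two]
      apply div_le_div₀ (by positivity) (by linarith) (by positivity)
      gcongr
    calc _ ≤ 200000 * D^2 / N * (11 / √N) + 4096 * D^2 / (N * √N) * 7 := by
          apply add_le_add
          · gcongr
          · apply mul_le_mul c3 c2 (by positivity) (by positivity)
      _ = (2200000 + 28672) * (D^2 / (N * √N)) := by field_simp; norm_num
      _ ≤ _ := by
        rw [mul_div_assoc]
        gcongr; norm_num
  · rw [Real.norm_eq_abs]
    simp only [Pi.add_apply]
    rcases le_or_gt |v| 1 with hv | hv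
    · refine (ps v hv).trans ?_
      have : 0 ≤ 4096 / (N:ℝ)^2 * (1 + ((1/2) * v)^2)⁻¹ := by positivity
      linarith
    · refine (pl v hv).trans ?_
      have : 0 ≤ 200000 * D^2 / N * Real.exp (-(N/32) * v^2) := by positivity
      linarith

lemma abs_sqrt_sub_one {r : ℝ} (hr : 0 ≤ r) : |√r - 1| ≤ |r - 1| := by
  have h : r - 1 = (√r - 1) * (√r + 1) := by nlinarith [Real.mul_self_sqrt hr]
  have h2 := Real.sqrt_nonneg r
  rw [h, abs_mul, abs_of_pos (by linarith : 0 < √r + 1)]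
  exact le_mul_of_one_le_right (abs_nonneg _) (by linarith)

lemma J_rel {s n D : ℝ} {N : ℕ} (hN : 8 ≤ N) (h1 : (2:ℝ)^(N-1) ≤ s) (h2 : s < 2^N)
    (hD : 1 ≤ D) (hn : |n - N| ≤ D) (hDN : D ≤ N/2) :
    |√(n/(2*π)) * (∫ v, Real.exp (-rho s v) * Real.cos (n * v - Th s v)) - 1| ≤
      4000000 * D^2 / N := by
  have hNr : (8:ℝ) ≤ N := by exact_mod_cast hN
  have a2 := ak_sum_bound (by omega) h1 h2 (p := 2) (Or.inr rfl)
  have jb := J_bound hN h1 h2 hD hn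
  set A := ∑' k, ak s k ^ 2
  set J := ∫ v, Real.exp (-rho s v) * Real.cos (n * v - Th s v)
  have hA : N/2 ≤ A := by rw [abs_le] at a2; linarith
  have hA0 : 0 < A := by linarith
  rw [abs_le] at hn
  have hn0 : 0 ≤ n := by linarith
  have hsN : 0 < √(N:ℝ) := Real.sqrt_pos.2 (by linarith)
  have e : √(n/(2*π)) * √(2 * π / A) = √(n/A) := by
    rw [← Real.sqrt_mul (by positivity)]; congr 1; field_simp
  have t1 : |√(n/(2*π)) * J - √(n/A)| ≤ 3000000 * D^2/N := by
    rw [← e, ← mul_sub, abs_mul, abs_of_nonneg (Real.sqrt_nonneg _)]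
    have : √(n/(2*π)) ≤ √N := by
      apply Real.sqrt_le_sqrt
      rw [div_le_iff₀ (by positivity)]
      nlinarith [Real.pi_gt_three]
    calc _ ≤ √N * (3000000 * D^2 / (N * √N)) := by gcongr
      _ = _ := by field_simp
  have t2 : |√(n/A) - 1| ≤ 10 * D^2/N := by
    refine (abs_sqrt_sub_one (by positivity)).trans ?_
    have : n/A - 1 = (n - A)/A := by field_simp
    rw [this, abs_div, abs_of_pos hA0]
    have h5 : |n - A| ≤ 5 * D := by
      rw [abs_le] at a2 ⊢; constructor <;> linarith
    calc |n - A|/A ≤ 5 * D / (N/2) := by gcongr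
      _ = 10 * D / N := by field_simp; norm_num
      _ ≤ 10 * D^2/N := by gcongr; nlinarith
  have t3 := abs_sub_le (√(n/(2*π)) * J) (√(n/A)) 1
  have t4 : 3000000 * D^2/N + 10 * D^2/N ≤ 4000000 * D^2/N := by
    rw [← add_div]; gcongr; nlinarith
  linarith

lemma expabs_aux {a : ℝ} (ha : 0 < a) (c : ℝ) :
    MeasureTheory.Integrable (fun t : ℝ => Complex.exp ((-(a * |t|) : ℝ) - c * t * Complex.I)) ∧
    ∫ t : ℝ, Complex.exp ((-(a * |t|) : ℝ) - c * t * Complex.I) = ((2 * a / (a^2 + c^2) : ℝ) : ℂ) := by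
  set g : ℝ → ℂ := fun t : ℝ => Complex.exp ((-(a * |t|) : ℝ) - c * t * Complex.I) with hg
  set z1 : ℂ := -a - c * Complex.I with hz1
  set z2 : ℂ := a - c * Complex.I with hz2
  have hr1 : z1.re < 0 := by simp [hz1, ha]
  have hr2 : 0 < z2.re := by simp [hz2, ha]
  have e1 : Set.EqOn g (fun t : ℝ => Complex.exp (z1 * t)) (Set.Ioi 0) := by
    intro t ht
    simp only [hg, hz1]
    rw [abs_of_pos ht]; push_cast; congr 1; ring
  have e2 : Set.EqOn g (fun t : ℝ => Complex.exp (z2 * t)) (Set.Iic 0) := by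
    intro t ht
    simp only [hg, hz2]
    rw [abs_of_nonpos ht]; push_cast; congr 1; ring
  have i1 : MeasureTheory.IntegrableOn g (Set.Ioi 0) :=
    (integrableOn_exp_mul_complex_Ioi hr1 0).congr_fun e1.symm measurableSet_Ioi
  have i2 : MeasureTheory.IntegrableOn g (Set.Iic 0) :=
    (integrableOn_exp_mul_complex_Iic hr2 0).congr_fun e2.symm measurableSet_Iic
  have hi : MeasureTheory.Integrable g := by
    have := i2.union i1
    rwa [Set.Iic_union_Ioi, MeasureTheory.integrableOn_univ] at this
  refine ⟨hi, ?_⟩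
  rw [← MeasureTheory.setIntegral_univ, ← Set.Iic_union_Ioi (a := (0:ℝ)),
    MeasureTheory.setIntegral_union (by rw [Set.disjoint_iff]; intro t ⟨h1, h2⟩; exact not_lt.2 (Set.mem_Iic.1 h1) (Set.mem_Ioi.1 h2)) measurableSet_Ioi i2 i1,
    MeasureTheory.setIntegral_congr_fun measurableSet_Iic e2, MeasureTheory.setIntegral_congr_fun measurableSet_Ioi e1,
    integral_exp_mul_complex_Iic hr2, integral_exp_mul_complex_Ioi hr1]
  simp only [Complex.ofReal_zero, mul_zero, Complex.exp_zero]
  have h1 : z1 ≠ 0 := by intro h; rw [h] at hr1; simp at hr1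
  have h2 : z2 ≠ 0 := by intro h; rw [h] at hr2; simp at hr2
  have hq : ((a:ℂ)^2 + c^2) ≠ 0 := by
    have : (a^2 + c^2) ≠ 0 := by positivity
    exact_mod_cast this
  have hp : z1 * z2 = -((a:ℂ)^2 + c^2) := by
    rw [hz1, hz2]; linear_combination (c:ℂ)^2 * Complex.I_sq
  rw [div_add_div _ _ h2 h1, mul_comm z2 z1, hp, hz1, hz2]
  push_cast
  field_simp
  ring

lemma expabs_real {a : ℝ} (ha : 0 < a) :
    MeasureTheory.Integrable (fun t : ℝ => Real.exp (-(a * |t|))) ∧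
    ∫ t : ℝ, Real.exp (-(a * |t|)) = 2 / a := by
  obtain ⟨h1, h2⟩ := expabs_aux ha 0
  have e : ∀ t : ℝ, Complex.exp ((-(a * |t|) : ℝ) - (0:ℝ) * t * Complex.I) = ((Real.exp (-(a * |t|)) : ℝ) : ℂ) := by
    intro t; simp
  simp only [e] at h1 h2
  rw [integral_complex_ofReal] at h2
  constructor
  · exact_mod_cast h1.re
  · have := Complex.ofReal_injective h2
    rw [this]; field_simp; ring

noncomputable def fL (t : ℝ) : ℝ := Real.log (1 + Real.exp (-(Real.log 2 * |t|)))

lemma fL_series {t : ℝ} (ht : t ≠ 0) :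
    HasSum (fun m : ℕ => (-1:ℝ)^m / ((m:ℝ)+1) * Real.exp (-(((m:ℝ)+1) * Real.log 2 * |t|))) (fL t) := by
  have hL := Real.log_pos (by norm_num : (1:ℝ) < 2)
  set y := Real.exp (-(Real.log 2 * |t|)) with hy
  have hy1 : y < 1 := by
    rw [hy, Real.exp_lt_one_iff]
    have := abs_pos.2 ht
    nlinarith [mul_pos hL this]
  have hy0 : 0 < y := Real.exp_pos _
  have h := Real.hasSum_pow_div_log_of_abs_lt_one (x := -y) (by rw [abs_neg, abs_of_pos hy0]; exact hy1)
  have h2 := h.neg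
  rw [neg_neg, sub_neg_eq_add] at h2
  rw [fL]
  refine h2.congr_fun ?_ |> id
  intro m
  have : Real.exp (-(((m:ℝ)+1) * Real.log 2 * |t|)) = y^(m+1) := by
    rw [hy, ← Real.exp_nat_mul]; congr 1; push_cast; ring
  rw [this, neg_pow y, pow_succ (-1:ℝ)]
  ring

lemma fL_fourier_sum (w : ℝ) :
    FourierTransform.fourier (fun t : ℝ => (fL t : ℂ)) w =
    ((2 / Real.log 2 * ∑' m : ℕ, (-1:ℝ)^m * (1 / (((m:ℝ)+1)^2 + (2*π*w/Real.log 2)^2)) : ℝ) : ℂ) := by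
  have hL := Real.log_pos (by norm_num : (1:ℝ) < 2)
  set L := Real.log 2 with hLd
  set G : ℕ → ℝ → ℂ := fun m t => ((-1:ℂ)^m / ((m:ℂ)+1)) *
    Complex.exp ((-((((m:ℝ)+1)*L) * |t|) : ℝ) - (2*π*w : ℝ) * t * Complex.I) with hG
  have ha : ∀ m : ℕ, 0 < ((m:ℝ)+1)*L := fun m => by positivity
  have hGi : ∀ m, MeasureTheory.Integrable (G m) := fun m =>
    (expabs_aux (ha m) (2*π*w)).1.const_mul _
  have hGv : ∀ m, ∫ t, G m t = ((2 / L * ((-1:ℝ)^m * (1 / (((m:ℝ)+1)^2 + (2*π*w/L)^2))) : ℝ) : ℂ) := by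
    intro m
    rw [hG]
    simp only
    rw [MeasureTheory.integral_const_mul, (expabs_aux (ha m) (2*π*w)).2]
    have e : (((m:ℝ)+1)*L)^2 + (2*π*w)^2 = L^2 * (((m:ℝ)+1)^2 + (2*π*w/L)^2) := by
      field_simp
    have hq : (((m:ℝ)+1)^2 + (2*π*w/L)^2) ≠ 0 := by positivity
    have hm : ((m:ℝ)+1) ≠ 0 := by positivity
    rw [show ((-1:ℂ)^m / ((m:ℂ)+1)) = (((-1:ℝ)^m / ((m:ℝ)+1) : ℝ) : ℂ) by push_cast; rfl, ← Complex.ofReal_mul, e]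
    congr 1
    generalize (((m:ℝ)+1)^2 + (2*π*w/L)^2) = q at hq
    field_simp
  have hGn : ∀ m t, ‖G m t‖ = 1 / ((m:ℝ)+1) * Real.exp (-((((m:ℝ)+1)*L) * |t|)) := by
    intro m t
    rw [hG]
    simp only
    rw [norm_mul, norm_div, norm_pow, norm_neg, norm_one, one_pow, Complex.norm_exp]
    congr 1
    · congr 1
      have : ((m:ℂ)+1) = (((m:ℝ)+1 : ℝ) : ℂ) := by push_cast; rfl
      rw [this, Complex.norm_real, Real.norm_eq_abs, abs_of_nonneg (by positivity)]
    · congr 1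
      simp
  have hsum : Summable (fun m => ∫ t, ‖G m t‖) := by
    have : ∀ m : ℕ, ∫ t, ‖G m t‖ = 2 / L * (1 / (((m:ℝ)+1)^2 + (0:ℝ)^2)) := by
      intro m
      simp only [hGn]
      rw [MeasureTheory.integral_const_mul, (expabs_real (ha m)).2]
      have hm : ((m:ℝ)+1) ≠ 0 := by positivity
      rw [zero_pow two_ne_zero, add_zero]
      field_simp
    simp only [this]
    exact (Ssum_summable 0).mul_left _
  have key := MeasureTheory.hasSum_integral_of_summable_integral_norm hGi hsum
  have e1 : FourierTransform.fourier (fun t : ℝ => (fL t : ℂ)) w = ∫ t, ∑' m, G m t := by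
    rw [Real.fourier_eq']
    apply MeasureTheory.integral_congr_ae
    have h0 : ∀ᵐ t : ℝ, t ≠ 0 := by
      simp [MeasureTheory.ae_iff]
    filter_upwards [h0] with t ht
    have h := fL_series ht
    have h' := (Complex.hasSum_ofReal.2 h).mul_left (Complex.exp (-((2*π*w : ℝ) * t * Complex.I)))
    have h'' : HasSum (fun m => G m t) (Complex.exp (-((2*π*w : ℝ) * t * Complex.I)) * (fL t : ℂ)) := by
      refine h'.congr_fun ?_ |> id
      intro m
      rw [hG]
      simp only
      rw [sub_eq_add_neg, Complex.exp_add]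
      push_cast
      ring
    rw [h''.tsum_eq, smul_eq_mul]
    congr 2
    simp
    ring
  rw [e1, ← key.tsum_eq]
  simp only [hGv]
  rw [← Complex.ofReal_tsum, tsum_mul_left]

noncomputable def phi (w : ℝ) : ℝ :=
  2 / Real.log 2 * ∑' m : ℕ, (-1:ℝ)^m * (1 / (((m:ℝ)+1)^2 + (2*π*w/Real.log 2)^2))

lemma log_two_pos' : 0 < Real.log 2 := Real.log_pos (by norm_num)

lemma phi_neg (w : ℝ) : phi (-w) = phi w := by
  unfold phi
  have : (2*π*(-w)/Real.log 2)^2 = (2*π*w/Real.log 2)^2 := by ring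
  rw [this]

lemma phi_zero : phi 0 = π^2/(6*Real.log 2) := by
  unfold phi
  have hL := log_two_pos'
  rw [show 2*π*0/Real.log 2 = (0:ℝ) by simp, alt_sum_zero]
  field_simp; norm_num

lemma phi_pos_eq {w : ℝ} (hw : 0 < w) :
    phi w = Real.log 2/(4*π^2*w^2) - 1/(2*w*Real.sinh (2*w*π^2/Real.log 2)) := by
  unfold phi
  have hL := log_two_pos'
  have hpi := Real.pi_pos
  rw [alt_sum_ne (by positivity)]
  have e : π * (2*π*w/Real.log 2) = 2*w*π^2/Real.log 2 := by ring
  rw [e]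
  have hs : 0 < Real.sinh (2*w*π^2/Real.log 2) := Real.sinh_pos_iff.2 (by positivity)
  generalize Real.sinh (2*w*π^2/Real.log 2) = S at *
  field_simp
  ring

lemma phi_bound_pos {w : ℝ} (hw : 0 < w) : |phi w| ≤ Real.log 2/(4*π^2) * (1/w^2) := by
  have hL := log_two_pos'
  have hpi := Real.pi_pos
  rw [phi_pos_eq hw]
  have hy : 0 ≤ 2*w*π^2/Real.log 2 := by positivity
  have h1 := Real.self_le_sinh_iff.2 hy
  have h2 : 1/(2*w*Real.sinh (2*w*π^2/Real.log 2)) ≤ 1/(2*w*(2*w*π^2/Real.log 2)) := by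
    apply one_div_le_one_div_of_le (by positivity)
    gcongr
  have h3 : 1/(2*w*(2*w*π^2/Real.log 2)) = Real.log 2/(4*π^2*w^2) := by field_simp; ring
  have h4 : 0 ≤ 1/(2*w*Real.sinh (2*w*π^2/Real.log 2)) := by
    have : 0 ≤ Real.sinh (2*w*π^2/Real.log 2) := le_trans hy h1
    positivity
  have h5 : Real.log 2/(4*π^2) * (1/w^2) = Real.log 2/(4*π^2*w^2) := by field_simp
  rw [h5, abs_of_nonneg (by linarith)]
  linarith

lemma phi_bound {w : ℝ} (hw : w ≠ 0) : |phi w| ≤ Real.log 2/(4*π^2) * (1/w^2) := by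
  rcases lt_or_gt_of_ne hw with h | h
  · have := phi_bound_pos (neg_pos.2 h)
    rwa [phi_neg, neg_sq] at this
  · exact phi_bound_pos h

lemma rpow_neg_two (x : ℝ) : |x| ^ (-(2:ℝ)) = 1 / x^2 := by
  rw [Real.rpow_neg (abs_nonneg x), Real.rpow_two, sq_abs, one_div]

lemma eventually_cocompact_ne : ∀ᶠ x : ℝ in cocompact ℝ, x ≠ 0 := by
  have := (isCompact_singleton (x := (0:ℝ))).compl_mem_cocompact
  filter_upwards [this] with x hx
  simpa using hx

lemma fL_bigO : (fun t : ℝ => (fL t : ℂ)) =O[cocompact ℝ] fun x => |x| ^ (-(2:ℝ)) := by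
  have hL := log_two_pos'
  apply Asymptotics.IsBigO.of_bound (2 / (Real.log 2)^2)
  filter_upwards [eventually_cocompact_ne] with x hx
  rw [rpow_neg_two, Complex.norm_real]
  set y := Real.log 2 * |x| with hy
  have hy0 : 0 < y := mul_pos hL (abs_pos.2 hx)
  have h1 : fL x ≤ Real.exp (-y) := by
    have := Real.log_le_sub_one_of_pos (show 0 < 1 + Real.exp (-y) by positivity)
    unfold fL; linarith
  have h0 : 0 ≤ fL x := Real.log_nonneg (by linarith [Real.exp_pos (-y)])
  have h2 : Real.exp (-y) ≤ 2 / y^2 := by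
    rw [Real.exp_neg, ← one_div, div_le_div_iff₀ (Real.exp_pos _) (by positivity)]
    nlinarith [Real.quadratic_le_exp_of_nonneg hy0.le]
  have h3 : 2 / y^2 = 2 / (Real.log 2)^2 * (1/x^2) := by
    rw [hy, mul_pow, sq_abs]; field_simp
  rw [Real.norm_eq_abs, Real.norm_eq_abs, abs_of_nonneg h0, abs_of_nonneg (by positivity), ← h3]
  linarith

lemma fL_fourier_bigO : FourierTransform.fourier (fun t : ℝ => (fL t : ℂ)) =O[cocompact ℝ] fun x => |x| ^ (-(2:ℝ)) := by
  apply Asymptotics.IsBigO.of_bound (Real.log 2/(4*π^2))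
  filter_upwards [eventually_cocompact_ne] with x hx
  rw [fL_fourier_sum, Complex.norm_real, Real.norm_eq_abs, rpow_neg_two, Real.norm_eq_abs (1/x^2), abs_of_nonneg (a := 1/x^2) (by positivity)]
  exact phi_bound hx

lemma fL_cont : Continuous (fun t : ℝ => (fL t : ℂ)) := by
  apply Complex.continuous_ofReal.comp
  unfold fL
  apply Continuous.log
  · fun_prop
  · intro x; positivity

lemma fL_poisson (t : ℝ) : ∑' n : ℤ, (fL (t + n) : ℂ) =
    ∑' n : ℤ, (phi n : ℂ) * Complex.exp (2 * π * Complex.I * n * t) := by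
  have h := Real.tsum_eq_tsum_fourier_of_rpow_decay fL_cont (by norm_num : (1:ℝ) < 2) fL_bigO fL_fourier_bigO t
  rw [h]
  apply tsum_congr
  intro n
  rw [fL_fourier_sum, fourier_coe_apply]
  simp [phi]

lemma phi_summable : Summable (fun j : ℕ => |phi ((j:ℝ)+1)|) := by
  have h := (Ssum_summable 0).mul_left (Real.log 2/(4*π^2))
  refine Summable.of_nonneg_of_le (fun j => abs_nonneg _) (fun j => ?_) h
  have := phi_bound_pos (w := (j:ℝ)+1) (by positivity)
  simpa using this

lemma phi_cos_summable (t : ℝ) : Summable (fun j : ℕ => phi ((j:ℝ)+1) * Real.cos (2*((j:ℝ)+1)*π*t)) := by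
  refine Summable.of_norm_bounded phi_summable (fun j => ?_)
  rw [Real.norm_eq_abs, abs_mul]
  exact mul_le_of_le_one_right (abs_nonneg _) (Real.abs_cos_le_one _)

lemma phi_int_sum (t : ℝ) : ∑' n : ℤ, (phi n : ℂ) * Complex.exp (2 * π * Complex.I * n * t) =
    ((phi 0 + 2 * ∑' j : ℕ, phi ((j:ℝ)+1) * Real.cos (2*((j:ℝ)+1)*π*t) : ℝ) : ℂ) := by
  have hb : Summable (fun j : ℕ => ‖(phi ((j:ℝ)+1) : ℂ)‖) := by
    simpa [Complex.norm_real] using phi_summable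
  set θ : ℕ → ℝ := fun j => 2*((j:ℝ)+1)*π*t with hθ
  have h1 : Summable (fun j : ℕ => (phi ((j:ℝ)+1) : ℂ) * Complex.exp (θ j * Complex.I)) := by
    refine Summable.of_norm_bounded hb (fun j => ?_)
    rw [norm_mul, Complex.norm_exp_ofReal_mul_I, mul_one]
  have h2 : Summable (fun j : ℕ => (phi ((j:ℝ)+1) : ℂ) * Complex.exp (-θ j * Complex.I)) := by
    refine Summable.of_norm_bounded hb (fun j => ?_)
    rw [norm_mul, ← Complex.ofReal_neg, Complex.norm_exp_ofReal_mul_I, mul_one]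
  have e1 : ∀ j : ℕ, (phi ((j:ℤ)+1 : ℤ) : ℂ) * Complex.exp (2 * π * Complex.I * ((j:ℤ)+1 : ℤ) * t) =
      (phi ((j:ℝ)+1) : ℂ) * Complex.exp (θ j * Complex.I) := by
    intro j
    rw [hθ]; push_cast; congr 2; ring
  have e2 : ∀ j : ℕ, (phi (-((j:ℤ)+1) : ℤ) : ℂ) * Complex.exp (2 * π * Complex.I * (-((j:ℤ)+1) : ℤ) * t) =
      (phi ((j:ℝ)+1) : ℂ) * Complex.exp (-θ j * Complex.I) := by
    intro j
    have hh : phi (((-((j:ℤ)+1) : ℤ)) : ℝ) = phi ((j:ℝ)+1) := by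
      rw [← phi_neg ((j:ℝ)+1)]; congr 1; push_cast; ring
    rw [hh]
    congr 2
    simp only [hθ]
    push_cast
    ring
  have key := HasSum.of_add_one_of_neg_add_one (f := fun n : ℤ => (phi n : ℂ) * Complex.exp (2 * π * Complex.I * n * t))
    (h1.hasSum.congr_fun e1) (h2.hasSum.congr_fun e2)
  rw [key.tsum_eq]
  have e3 : ∑' j : ℕ, (phi ((j:ℝ)+1) : ℂ) * Complex.exp (θ j * Complex.I) +
      ∑' j : ℕ, (phi ((j:ℝ)+1) : ℂ) * Complex.exp (-θ j * Complex.I) =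
      ((2 * ∑' j : ℕ, phi ((j:ℝ)+1) * Real.cos (2*((j:ℝ)+1)*π*t) : ℝ) : ℂ) := by
    rw [← h1.tsum_add h2, ← tsum_mul_left, Complex.ofReal_tsum]
    apply tsum_congr
    intro j
    rw [← mul_add, ← Complex.two_cos, ← Complex.ofReal_cos]
    simp only [hθ]
    push_cast
    ring
  push_cast at e3 ⊢
  rw [← e3]
  simp
  ring

lemma B2_eval (x : ℝ) : Polynomial.eval x (Polynomial.map (algebraMap ℚ ℝ) (Polynomial.bernoulli (2*1))) = x^2 - x + 1/6 := by
  have h2 : bernoulli 2 = 1/6 := by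
    rw [bernoulli_eq_bernoulli'_of_ne_one (by norm_num)]; norm_num
  simp [Polynomial.bernoulli, Finset.sum_range_succ, bernoulli_zero, bernoulli_one, h2]
  ring

lemma cos_sq_sum {t : ℝ} (ht : t ∈ Set.Icc (0:ℝ) 1) :
    HasSum (fun j : ℕ => 1/((j:ℝ)+1)^2 * Real.cos (2*((j:ℝ)+1)*π*t)) (π^2 * (t^2 - t + 1/6)) := by
  have h := hasSum_one_div_nat_pow_mul_cos one_ne_zero ht
  rw [B2_eval] at h
  have h2 := (hasSum_nat_add_iff' 1).2 h
  have e : (-1:ℝ) ^ (1 + 1) * (2 * π) ^ (2 * 1) / 2 / ((2 * 1).factorial : ℝ) * (t^2 - t + 1/6) = π^2 * (t^2 - t + 1/6) := by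
    have hf : ((2 * 1).factorial : ℝ) = 2 := by norm_num [Nat.factorial]
    rw [hf]; ring
  rw [e] at h2
  simp only [Finset.range_one, Finset.sum_singleton, Nat.cast_zero, mul_one, zero_pow two_ne_zero, div_zero, zero_mul, sub_zero] at h2
  refine h2.congr_fun ?_
  intro j
  push_cast
  congr 2
  ring

lemma theta_right {t : ℝ} (ht : t ∈ Set.Icc (0:ℝ) 1) :
    phi 0 + 2 * ∑' j : ℕ, phi ((j:ℝ)+1) * Real.cos (2*((j:ℝ)+1)*π*t) =
    P t + Real.log 2 * (t^2 - t)/2 := by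
  have hc := cos_sq_sum ht
  have hL := log_two_pos'
  have hpi := Real.pi_pos
  have e : ∀ j : ℕ, Real.cos (2 * ((j:ℝ)+1) * π * t) / (((j:ℝ)+1) * Real.sinh (2 * ((j:ℝ)+1) * π^2 / Real.log 2)) =
      Real.log 2/(2*π^2) * (1/((j:ℝ)+1)^2 * Real.cos (2*((j:ℝ)+1)*π*t)) - 2 * (phi ((j:ℝ)+1) * Real.cos (2*((j:ℝ)+1)*π*t)) := by
    intro j
    have hj : (0:ℝ) < (j:ℝ)+1 := by positivity
    rw [phi_pos_eq hj]
    have hs : 0 < Real.sinh (2*((j:ℝ)+1)*π^2/Real.log 2) := Real.sinh_pos_iff.2 (by positivity)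
    generalize Real.sinh (2*((j:ℝ)+1)*π^2/Real.log 2) = S at *
    generalize Real.cos (2 * ((j:ℝ)+1) * π * t) = c
    generalize (j:ℝ)+1 = q at *
    field_simp
    ring
  have hP : P t = Real.log 2 / 12 + π^2 / (6 * Real.log 2) - (Real.log 2/(2*π^2) * (π^2 * (t^2 - t + 1/6))
      - 2 * ∑' j : ℕ, phi ((j:ℝ)+1) * Real.cos (2*((j:ℝ)+1)*π*t)) := by
    unfold P
    congr 1
    rw [tsum_congr e]
    exact ((hc.mul_left _).sub ((phi_cos_summable t).hasSum.mul_left 2)).tsum_eq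
  rw [hP, phi_zero]
  generalize (∑' j : ℕ, phi ((j:ℝ)+1) * Real.cos (2*((j:ℝ)+1)*π*t)) = T
  field_simp
  ring

lemma LS_double {s : ℝ} (hs : 0 < s) : LS (2*s) = LS s + Real.log (1 + 2*s) := by
  have h := (LS_summable (s := 2*s) (by positivity)).tsum_eq_zero_add
  unfold LS
  rw [h, add_comm]
  congr 1
  · apply tsum_congr
    intro k
    congr 2
    rw [pow_succ]
    field_simp
  · simp

lemma LS_nonneg {s : ℝ} (hs : 0 < s) : 0 ≤ LS s :=
  tsum_nonneg (fun k => Real.log_nonneg (by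
    have : 0 < s / 2^k := by positivity
    linarith))

lemma LS_le {s : ℝ} (hs : 0 < s) : LS s ≤ 2 * s := by
  have h1 : LS s ≤ ∑' k : ℕ, s / 2^k :=
    (LS_summable hs).tsum_le_tsum (fun k => log_one_add_le (by positivity)) (sdiv_summable s)
  have h2 : ∑' k : ℕ, s / 2^k = 2 * s := by
    have := tsum_geometric_two' (2*s)
    rw [← this]
    apply tsum_congr; intro k
    ring
  linarith

lemma LS_theta01 {t : ℝ} (ht : t ∈ Set.Icc (0:ℝ) 1) :
    LS (Real.exp (Real.log 2 * t)) + LS (Real.exp (-(Real.log 2 * t))) - Real.log (1 + Real.exp (Real.log 2 * t))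
      = P t + Real.log 2 * (t^2 - t)/2 := by
  have h := fL_poisson t
  rw [phi_int_sum, theta_right ht, ← Complex.ofReal_tsum] at h
  have h := Complex.ofReal_injective h
  rw [← h]
  have hpow : ∀ k : ℕ, Real.exp (-(Real.log 2 * k)) = 1 / 2^k := by
    intro k
    rw [Real.exp_neg, mul_comm, Real.exp_nat_mul, Real.exp_log (by norm_num), one_div]
  have h1 : ∀ k : ℕ, fL (t + ((k:ℤ):ℝ)) = Real.log (1 + Real.exp (-(Real.log 2 * t)) / 2^k) := by
    intro k
    unfold fL
    rw [abs_of_nonneg (by have := ht.1; push_cast; positivity)]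
    congr 2
    rw [div_eq_mul_one_div, ← hpow, ← Real.exp_add]
    congr 1; push_cast; ring
  have h2 : ∀ k : ℕ, fL (t + ((-((k:ℤ)+1) : ℤ):ℝ)) = Real.log (1 + Real.exp (Real.log 2 * t) / 2^(k+1)) := by
    intro k
    unfold fL
    rw [abs_of_nonpos (by have := ht.2; push_cast; have : (0:ℝ) ≤ k := by positivity
                          linarith)]
    congr 2
    rw [div_eq_mul_one_div, ← hpow, ← Real.exp_add]
    congr 1; push_cast; ring
  have s1 := LS_summable (Real.exp_pos (-(Real.log 2 * t)))
  have s2 := LS_summable (Real.exp_pos (Real.log 2 * t))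
  have s3 := (summable_nat_add_iff 1).2 s2
  have key := HasSum.of_nat_of_neg_add_one (f := fun n : ℤ => fL (t + n)) (s1.hasSum.congr_fun h1) (s3.hasSum.congr_fun h2)
  rw [key.tsum_eq]
  have h4 := s2.tsum_eq_zero_add
  unfold LS
  rw [h4]
  simp
  ring

lemma P_add_one (t : ℝ) : P (t+1) = P t := by
  unfold P
  congr 1
  apply tsum_congr
  intro j
  have : 2 * ((j:ℝ)+1) * π * (t+1) = 2 * ((j:ℝ)+1) * π * t + ((j+1:ℕ):ℝ) * (2*π) := by push_cast; ring
  rw [this, Real.cos_add_nat_mul_two_pi]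

lemma log_swap {y : ℝ} (hy : 0 < y) : Real.log (1 + y) = Real.log (1 + y⁻¹) + Real.log y := by
  rw [← Real.log_mul (by positivity) (by positivity)]
  congr 1; field_simp; ring

lemma W_eq (n : ℕ) : ∀ t ∈ Set.Icc (0:ℝ) 1,
    LS (Real.exp (Real.log 2 * (t+n))) + LS (Real.exp (-(Real.log 2 * (t+n)))) - Real.log (1 + Real.exp (-(Real.log 2 * (t+n))))
      = P (t+n) + Real.log 2 * (t+n)^2/2 + Real.log 2 * (t+n)/2 := by
  induction n with
  | zero =>
    intro t ht
    have h := LS_theta01 ht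
    have h2 := log_swap (Real.exp_pos (Real.log 2 * t))
    rw [← Real.exp_neg, Real.log_exp] at h2
    simp only [Nat.cast_zero, add_zero]
    linarith
  | succ n ih =>
    intro t ht
    have h := ih t ht
    set u := t + n with hu
    have e : t + ((n+1:ℕ):ℝ) = u + 1 := by rw [hu]; push_cast; ring
    rw [e, P_add_one]
    have hl2 : Real.exp (Real.log 2) = 2 := Real.exp_log (by norm_num)
    have e1 : Real.exp (Real.log 2 * (u+1)) = 2 * Real.exp (Real.log 2 * u) := by
      rw [mul_add, mul_one, Real.exp_add, hl2]; ring
    have e2 : Real.exp (-(Real.log 2 * u)) = 2 * Real.exp (-(Real.log 2 * (u+1))) := by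
      rw [Real.exp_neg, Real.exp_neg, e1]; field_simp
    have d1 := LS_double (Real.exp_pos (Real.log 2 * u))
    have d2 := LS_double (Real.exp_pos (-(Real.log 2 * (u+1))))
    rw [← e1] at d1
    rw [← e2] at d2
    have h2 := log_swap (Real.exp_pos (Real.log 2 * (u+1)))
    rw [← Real.exp_neg, Real.log_exp] at h2
    linarith

lemma LS_asymp {s : ℝ} (hs : 1 ≤ s) : ∃ ε : ℝ, 0 ≤ ε ∧ ε ≤ 1/s ∧
    LS s = (Real.log s)^2/(2*Real.log 2) + Real.log s/2 + P (Real.logb 2 s) - ε := by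
  have hL := log_two_pos'
  have hs0 : 0 < s := by linarith
  set u := Real.logb 2 s with hu
  have hu0 : 0 ≤ u := Real.logb_nonneg (by norm_num) hs
  have hlu : Real.log 2 * u = Real.log s := by rw [hu, Real.logb]; field_simp
  have h := W_eq ⌊u⌋₊ (u - ⌊u⌋₊) ⟨by linarith [Nat.floor_le hu0], by linarith [Nat.lt_floor_add_one u]⟩
  rw [sub_add_cancel, Real.exp_neg, hlu, Real.exp_log hs0] at h
  have hy : 0 < s⁻¹/2 := by positivity
  have d := LS_double hy
  rw [show 2 * (s⁻¹/2) = s⁻¹ by ring] at d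
  refine ⟨LS (s⁻¹/2), LS_nonneg hy, ?_, ?_⟩
  · have := LS_le hy
    rw [one_div]; linarith
  · have e : Real.log 2 * u^2/2 = (Real.log s)^2/(2*Real.log 2) := by
      rw [← hlu]; field_simp
    have e2 : Real.log 2 * u/2 = Real.log s/2 := by rw [hlu]
    linarith

set_option maxHeartbeats 1000000
/-- Small-`x` asymptotics of `F`: with `X = 1/(x log 2)`,
`F(x) = √(log 2/(2π)) X^{1/2+1/log 2} exp(−(log(X log X))²/(2 log 2) − P(log₂(X log X)))
  (1 + O((log log X)²/log X))`. -/
theorem F_small_x_asymptotics :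
    ∃ C > (0:ℝ), ∃ x₀ : ℝ, 0 < x₀ ∧ x₀ < 1 ∧
      ∀ x : ℝ, 0 < x → x ≤ x₀ →
        ∀ X : ℝ, X = 1 / (x * Real.log 2) →
          ∃ E : ℝ,
            F x = Real.sqrt (Real.log 2 / (2 * Real.pi)) *
              X ^ ((1:ℝ)/2 + 1 / Real.log 2) *
              Real.exp (-(Real.log (X * Real.log X))^2 / (2 * Real.log 2)
                - P (Real.logb 2 (X * Real.log X))) * (1 + E) ∧
            |E| ≤ C * (Real.log (Real.log X))^2 / Real.log X := by
  refine ⟨200000000, by norm_num, Real.exp (-Real.exp 10), Real.exp_pos _, ?_, ?_⟩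
  · rw [Real.exp_lt_one_iff]; linarith [Real.exp_pos 10]
  intro x hx hx0 X hX
  have hL := log_two_pos'
  have hL1 : Real.log 2 < 1 := by linarith [Real.log_two_lt_d9]
  have hL2 : 1/2 < Real.log 2 := by linarith [Real.log_two_gt_d9]
  have hXpos : 0 < X := by rw [hX]; positivity
  have hXx : X * x * Real.log 2 = 1 := by rw [hX]; field_simp
  have hXbig : Real.exp (Real.exp 10) ≤ X := by
    have h1 : Real.exp (Real.exp 10) * (x * Real.log 2) ≤ 1 := by
      have : x * Real.log 2 ≤ Real.exp (-Real.exp 10) := by nlinarith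
      calc Real.exp (Real.exp 10) * (x * Real.log 2) ≤ Real.exp (Real.exp 10) * Real.exp (-Real.exp 10) := by gcongr
        _ = 1 := by rw [← Real.exp_add]; simp
    rw [hX, le_div_iff₀ (by positivity)]; exact h1
  set l := Real.log X with hl
  set m := Real.log l with hm
  have hl10 : Real.exp 10 ≤ l := (Real.le_log_iff_exp_le hXpos).2 hXbig
  have hlpos : 0 < l := lt_of_lt_of_le (Real.exp_pos _) hl10
  have hm10 : 10 ≤ m := (Real.le_log_iff_exp_le hlpos).2 hl10
  have hlm : l = Real.exp m := (Real.exp_log hlpos).symm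
  have hXl : X = Real.exp l := (Real.exp_log hXpos).symm
  have h6m : 6 * m ≤ l := by
    have := Real.quadratic_le_exp_of_nonneg (by linarith : 0 ≤ m)
    rw [← hlm] at this
    nlinarith
  have hl60 : 60 ≤ l := by linarith
  have hX1 : 1 ≤ X := by rw [hXl]; exact Real.one_le_exp hlpos.le
  set s := X * l with hs
  have hspos : 0 < s := by positivity
  have hls : l ≤ s := by rw [hs]; nlinarith
  have hs1 : 1 ≤ s := by linarith
  have hlogs : Real.log s = l + m := by rw [hs, Real.log_mul hXpos.ne' hlpos.ne']
  obtain ⟨ε, he0, he1, hLS⟩ := LS_asymp hs1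
  set n := s * x with hn
  have hnL : n * Real.log 2 = l := by
    rw [hn, hs]; linear_combination l * hXx
  have hn' : n = l / Real.log 2 := by rw [← hnL]; field_simp
  have hln : l ≤ n := by rw [hn', le_div_iff₀ hL]; nlinarith
  have hnpos : 0 < n := by linarith
  set t := Real.logb 2 s with ht
  have htL : t * Real.log 2 = l + m := by rw [ht, Real.logb, ← hlogs]; field_simp
  have htn : (t - n) * Real.log 2 = m := by linarith
  have htn0 : n ≤ t := by nlinarith
  have htn2 : t ≤ n + 2*m := by nlinarith
  have ht0 : 0 ≤ t := by linarith
  set N := ⌊t⌋₊ + 1 with hN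
  have hNt : t < N := by rw [hN]; push_cast; exact Nat.lt_floor_add_one t
  have hNt2 : (N:ℝ) ≤ t + 1 := by rw [hN]; push_cast; linarith [Nat.floor_le ht0]
  have h2t : (2:ℝ)^t = s := Real.rpow_logb (by norm_num) (by norm_num) hspos
  have h1 : (2:ℝ)^(N-1) ≤ s := by
    rw [← h2t, ← Real.rpow_natCast]
    apply Real.rpow_le_rpow_of_exponent_le (by norm_num)
    rw [hN, Nat.add_sub_cancel]; exact Nat.floor_le ht0
  have h2 : s < (2:ℝ)^N := by
    rw [← h2t, ← Real.rpow_natCast]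
    exact Real.rpow_lt_rpow_of_exponent_lt (by norm_num) hNt
  have hN8 : 8 ≤ N := by
    have : (8:ℝ) ≤ N := by linarith
    exact_mod_cast this
  have hJ := J_rel (s := s) (n := n) (D := 3*m) hN8 h1 h2 (by linarith)
    (by rw [abs_le]; constructor <;> linarith) (by linarith)
  have hinv := inversion hspos hx
  rw [← hn] at hinv
  set J := ∫ v, Real.exp (-rho s v) * Real.cos (n*v - Th s v) with hJd
  set R := Real.sqrt (n/(2*π)) * J with hR
  refine ⟨Real.exp ε * R - 1, ?_, ?_⟩
  · have hpi := Real.pi_pos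
    rw [hinv, hLS, hR]
    have hsq : Real.sqrt (Real.log 2/(2*π)) * Real.sqrt (n/(2*π)) = Real.exp (m/2)/(2*π) := by
      rw [← Real.sqrt_mul (by positivity)]
      have : Real.log 2/(2*π) * (n/(2*π)) = (Real.exp (m/2)/(2*π))^2 := by
        rw [div_pow, ← Real.exp_nat_mul, show ((2:ℕ):ℝ) * (m/2) = m by push_cast; ring, ← hlm, ← hnL]
        field_simp
      rw [this, Real.sqrt_sq (by positivity)]
    have hsexp : s = Real.exp (l + m) := by rw [← hlogs, Real.exp_log hspos]
    have hXp : X ^ ((1:ℝ)/2 + 1/Real.log 2) = Real.exp (l * (1/2 + 1/Real.log 2)) := by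
      rw [Real.rpow_def_of_pos hXpos]
    rw [hXp, hlogs]
    have e1 : Real.sqrt (Real.log 2/(2*π)) * Real.exp (l * (1/2 + 1/Real.log 2)) *
        Real.exp (-(l+m)^2/(2*Real.log 2) - P t) * (1 + (Real.exp ε * (Real.sqrt (n/(2*π)) * J) - 1)) =
        (Real.exp (m/2) * Real.exp (l * (1/2 + 1/Real.log 2)) *
        Real.exp (-(l+m)^2/(2*Real.log 2) - P t) * Real.exp ε) / (2*π) * J := by
      linear_combination (Real.exp (l * (1/2 + 1/Real.log 2)) *
        Real.exp (-(l+m)^2/(2*Real.log 2) - P t) * Real.exp ε * J) * hsq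
    rw [e1, ← Real.exp_add, ← Real.exp_add, ← Real.exp_add]
    have e2 : Real.exp (n - ((l+m)^2/(2*Real.log 2) + (l+m)/2 + P t - ε)) * (s/(2*π)) =
      Real.exp (n - ((l+m)^2/(2*Real.log 2) + (l+m)/2 + P t - ε) + (l + m)) / (2*π) := by
      rw [Real.exp_add, ← hsexp]; ring
    rw [e2]
    congr 3
    rw [hn']
    ring
  · have hNl : l ≤ N := by linarith
    have hR1 : |R - 1| ≤ 36000000 * m^2/l := by
      refine hJ.trans ?_
      rw [show 4000000 * (3*m)^2 = 36000000 * m^2 by ring]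
      gcongr
    have heps1 : ε ≤ 1/l := he1.trans (one_div_le_one_div_of_le hlpos hls)
    have heps2 : ε ≤ 1 := heps1.trans (by rw [div_le_one hlpos]; linarith)
    have hexp3 : Real.exp ε ≤ 3 := by
      have := Real.exp_le_exp.2 heps2
      linarith [Real.exp_one_lt_d9]
    have hexp1 : 1 ≤ Real.exp ε := Real.one_le_exp he0
    have hexpd : Real.exp ε - 1 ≤ 3 * ε := by
      have h := Real.add_one_le_exp (-ε)
      have hm' : Real.exp ε * Real.exp (-ε) = 1 := by rw [← Real.exp_add]; simp
      nlinarith [Real.exp_pos ε]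
    have hml : 1/l ≤ m^2/l := by gcongr; nlinarith
    have : Real.exp ε * R - 1 = Real.exp ε * (R - 1) + (Real.exp ε - 1) := by ring
    rw [this]
    have hnn : 0 ≤ m^2/l := by positivity
    calc |Real.exp ε * (R - 1) + (Real.exp ε - 1)| ≤ |Real.exp ε * (R - 1)| + |Real.exp ε - 1| := abs_add_le _ _
      _ = Real.exp ε * |R - 1| + (Real.exp ε - 1) := by
        rw [abs_mul, abs_of_pos (Real.exp_pos _), abs_of_nonneg (by linarith : 0 ≤ Real.exp ε - 1)]
      _ ≤ 3 * (36000000 * m^2/l) + 3 * (m^2/l) := by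
        gcongr
        linarith
      _ ≤ 200000000 * m^2/l := by
        have e1 : 36000000 * m^2/l = 36000000 * (m^2/l) := by ring
        have e2 : 200000000 * m^2/l = 200000000 * (m^2/l) := by ring
        rw [e1, e2]; linarith
end
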